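/- arXiv:1709.06441 — 3 statements merged into one kernel-verified Lean document; each statement's English description precedes it below -/
import Mathlib

section
/- If a group H contains a malcharacteristic subgroup which is a free group of rank m for some m > 1 (possibly countably infinite), then for every n ∈ ℕ⁺ ∪ {ℵ₀} the group H contains a malcharacteristic subgroup which is a free group of rank n. -/
/-- A subgroup `M ≤ H` is malcharacteristic if for every automorphism `δ` of `H`,
`δ(M) ∩ M ≠ 1` implies that `δ` is conjugation by an element of `M`. -/
def Malcharacteristic {H : Type*} [Group H] (M : Subgroup H) : Prop :=
  ∀ δ : MulAut H, (∃ x ∈ M, x ≠ 1 ∧ δ x ∈ M) →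
    ∃ m ∈ M, ∀ h : H, δ h = m⁻¹ * h * m

/-- The subgroup `M` is a free group of rank `n`. -/
def IsFreeOfRank {H : Type*} [Group H] (M : Subgroup H) (n : Cardinal) : Prop :=
  ∃ ι : Type, Cardinal.mk ι = n ∧ Nonempty (↥M ≃* FreeGroup ι)

/-- An injective homomorphism with malnormal image. -/
def MalnHom {A B : Type*} [Group A] [Group B] (f : A →* B) : Prop :=
  Function.Injective f ∧ ∀ (g : B) (x y : A), x ≠ 1 → f x * g = g * f y → g ∈ f.range

theorem MalnHom.comp {A B C : Type*} [Group A] [Group B] [Group C] {f : A →* B} {g : B →* C}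
    (hg : MalnHom g) (hf : MalnHom f) : MalnHom (g.comp f) := by
  refine ⟨hg.1.comp hf.1, ?_⟩
  intro c x y hx h
  have hfx : f x ≠ 1 := fun h1 => hx (hf.1 (by rw [h1, map_one]))
  obtain ⟨b, rfl⟩ := hg.2 c (f x) (f y) hfx h
  have h2 : f x * b = b * f y := hg.1 (by simpa using h)
  obtain ⟨a, rfl⟩ := hf.2 b x y hx h2
  exact ⟨a, rfl⟩

theorem MalnHom.of_equiv {A B : Type*} [Group A] [Group B] (e : A ≃* B) :
    MalnHom e.toMonoidHom :=
  ⟨e.injective, fun g _ _ _ _ => ⟨e.symm g, by simp⟩⟩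

theorem freeGroup_comm_subsingleton {X : Type*}
    (h : ∀ a b : FreeGroup X, a * b = b * a) (x y : X) : x = y := by
  classical
  by_contra hxy
  let f : FreeGroup X →* Equiv.Perm (Fin 3) :=
    FreeGroup.lift (fun z => if z = x then Equiv.swap 0 1 else Equiv.swap 1 2)
  have h1 := congrArg f (h (FreeGroup.of x) (FreeGroup.of y))
  have hy : ¬ y = x := fun e => hxy e.symm
  simp only [f, map_mul, FreeGroup.lift_apply_of, if_true, if_neg hy] at h1
  revert h1
  decide

theorem freeGroup_subsingleton_cyclic {X : Type*} (hX : ∀ x y : X, x = y) :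
    ∃ u : FreeGroup X, ∀ g, ∃ k : ℤ, g = u ^ k := by
  by_cases hne : Nonempty X
  · obtain ⟨x0⟩ := hne
    refine ⟨FreeGroup.of x0, fun g => ?_⟩
    induction g using FreeGroup.induction_on with
    | C1 => exact ⟨0, by simp⟩
    | of x => exact ⟨1, by simp [hX x x0]⟩
    | inv_of x _ => exact ⟨-1, by simp [hX x x0]⟩
    | mul a b ha hb =>
      obtain ⟨m, rfl⟩ := ha
      obtain ⟨k, rfl⟩ := hb
      exact ⟨m + k, by rw [zpow_add]⟩
  · refine ⟨1, fun g => ⟨0, ?_⟩⟩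
    have : IsEmpty X := not_nonempty_iff.mp hne
    exact Subsingleton.elim _ _

theorem freeGroup_commute_powers {β : Type*} (h x : FreeGroup β) (hc : h * x = x * h) :
    ∃ (u : FreeGroup β) (m k : ℤ), h = u ^ m ∧ x = u ^ k := by
  let K : Subgroup (FreeGroup β) := Subgroup.closure {h, x}
  have hcomm : ∀ a ∈ ({h, x} : Set (FreeGroup β)), ∀ b ∈ ({h, x} : Set (FreeGroup β)),
      a * b = b * a := by
    rintro a (rfl | rfl) b (rfl | rfl) <;> first | rfl | exact hc | exact hc.symm
  have hK : ∀ a b : K, a * b = b * a :=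
    fun a b => (Subgroup.isMulCommutative_closure hcomm).is_comm.comm a b
  let e := IsFreeGroup.toFreeGroup K
  have hF : ∀ a b : FreeGroup (IsFreeGroup.Generators K), a * b = b * a := by
    intro a b
    apply e.symm.injective
    rw [map_mul, map_mul, hK]
  obtain ⟨u, hu⟩ := freeGroup_subsingleton_cyclic (freeGroup_comm_subsingleton hF)
  have key : ∀ a : K, ∃ k : ℤ, (a : FreeGroup β) = ((e.symm u : K) : FreeGroup β) ^ k := by
    intro a
    obtain ⟨k, hk⟩ := hu (e a)
    refine ⟨k, ?_⟩
    have : a = (e.symm u) ^ k := by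
      rw [← map_zpow, ← hk]; simp
    rw [← Subgroup.coe_zpow, ← this]
  obtain ⟨m, hm⟩ := key ⟨h, Subgroup.subset_closure (by simp)⟩
  obtain ⟨k, hk⟩ := key ⟨x, Subgroup.subset_closure (by simp)⟩
  exact ⟨_, m, k, hm, hk⟩

/-- Retracts of free groups are malnormal. -/
theorem MalnHom.of_retract {α β : Type*} (f : FreeGroup α →* FreeGroup β)
    (r : FreeGroup β →* FreeGroup α) (hr : ∀ x, r (f x) = x) : MalnHom f := by
  refine ⟨Function.LeftInverse.injective hr, ?_⟩
  intro g x y hx h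
  have h1 : x * r g = r g * y := by
    have := congrArg r h
    simpa [hr] using this
  have h2 : f x * f (r g) = f (r g) * f y := by rw [← map_mul, h1, map_mul]
  -- c = g * f (r g)⁻¹ commutes with f x
  have hc : (g * (f (r g))⁻¹) * f x = f x * (g * (f (r g))⁻¹) := by
    have h3 : f y = (f (r g))⁻¹ * f x * f (r g) := by
      rw [mul_assoc, h2]; group
    rw [h3] at h
    rw [← mul_assoc (f x), h]; group
  obtain ⟨u, m, k, hm, hk⟩ := freeGroup_commute_powers _ _ hc
  have hrm : (r u) ^ m = 1 := by
    rw [← map_zpow, ← hm]; simp [hr]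
  have hrk : x = (r u) ^ k := by
    rw [← map_zpow, ← hk, hr]
  have hm0 : m = 0 := by
    by_contra hne
    have : r u = 1 := zpow_left_injective hne (by simpa using hrm)
    rw [this, one_zpow] at hrk
    exact hx hrk
  rw [hm0, zpow_zero, mul_inv_eq_one] at hm
  exact ⟨r g, hm.symm⟩

/-- The shift action of `ℤ` on the free group on `ℤ`. -/
noncomputable def shiftAct : Multiplicative ℤ →* MulAut (FreeGroup ℤ) where
  toFun n := FreeGroup.freeGroupCongr (Equiv.addRight n.toAdd)
  map_one' := by
    ext x
    induction x using FreeGroup.induction_on <;> simp_all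
  map_mul' a b := by
    ext x
    induction x using FreeGroup.induction_on <;> simp_all [add_comm, add_left_comm]

theorem shiftAct_of (n : Multiplicative ℤ) (z : ℤ) :
    shiftAct n (FreeGroup.of z) = FreeGroup.of (z + n.toAdd) := by
  simp [shiftAct]

theorem pow_three_sidon {u v u' v' : ℕ} (h : (3:ℤ) ^ v + 3 ^ u' = 3 ^ v' + 3 ^ u) (huv : v ≠ u) :
    v = v' := by
  have mono : ∀ {a b : ℕ}, a < b → 3 * (3:ℤ) ^ a ≤ 3 ^ b := by
    intro a b hab
    rw [← pow_succ']
    exact pow_le_pow_right₀ (by norm_num) hab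
  have tri : ∀ a b : ℕ, (a < b ∧ 3 * (3:ℤ) ^ a ≤ 3 ^ b) ∨ (a = b ∧ (3:ℤ) ^ a = 3 ^ b) ∨
      (b < a ∧ 3 * (3:ℤ) ^ b ≤ 3 ^ a) := by
    intro a b
    rcases lt_trichotomy a b with h | h | h
    · exact Or.inl ⟨h, mono h⟩
    · exact Or.inr (Or.inl ⟨h, by rw [h]⟩)
    · exact Or.inr (Or.inr ⟨h, mono h⟩)
  have pos : ∀ a : ℕ, (0:ℤ) < 3 ^ a := fun a => by positivity
  have p1 := pos u
  have p2 := pos v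
  have p3 := pos u'
  have p4 := pos v'
  have t1 := tri u v
  have t2 := tri u u'
  have t3 := tri u v'
  have t4 := tri v u'
  have t5 := tri v v'
  have t6 := tri u' v'
  omega

theorem malnHom_shift {I : Type*} (e : I → ℕ) (he : Function.Injective e) :
    ∃ f : FreeGroup I →* (FreeGroup ℤ ⋊[shiftAct] Multiplicative ℤ), MalnHom f := by
  classical
  let s : I → ℤ := fun i => 3 ^ (2 * e i)
  let r : I → ℤ := fun i => 3 ^ (2 * e i + 1)
  have p3 : ∀ {a b : ℕ}, (3:ℤ) ^ a = 3 ^ b → a = b := fun h =>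
    pow_right_injective₀ (by norm_num) (by norm_num) h
  have hs : Function.Injective s := fun i j h => he (by have := p3 h; omega)
  have hr : Function.Injective r := fun i j h => he (by have := p3 h; omega)
  have hsr : ∀ i j, s i ≠ r j := fun i j h => by have := p3 h; omega
  let b : FreeGroup I →* FreeGroup ℤ :=
    FreeGroup.lift (fun i => FreeGroup.of (s i) * FreeGroup.of (r i))
  let ρ : FreeGroup ℤ →* FreeGroup I := FreeGroup.lift (Function.extend s FreeGroup.of 1)
  let ρ' : FreeGroup ℤ →* FreeGroup I := FreeGroup.lift (Function.extend r FreeGroup.of 1)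
  have hρ : ∀ x, ρ (b x) = x := by
    intro x
    have : ρ.comp b = MonoidHom.id _ := by
      ext i
      have : ¬ ∃ j, s j = r i := fun ⟨j, hj⟩ => hsr j i hj
      simp [ρ, b, hs.extend_apply, Function.extend_apply' _ _ _ this]
    exact DFunLike.congr_fun this x
  have hρ' : ∀ x, ρ' (b x) = x := by
    intro x
    have : ρ'.comp b = MonoidHom.id _ := by
      ext i
      have : ¬ ∃ j, r j = s i := fun ⟨j, hj⟩ => hsr i j hj.symm
      simp [ρ', b, hr.extend_apply, Function.extend_apply' _ _ _ this]
    exact DFunLike.congr_fun this x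
  have hb : MalnHom b := MalnHom.of_retract b ρ hρ
  refine ⟨SemidirectProduct.inl.comp b, SemidirectProduct.inl_injective.comp hb.1, ?_⟩
  rintro ⟨k, n⟩ x y hx h
  have hl : b x * k = k * shiftAct n (b y) := by
    have := congrArg SemidirectProduct.left h
    simpa using this
  by_cases hn : n = 1
  · subst hn
    obtain ⟨z, hz⟩ := hb.2 k x y hx (by simpa using hl)
    refine ⟨z, ?_⟩
    ext <;> simp [hz]
  · exfalso
    have hn0 : n.toAdd ≠ 0 := fun h0 => hn (by simpa using h0)
    have fin : ∀ q : FreeGroup ℤ →* FreeGroup I, (∀ x, q (b x) = x) →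
        (∀ i, q (FreeGroup.of (s i + n.toAdd)) = 1 ∧ q (FreeGroup.of (r i + n.toAdd)) = 1) →
        False := by
      intro q hq hk
      have h1 : (q.comp (shiftAct n).toMonoidHom).comp b = 1 := by
        ext i
        simp [b, shiftAct_of, hk i]
      have h2 : q (shiftAct n (b y)) = 1 := DFunLike.congr_fun h1 y
      have h3 := congrArg q hl
      rw [map_mul, map_mul, h2, hq] at h3
      exact hx (by simpa using h3)
    by_cases c1 : ∃ (u j : ℕ), (∃ i, e i = j) ∧ (3:ℤ) ^ u + n.toAdd = 3 ^ (2 * j)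
    · by_cases c2 : ∃ (u j : ℕ), (∃ i, e i = j) ∧ (3:ℤ) ^ u + n.toAdd = 3 ^ (2 * j + 1)
      · obtain ⟨u, j, _, h1⟩ := c1
        obtain ⟨u', j', _, h2⟩ := c2
        have := pow_three_sidon (u := u) (v := 2 * j) (u' := u') (v' := 2 * j' + 1)
          (by linarith) (by
            intro hh
            rw [hh] at h1
            exact hn0 (by linarith))
        omega
      · refine fin ρ' hρ' fun i => ⟨?_, ?_⟩
        · have : ¬ ∃ j, r j = s i + n.toAdd :=
            fun ⟨j, hj⟩ => c2 ⟨_, e j, ⟨j, rfl⟩, hj.symm⟩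
          simp [ρ', Function.extend_apply' _ _ _ this]
        · have : ¬ ∃ j, r j = r i + n.toAdd :=
            fun ⟨j, hj⟩ => c2 ⟨_, e j, ⟨j, rfl⟩, hj.symm⟩
          simp [ρ', Function.extend_apply' _ _ _ this]
    · refine fin ρ hρ fun i => ⟨?_, ?_⟩
      · have : ¬ ∃ j, s j = s i + n.toAdd :=
          fun ⟨j, hj⟩ => c1 ⟨_, e j, ⟨j, rfl⟩, hj.symm⟩
        simp [ρ, Function.extend_apply' _ _ _ this]
      · have : ¬ ∃ j, s j = r i + n.toAdd :=
          fun ⟨j, hj⟩ => c1 ⟨_, e j, ⟨j, rfl⟩, hj.symm⟩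
        simp [ρ, Function.extend_apply' _ _ _ this]

/-- The free group of rank two as a semidirect product. -/
theorem semidirect_equiv :
    Nonempty ((FreeGroup ℤ ⋊[shiftAct] Multiplicative ℤ) ≃* FreeGroup Bool) := by
  let a : FreeGroup Bool := FreeGroup.of true
  let t : FreeGroup Bool := FreeGroup.of false
  let fn : FreeGroup ℤ →* FreeGroup Bool := FreeGroup.lift (fun z : ℤ => t ^ z * a * t ^ (-z))
  let fg : Multiplicative ℤ →* FreeGroup Bool := zpowersHom _ t
  have hfg : ∀ n : Multiplicative ℤ, fg n = t ^ n.toAdd := fun n => by simp [fg]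
  let Ψ : (FreeGroup ℤ ⋊[shiftAct] Multiplicative ℤ) →* FreeGroup Bool :=
    SemidirectProduct.lift fn fg (by
      intro n
      ext z
      simp only [MonoidHom.comp_apply, MulEquiv.coe_toMonoidHom, shiftAct_of, fn,
        FreeGroup.lift_apply_of, MulAut.conj_apply, hfg]
      rw [add_comm z, neg_add_rev, zpow_add, zpow_add]
      simp only [zpow_neg]
      group)
  let Φ : FreeGroup Bool →* (FreeGroup ℤ ⋊[shiftAct] Multiplicative ℤ) :=
    FreeGroup.lift (fun c => if c then SemidirectProduct.inl (FreeGroup.of 0)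
      else SemidirectProduct.inr (Multiplicative.ofAdd 1))
  have hΦa : Φ a = SemidirectProduct.inl (FreeGroup.of 0) := by simp [Φ, a]
  have hΦt : Φ t = SemidirectProduct.inr (Multiplicative.ofAdd 1) := by simp [Φ, t]
  have h1 : Φ.comp Ψ = MonoidHom.id _ := by
    apply SemidirectProduct.hom_ext
    · apply FreeGroup.ext_hom
      intro z
      have : Φ (t ^ z * a * t ^ (-z)) =
          SemidirectProduct.inl (shiftAct (Multiplicative.ofAdd z) (FreeGroup.of 0)) := by
        rw [SemidirectProduct.inl_aut, map_mul, map_mul, map_zpow, map_zpow, hΦa, hΦt,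
          ← map_zpow SemidirectProduct.inr, ← map_zpow SemidirectProduct.inr, ← ofAdd_zsmul,
          ← ofAdd_zsmul]
        simp
      simpa [Ψ, fn, shiftAct_of] using this
    · apply MonoidHom.ext_mint
      simp [Ψ, hfg, hΦt]
  have h2 : Ψ.comp Φ = MonoidHom.id _ := by
    apply FreeGroup.ext_hom
    rintro (_ | _)
    · show Ψ (Φ t) = t
      rw [hΦt]; simp [Ψ, hfg]
    · show Ψ (Φ a) = a
      rw [hΦa]; simp [Ψ, fn]
  exact ⟨MonoidHom.toMulEquiv Ψ Φ h1 h2⟩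

theorem malnHom_two {ι : Type*} (a t : ι) (hat : a ≠ t) :
    ∃ f : FreeGroup Bool →* FreeGroup ι, MalnHom f := by
  classical
  refine ⟨FreeGroup.lift (fun c => FreeGroup.of (if c then a else t)),
    MalnHom.of_retract _ (FreeGroup.lift (fun z => FreeGroup.of (decide (z = a)))) ?_⟩
  intro x
  induction x using FreeGroup.induction_on with
  | C1 => simp
  | of c => cases c <;> simp [hat.symm]
  | inv_of c h => rw [map_inv, map_inv, h]
  | mul x y hx hy => rw [map_mul, map_mul, hx, hy]

theorem lem_malchar_arb_rank {H : Type*} [Group H] (M : Subgroup H)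
    (hM : Malcharacteristic M)
    (hfree : ∃ m : Cardinal, 1 < m ∧ m ≤ Cardinal.aleph0 ∧ IsFreeOfRank M m) :
    ∀ n : Cardinal, 1 ≤ n → n ≤ Cardinal.aleph0 →
      ∃ N : Subgroup H, Malcharacteristic N ∧ IsFreeOfRank N n := by
  intro n _ hn
  obtain ⟨m, hm, _, ι, hι, ⟨E⟩⟩ := hfree
  rw [← hι, Cardinal.one_lt_iff_nontrivial] at hm
  obtain ⟨a, t, hat⟩ := hm
  obtain ⟨I, rfl⟩ : ∃ I : Type, Cardinal.mk I = n := ⟨n.out, Cardinal.mk_out n⟩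
  have : Countable I := Cardinal.mk_le_aleph0_iff.mp hn
  obtain ⟨e, he⟩ := exists_injective_nat I
  obtain ⟨f1, hf1⟩ := malnHom_shift e he
  obtain ⟨e2⟩ := semidirect_equiv
  obtain ⟨f3, hf3⟩ := malnHom_two a t hat
  obtain ⟨f, hf⟩ : ∃ f : FreeGroup I →* M, MalnHom f :=
    ⟨_, (MalnHom.of_equiv E.symm).comp (hf3.comp ((MalnHom.of_equiv e2).comp hf1))⟩
  have hinj : Function.Injective (M.subtype.comp f) := M.subtype_injective.comp hf.1
  refine ⟨(M.subtype.comp f).range, ?_, I, rfl, ⟨(MonoidHom.ofInjective hinj).symm⟩⟩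
  rintro δ ⟨_, ⟨x, rfl⟩, hx1, ⟨y, hy⟩⟩
  have hx : x ≠ 1 := by
    rintro rfl
    exact hx1 (map_one _)
  obtain ⟨g, hg, hδ⟩ := hM δ ⟨(f x : H), (f x).2, hx1, by
    have : (f y : H) = δ (f x : H) := hy
    rw [← this]; exact (f y).2⟩
  have h1 : (f y : H) = g⁻¹ * (f x : H) * g := by
    rw [← hδ]; exact hy
  obtain ⟨z, hz⟩ := hf.2 ⟨g, hg⟩ x y hx (by
    ext
    simp only [Subgroup.coe_mul, h1]
    group)
  exact ⟨g, ⟨z, by simp [hz]⟩, hδ⟩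
end

section
/- There exists ρ₀ ∈ ℕ such that for all integers ρ ≥ ρ₀ the following holds: in the free group F(a,b) of rank two, let ω_x = (a³b³)(a³b⁴)⋯(a³b^{ρ+2}) (the concatenation of the words a³b^m for m = 3, …, ρ+2) and ω_y = (a³b^{ρ+3})(a³b^{ρ+4})⋯(a³b^{2ρ+2}) (the concatenation of a³b^m for m = ρ+3, …, 2ρ+2). Then the subgroup L = ⟨ω_x, ω_y⟩ of F(a,b) is non-cyclic and malcharacteristic in F(a,b). -/
/-- The generator `a` of the free group of rank two. -/
def fa : FreeGroup (Fin 2) := FreeGroup.of 0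

/-- The generator `b` of the free group of rank two. -/
def fb : FreeGroup (Fin 2) := FreeGroup.of 1

/-- The word `ω_x = a³b³ a³b⁴ ⋯ a³b^{ρ+2}`. -/
def omegaX (ρ : ℕ) : FreeGroup (Fin 2) :=
  (((List.range ρ).map fun m => fa ^ 3 * fb ^ (m + 3))).prod

/-- The word `ω_y = a³b^{ρ+3} a³b^{ρ+4} ⋯ a³b^{2ρ+2}`. -/
def omegaY (ρ : ℕ) : FreeGroup (Fin 2) :=
  (((List.range ρ).map fun m => fa ^ 3 * fb ^ (m + ρ + 3))).prod


namespace MC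
open FreeGroup hiding map_mul map_inv map_one

abbrev F2 := FreeGroup (Fin 2)
abbrev Lt := Fin 2 × Bool

theorem toWord_mk_of_red {L : List Lt} (h : IsReduced L) : (mk L : F2).toWord = L := by
  rw [toWord_mk, h.reduce_eq]

theorem isReduced_append {A B : List Lt} : IsReduced (A ++ B) ↔ IsReduced A ∧ IsReduced B ∧
    ∀ x ∈ A.getLast?, ∀ y ∈ B.head?, x.1 = y.1 → x.2 = y.2 := by
  unfold FreeGroup.IsReduced
  exact List.isChain_append

theorem red_left {A B : List Lt} (h : IsReduced (A ++ B)) : IsReduced A :=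
  (isReduced_append.1 h).1
theorem red_right {A B : List Lt} (h : IsReduced (A ++ B)) : IsReduced B :=
  (isReduced_append.1 h).2.1

theorem isReduced_invRev {A : List Lt} (h : IsReduced A) : IsReduced (invRev A) := by
  rw [isReduced_iff_reduce_eq] at *
  rw [reduce_invRev, h]

/-- cancellation at the list level -/
theorem cancel_list (A : List Lt) : ∀ B : List Lt, IsReduced A → IsReduced B →
    ∃ A' p B', A = A' ++ p ∧ B = invRev p ++ B' ∧ IsReduced (A' ++ B') := by
  induction A using List.reverseRecOn with
  | nil => intro B _ hB; exact ⟨[], [], B, by simp, by simp, by simpa using hB⟩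
  | append_singleton A x ih =>
    intro B hA hB
    by_cases hc : ∃ B0, B = (x.1, !x.2) :: B0
    · obtain ⟨B0, rfl⟩ := hc
      obtain ⟨A', p, B', h1, h2, h3⟩ := ih B0 (red_left hA)
        (red_right (A := [(x.1, !x.2)]) (by simpa using hB))
      refine ⟨A', p ++ [x], B', by simp [h1], ?_, h3⟩
      rw [invRev_append, h2]; simp [invRev]
    · refine ⟨A ++ [x], [], B, by simp, by simp, ?_⟩
      refine isReduced_append.2 ⟨hA, hB, ?_⟩
      intro y hy z hz
      simp at hy
      subst hy
      cases B with
      | nil => simp at hz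
      | cons z' B0 =>
        simp at hz
        subst hz
        intro h1
        by_contra h2
        apply hc
        refine ⟨B0, ?_⟩
        congr 1
        ext1
        · exact h1.symm
        · revert h2; generalize x.2 = s; generalize z'.2 = t
          cases s <;> cases t <;> simp

theorem cancel (g h : F2) : ∃ A p B, g.toWord = A ++ p ∧ h.toWord = invRev p ++ B ∧
    (g * h).toWord = A ++ B := by
  obtain ⟨A, p, B, h1, h2, h3⟩ := cancel_list g.toWord h.toWord isReduced_toWord isReduced_toWord
  refine ⟨A, p, B, h1, h2, ?_⟩
  have : g * h = mk (A ++ B) := by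
    rw [← mk_toWord (x := g), ← mk_toWord (x := h), h1, h2, ← mul_mk, ← mul_mk, ← mul_mk, ← inv_mk]
    group
  rw [this, toWord_mk_of_red h3]

theorem mk_eq_of_left {g : F2} {A B : List Lt} (h : g.toWord = A ++ B) : g = mk A * mk B := by
  rw [← mk_toWord (x := g), h, mul_mk]

theorem left_stable (g h : F2) {U P : List Lt} (hh : h.toWord = U ++ P) (hU : g.norm < U.length) :
    ∃ U', (g * h).toWord = U' ++ P ∧ U.length ≤ U'.length + g.norm := by
  obtain ⟨A, p, B, h1, h2, h3⟩ := cancel g h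
  have hp : p.length + A.length = g.norm := by simp [FreeGroup.norm, h1, add_comm]
  rw [hh] at h2
  rw [List.append_eq_append_iff] at h2
  rcases h2 with ⟨C, h4, h5⟩ | ⟨C, h4, h5⟩
  · have : (invRev p).length = U.length + C.length := by rw [h4]; simp
    simp at this
    omega
  · refine ⟨A ++ C, by rw [h3, h5]; simp, ?_⟩
    rw [h4]; simp; omega

theorem mk_of_append {g : F2} {U P U' : List Lt} {h : F2} (h1 : h.toWord = U ++ P)
    (h2 : (g * h).toWord = U' ++ P) : (mk U' : F2) = g * mk U := by
  have e1 := mk_eq_of_left h1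
  have e2 := mk_eq_of_left h2
  rw [e1, ← mul_assoc] at e2
  exact (mul_right_cancel e2).symm

theorem right_stable (g h : F2) {V P : List Lt} (hh : h.toWord = P ++ V) (hU : g.norm < V.length) :
    ∃ V', (h * g).toWord = P ++ V' ∧ V.length ≤ V'.length + g.norm := by
  have := left_stable g⁻¹ h⁻¹ (U := invRev V) (P := invRev P) (by rw [toWord_inv, hh, invRev_append])
    (by simpa using hU)
  obtain ⟨U', h1, h2⟩ := this
  refine ⟨invRev U', ?_, by simpa using h2⟩
  have h3 : h * g = (g⁻¹ * h⁻¹)⁻¹ := by group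
  rw [h3, toWord_inv, h1, invRev_append, invRev_invRev]

theorem conj_stable (g h : F2) {U P V : List Lt} (hh : h.toWord = U ++ P ++ V)
    (hU : g.norm < U.length) (hV : g.norm < V.length) :
    ∃ U' V', (g * h * g⁻¹).toWord = U' ++ P ++ V' ∧ (mk U' : F2) = g * mk U ∧
      U.length ≤ U'.length + g.norm ∧ V.length ≤ V'.length + g.norm := by
  obtain ⟨U', h1, h2⟩ := left_stable g h (U := U) (P := P ++ V) (by rw [hh]; simp) hU
  obtain ⟨V', h3, h4⟩ := right_stable g⁻¹ (g * h) (P := U' ++ P) (V := V) (by rw [h1]; simp)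
    (by simpa using hV)
  refine ⟨U', V', h3, ?_, h2, by simpa using h4⟩
  exact mk_of_append (h := h) (P := P ++ V) (by rw [hh]; simp) h1

/-- words occurring arbitrarily deep in powers of `w` -/
def Lang (w : F2) (p : List Lt) : Prop :=
  ∀ K : ℕ, ∃ n : ℤ, ∃ U V : List Lt, K ≤ U.length ∧ K ≤ V.length ∧ (w ^ n).toWord = U ++ p ++ V

theorem Lang.factor {w : F2} {A p B : List Lt} (h : Lang w (A ++ p ++ B)) : Lang w p := by
  intro K
  obtain ⟨n, U, V, h1, h2, h3⟩ := h K
  exact ⟨n, U ++ A, B ++ V, by simp; omega, by simp; omega, by rw [h3]; simp⟩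

theorem Lang.inv {w : F2} {p : List Lt} (h : Lang w p) : Lang w (invRev p) := by
  intro K
  obtain ⟨n, U, V, h1, h2, h3⟩ := h K
  exact ⟨-n, invRev V, invRev U, by simpa, by simpa, by
    rw [zpow_neg, toWord_inv, h3, invRev_append, invRev_append, List.append_assoc]⟩

theorem Lang.conj {w : F2} {p : List Lt} (h : Lang w p) (g : F2) : Lang (g * w * g⁻¹) p := by
  intro K
  obtain ⟨n, U, V, h1, h2, h3⟩ := h (K + g.norm + 1)
  obtain ⟨U', V', h4, -, h5, h6⟩ := conj_stable g _ h3 (by omega) (by omega)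
  refine ⟨n, U', V', by omega, by omega, ?_⟩
  rw [conj_zpow, h4]

theorem Lang.map {w : F2} {p : List Lt} (h : Lang w p) (φ : MulAut F2) (f : Lt → Lt)
    (hf : ∀ g, (φ g).toWord = g.toWord.map f) : Lang (φ w) (p.map f) := by
  intro K
  obtain ⟨n, U, V, h1, h2, h3⟩ := h K
  exact ⟨n, U.map f, V.map f, by simpa, by simpa, by rw [← map_zpow, hf, h3]; simp⟩

end MC

namespace MC
open FreeGroup hiding map_mul map_inv map_one

def gE : F2 →* F2 := FreeGroup.lift ![of 0 * of 1, of 1]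
def gEi : F2 →* F2 := FreeGroup.lift ![of 0 * (of 1)⁻¹, of 1]

/-- the elementary automorphism `a ↦ ab, b ↦ b` -/
def aE : MulAut F2 := MonoidHom.toMulEquiv gE gEi
  (by ext i; fin_cases i <;> simp [gE, gEi])
  (by ext i; fin_cases i <;> simp [gE, gEi])

@[simp] theorem aE_a : aE (of 0) = of 0 * of 1 := by simp [aE, gE]
@[simp] theorem aE_b : aE (of 1) = of 1 := by simp [aE, gE]
@[simp] theorem aEi_a : aE⁻¹ (of 0) = of 0 * (of 1)⁻¹ := by
  rw [MulAut.inv_apply, MulEquiv.symm_apply_eq]; simp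
@[simp] theorem aEi_b : aE⁻¹ (of 1) = of 1 := by
  rw [MulAut.inv_apply, MulEquiv.symm_apply_eq]; simp

theorem mk_cons (x : Lt) (V : List Lt) : (mk (x :: V) : F2) = mk [x] * mk V := by
  rw [mul_mk]; rfl

theorem mk_at : (mk [((0 : Fin 2), true)] : F2) = of 0 := rfl
theorem mk_bt : (mk [((1 : Fin 2), true)] : F2) = of 1 := rfl
theorem mk_af : (mk [((0 : Fin 2), false)] : F2) = (of 0)⁻¹ := rfl
theorem mk_bf : (mk [((1 : Fin 2), false)] : F2) = (of 1)⁻¹ := rfl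

theorem toWord_mul' (L : List Lt) (h : F2) : (mk L * h).toWord = reduce (L ++ h.toWord) := by
  conv_lhs => rw [← mk_toWord (x := h), mul_mk, toWord_mk]

theorem lt_cases (x : Lt) : x = (0, true) ∨ x = (0, false) ∨ x = (1, true) ∨ x = (1, false) := by
  revert x; decide

/-- how `aE` acts on heads -/
structure HeadInv (V Z : List Lt) : Prop where
  nil : V = [] → Z = []
  a : V.head? = some (0, true) → Z.head? = some (0, true)
  A : V.head? = some (0, false) → ∃ Z', Z = (1, false) :: (0, false) :: Z'
  b : V.head? = some (1, true) → Z.head? = some (1, true) ∨ Z.head? = some (0, false)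
  B : V.head? = some (1, false) → ∃ Z', Z = (1, false) :: Z' ∧ Z'.head? ≠ some (0, false)

theorem headInv (V : List Lt) (hV : IsReduced V) : HeadInv V (aE (mk V)).toWord := by
  induction V with
  | nil =>
    have : (mk [] : F2) = 1 := rfl
    constructor <;> simp [this]
  | cons x V ih =>
    have hV' : IsReduced V := red_right (A := [x]) (by simpa using hV)
    have ih := ih hV'
    have hZ : reduce (aE (mk V)).toWord = (aE (mk V)).toWord := reduce_toWord _
    have key : ∀ M : List Lt, aE (mk [x]) = mk M →
      (aE (mk (x :: V))).toWord = reduce (M ++ (aE (mk V)).toWord) := by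
      intro M hM
      rw [mk_cons, map_mul, hM, toWord_mul']
    have hhead : ∀ y ∈ V.head?, x.1 = y.1 → x.2 = y.2 := by
      have := isReduced_append (A := [x]) (B := V) |>.1 (by simpa using hV)
      intro y hy
      exact this.2.2 x (by simp) y hy
    generalize hz : (aE (mk V)).toWord = Z at *
    obtain ⟨i1, i2, i3, i4, i5⟩ := ih
    rcases lt_cases x with rfl | rfl | rfl | rfl
    · have k := key [(0, true), (1, true)] (by rw [mk_at, aE_a]; rfl)
      rw [k]
      simp only [List.cons_append, List.nil_append, reduce.cons, hZ]
      cases V with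
      | nil => have := i1 rfl; subst this; constructor <;> simp
      | cons y V =>
        rcases lt_cases y with rfl | rfl | rfl | rfl
        · cases Z <;> simp at i2; subst i2; constructor <;> simp
        · simp at hhead
        · cases Z <;> simp at i4
          rcases i4 with rfl | rfl <;> constructor <;> simp
        · obtain ⟨Z', rfl, h⟩ := i5 (by simp)
          cases Z' with
          | nil => constructor <;> simp
          | cons z Z' =>
            simp at h
            rcases lt_cases z with rfl | rfl | rfl | rfl <;> simp at h <;> constructor <;> simp
    · have k := key [(1, false), (0, false)] (by rw [mk_af, map_inv, aE_a]; rfl)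
      rw [k]
      simp only [List.cons_append, List.nil_append, reduce.cons, hZ]
      cases V with
      | nil => have := i1 rfl; subst this; constructor <;> simp
      | cons y V =>
        rcases lt_cases y with rfl | rfl | rfl | rfl
        · simp at hhead
        · obtain ⟨Z', rfl⟩ := i3 (by simp)
          constructor <;> simp
        · cases Z <;> simp at i4
          rcases i4 with rfl | rfl <;> constructor <;> simp
        · obtain ⟨Z', rfl, h⟩ := i5 (by simp)
          constructor <;> simp
    · have k := key [(1, true)] (by rw [mk_bt, aE_b])
      rw [k]
      simp only [List.cons_append, List.nil_append, reduce.cons, hZ]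
      cases V with
      | nil => have := i1 rfl; subst this; constructor <;> simp
      | cons y V =>
        rcases lt_cases y with rfl | rfl | rfl | rfl
        · cases Z <;> simp at i2; subst i2; constructor <;> simp
        · obtain ⟨Z', rfl⟩ := i3 (by simp)
          constructor <;> simp
        · cases Z <;> simp at i4
          rcases i4 with rfl | rfl <;> constructor <;> simp
        · simp at hhead
    · have k := key [(1, false)] (by rw [mk_bf, map_inv, aE_b])
      rw [k]
      simp only [List.cons_append, List.nil_append, reduce.cons, hZ]
      cases V with
      | nil => have := i1 rfl; subst this; constructor <;> simp
      | cons y V =>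
        rcases lt_cases y with rfl | rfl | rfl | rfl
        · cases Z <;> simp at i2; subst i2; constructor <;> simp
        · obtain ⟨Z', rfl⟩ := i3 (by simp)
          constructor <;> simp
        · simp at hhead
        · obtain ⟨Z', rfl, h⟩ := i5 (by simp)
          constructor <;> simp

/-- left contexts -/
theorem ctx_left {U : List Lt} (hU : IsReduced U) (i : Fin 2)
    (h : U.head? ≠ some (i, true)) : (aE (mk U)).toWord.head? ≠ some (i, true) := by
  obtain ⟨i1, i2, i3, i4, i5⟩ := headInv U hU
  generalize (aE (mk U)).toWord = Z at *
  cases U with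
  | nil => rw [i1 rfl]; simp
  | cons y V =>
    rcases lt_cases y with rfl | rfl | rfl | rfl
    · cases Z <;> simp at i2; subst i2
      revert h; fin_cases i <;> simp
    · obtain ⟨Z', rfl⟩ := i3 (by simp)
      revert h; fin_cases i <;> simp
    · cases Z <;> simp at i4
      rcases i4 with rfl | rfl <;> revert h <;> fin_cases i <;> simp
    · obtain ⟨Z', rfl, h⟩ := i5 (by simp)
      revert h; fin_cases i <;> simp

theorem ctx_right {V : List Lt} (hV : IsReduced V) (i : Fin 2)
    (h : V.head? ≠ some (i, false)) : (of 1 * aE (mk V)).toWord.head? ≠ some (i, false) := by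
  obtain ⟨i1, i2, i3, i4, i5⟩ := headInv V hV
  have hZ : reduce (aE (mk V)).toWord = (aE (mk V)).toWord := reduce_toWord _
  have k : (of 1 * aE (mk V)).toWord = reduce ([(1, true)] ++ (aE (mk V)).toWord) := by
    rw [← toWord_mul']; rfl
  rw [k]
  simp only [List.cons_append, List.nil_append, reduce.cons, hZ]
  generalize (aE (mk V)).toWord = Z at *
  cases V with
  | nil => rw [i1 rfl]; simp
  | cons y V =>
    rcases lt_cases y with rfl | rfl | rfl | rfl
    · cases Z <;> simp at i2; subst i2
      revert h; fin_cases i <;> simp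
    · obtain ⟨Z', rfl⟩ := i3 (by simp)
      revert h; fin_cases i <;> simp
    · cases Z <;> simp at i4
      rcases i4 with rfl | rfl <;> revert h <;> fin_cases i <;> simp
    · obtain ⟨Z', rfl, h'⟩ := i5 (by simp)
      revert h
      fin_cases i
      · simpa using h'
      · simp

theorem aE_norm (g : F2) : g.norm ≤ 2 * (aE g).norm := by
  have key : ∀ L : List Lt, (aE⁻¹ (mk L)).norm ≤ 2 * L.length := by
    intro L
    induction L with
    | nil => 
      have : (mk [] : F2) = 1 := rfl
      simp [this]
    | cons x L ih =>
      rw [mk_cons, map_mul]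
      have h1 := norm_mul_le (aE⁻¹ (mk [x])) (aE⁻¹ (mk L))
      have h2 : (aE⁻¹ (mk [x])).norm ≤ 2 := by
        rcases lt_cases x with rfl | rfl | rfl | rfl
        · rw [mk_at, aEi_a]; decide
        · rw [mk_af, map_inv, aEi_a]; decide
        · rw [mk_bt, aEi_b]; decide
        · rw [mk_bf, map_inv, aEi_b]; decide
      simp only [List.length_cons]
      omega
  have := key (aE g).toWord
  rw [mk_toWord] at this
  simpa [FreeGroup.norm] using this

theorem Lang.aE {w : F2} {p p' : List Lt} (i j : Fin 2) (h : Lang w p)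
    (hE : MC.aE (mk p) = mk (p' ++ [(1, true)])) (hr : IsReduced p')
    (h1 : p.head? = some (i, true)) (h1' : p'.head? = some (i, true))
    (h2 : p.getLast? = some (j, true)) (h2' : p'.getLast? = some (j, true)) :
    Lang (MC.aE w) p' := by
  intro K
  obtain ⟨n, U, V, hU, hV, hw⟩ := h (2 * (K + 1))
  have hred : IsReduced (U ++ p ++ V) := by rw [← hw]; exact isReduced_toWord
  obtain ⟨r1, rV, r2⟩ := isReduced_append.1 hred
  obtain ⟨rU, rp, r3⟩ := isReduced_append.1 r1
  have nU : (MC.aE (mk U)).toWord.getLast? ≠ some (i, false) := by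
    have := ctx_left (isReduced_invRev rU) i (by
      intro hh
      have : U.getLast? = some (i, false) := by
        simpa [invRev] using hh
      have := r3 _ this _ h1
      simp at this)
    rw [← inv_mk, map_inv, toWord_inv] at this
    intro hh
    apply this
    simp [invRev, hh]
  have nV : (of 1 * MC.aE (mk V)).toWord.head? ≠ some (j, false) := by
    apply ctx_right rV
    intro hh
    have := r2 (j, true) (by simp [h2]) _ hh
    simp at this
  have hrr : IsReduced ((MC.aE (mk U)).toWord ++ p' ++ (of 1 * MC.aE (mk V)).toWord) := by
    refine isReduced_append.2 ⟨isReduced_append.2 ⟨isReduced_toWord, hr, ?_⟩, isReduced_toWord, ?_⟩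
    · intro x hx y hy
      rw [h1'] at hy
      simp at hy; subst hy
      obtain ⟨x1, x2⟩ := x
      rintro rfl
      cases x2
      · exact absurd hx nU
      · rfl
    · intro x hx y hy
      have : x = (j, true) := by
        rw [Option.mem_def, List.getLast?_append, h2'] at hx; simpa using hx.symm
      subst this
      obtain ⟨x1, x2⟩ := y
      rintro rfl
      cases x2
      · exact absurd hy nV
      · rfl
  refine ⟨n, (MC.aE (mk U)).toWord, (of 1 * MC.aE (mk V)).toWord, ?_, ?_, ?_⟩
  · have := aE_norm (mk U)
    have e : (mk U : F2).norm = U.length := by rw [FreeGroup.norm, toWord_mk_of_red rU]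
    rw [e, FreeGroup.norm] at this
    omega
  · have := aE_norm (mk V)
    have e : (mk V : F2).norm = V.length := by rw [FreeGroup.norm, toWord_mk_of_red rV]
    have t := norm_mul_le (of 1)⁻¹ (of 1 * MC.aE (mk V))
    rw [inv_mul_cancel_left, norm_inv_eq, norm_of] at t
    have t' : (of 1 * MC.aE (mk V)).norm = (of 1 * MC.aE (mk V)).toWord.length := rfl
    omega
  · rw [← toWord_mk_of_red hrr, ← map_zpow]
    congr 1
    rw [← mk_toWord (x := w ^ n), hw, ← mul_mk, ← mul_mk, ← mul_mk, ← mul_mk, map_mul, map_mul, hE,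
      mk_toWord, mk_toWord, ← mul_mk, mk_bt]
    group

end MC

namespace MC
open FreeGroup hiding map_mul map_inv map_one

theorem aut_ext {φ ψ : MulAut F2} (h0 : φ (of 0) = ψ (of 0)) (h1 : φ (of 1) = ψ (of 1)) :
    φ = ψ := by
  have : φ.toMonoidHom = ψ.toMonoidHom := by
    ext i
    fin_cases i
    · exact h0
    · exact h1
  ext x
  exact DFunLike.congr_fun this x

def gSw : F2 →* F2 := FreeGroup.lift ![of 1, of 0]
def gTa : F2 →* F2 := FreeGroup.lift ![(of 0)⁻¹, of 1]

def sw : MulAut F2 := MonoidHom.toMulEquiv gSw gSw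
  (by ext i; fin_cases i <;> simp [gSw]) (by ext i; fin_cases i <;> simp [gSw])
def ta : MulAut F2 := MonoidHom.toMulEquiv gTa gTa
  (by ext i; fin_cases i <;> simp [gTa]) (by ext i; fin_cases i <;> simp [gTa])

@[simp] theorem sw_a : sw (of 0) = of 1 := by simp [sw, gSw]
@[simp] theorem sw_b : sw (of 1) = of 0 := by simp [sw, gSw]
@[simp] theorem ta_a : ta (of 0) = (of 0)⁻¹ := by simp [ta, gTa]
@[simp] theorem ta_b : ta (of 1) = of 1 := by simp [ta, gTa]

theorem sw_sw : sw * sw = 1 := aut_ext (by simp) (by simp)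
theorem ta_ta : ta * ta = 1 := aut_ext (by simp) (by simp)
theorem sw_inv : sw⁻¹ = sw := inv_eq_of_mul_eq_one_left sw_sw
theorem ta_inv : ta⁻¹ = ta := inv_eq_of_mul_eq_one_left ta_ta

/-- `b ↦ ba` -/
def aE' : MulAut F2 := sw * aE * sw
@[simp] theorem aE'_a : aE' (of 0) = of 0 := by simp [aE']
@[simp] theorem aE'_b : aE' (of 1) = of 1 * of 0 := by simp [aE']
@[simp] theorem aEpi_a : aE'⁻¹ (of 0) = of 0 := by
  rw [MulAut.inv_apply, MulEquiv.symm_apply_eq]; simp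
@[simp] theorem aEpi_b : aE'⁻¹ (of 1) = of 1 * (of 0)⁻¹ := by
  rw [MulAut.inv_apply, MulEquiv.symm_apply_eq]; simp

@[simp] theorem aEs_a : MulEquiv.symm aE (of 0) = of 0 * (of 1)⁻¹ := aEi_a
@[simp] theorem aEs_b : MulEquiv.symm aE (of 1) = of 1 := aEi_b
@[simp] theorem aEps_a : MulEquiv.symm aE' (of 0) = of 0 := aEpi_a
@[simp] theorem aEps_b : MulEquiv.symm aE' (of 1) = of 1 * (of 0)⁻¹ := aEpi_b

/-- signed permutations -/
def W : Subgroup (MulAut F2) := Subgroup.closure {sw, ta}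
theorem sw_mem : sw ∈ W := Subgroup.subset_closure (by simp)
theorem ta_mem : ta ∈ W := Subgroup.subset_closure (by simp)

def fsw (x : Lt) : Lt := (Equiv.swap 0 1 x.1, x.2)
def fta (x : Lt) : Lt := if x.1 = 0 then (x.1, !x.2) else x

/-- `φ` acts letterwise through `f` -/
structure Letterwise (φ : MulAut F2) (f : Lt → Lt) : Prop where
  comm : ∀ x, f (x.1, !x.2) = ((f x).1, !(f x).2)
  inj : Function.Injective f
  word : ∀ g, (φ g).toWord = g.toWord.map f

theorem letterwise_of (φ : MulAut F2) (f : Lt → Lt) (hc : ∀ x, f (x.1, !x.2) = ((f x).1, !(f x).2))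
    (hi : Function.Injective f) (h : ∀ x, φ (mk [x]) = mk [f x]) : Letterwise φ f := by
  refine ⟨hc, hi, ?_⟩
  have h1 : ∀ L : List Lt, φ (mk L) = mk (L.map f) := by
    intro L
    induction L with
    | nil => exact map_one φ
    | cons x L ih => rw [mk_cons, map_mul, ih, h, mul_mk]; rfl
  have h2 : ∀ L : List Lt, IsReduced L → IsReduced (L.map f) := by
    intro L hL
    unfold FreeGroup.IsReduced at *
    rw [List.isChain_map]
    refine List.IsChain.imp ?_ hL
    intro x y hxy hf
    by_contra hne
    have : f x = f (y.1, !y.2) := by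
      rw [hc]
      ext1
      · exact hf
      · revert hne; simp only; generalize (f x).2 = s; generalize (f y).2 = t
        cases s <;> cases t <;> simp
    have := hi this
    rw [this] at hxy
    simp at hxy
  intro g
  conv_lhs => rw [← mk_toWord (x := g), h1]
  exact toWord_mk_of_red (h2 _ isReduced_toWord)

theorem lw_sw : Letterwise sw fsw := by
  apply letterwise_of
  · decide
  · decide
  · intro x
    rcases lt_cases x with rfl | rfl | rfl | rfl
    · rw [mk_at, sw_a]; rfl
    · rw [mk_af, map_inv, sw_a]; rfl
    · rw [mk_bt, sw_b]; rfl
    · rw [mk_bf, map_inv, sw_b]; rfl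

theorem lw_ta : Letterwise ta fta := by
  apply letterwise_of
  · decide
  · decide
  · intro x
    rcases lt_cases x with rfl | rfl | rfl | rfl
    · rw [mk_at, ta_a]; rfl
    · rw [mk_af, map_inv, ta_a]; rfl
    · rw [mk_bt, ta_b]; rfl
    · rw [mk_bf, map_inv, ta_b]; rfl

theorem Letterwise.mul {φ ψ : MulAut F2} {f h : Lt → Lt} (h1 : Letterwise φ f)
    (h2 : Letterwise ψ h) : Letterwise (φ * ψ) (f ∘ h) := by
  refine ⟨fun x => ?_, h1.inj.comp h2.inj, fun g => ?_⟩
  · simp [h1.comm, h2.comm]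
  · rw [MulAut.mul_apply, h1.word, h2.word, List.map_map]

theorem lw_W {τ : MulAut F2} (h : τ ∈ W) : ∃ f, Letterwise τ f := by
  have gen : ∀ y ∈ ({sw, ta} : Set (MulAut F2)), y⁻¹ = y ∧ ∃ f, Letterwise y f := by
    rintro y (rfl | rfl)
    · exact ⟨sw_inv, _, lw_sw⟩
    · exact ⟨ta_inv, _, lw_ta⟩
  induction h using Subgroup.closure_induction_right with
  | one => exact ⟨id, fun x => rfl, Function.injective_id, fun g => by simp⟩
  | mul_right x hx y hy ih =>
    obtain ⟨f, hf⟩ := ih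
    obtain ⟨-, k, hk⟩ := gen y hy
    exact ⟨_, hf.mul hk⟩
  | mul_inv_cancel x hx y hy ih =>
    obtain ⟨f, hf⟩ := ih
    obtain ⟨e, k, hk⟩ := gen y hy
    rw [e]
    exact ⟨_, hf.mul hk⟩

theorem Lang.aE' {w : F2} {p p' : List Lt} (i j : Fin 2) (h : Lang w p)
    (hE : MC.aE (mk (p.map fsw)) = mk (p'.map fsw ++ [(1, true)])) (hr : IsReduced (p'.map fsw))
    (h1 : (p.map fsw).head? = some (i, true)) (h1' : (p'.map fsw).head? = some (i, true))
    (h2 : (p.map fsw).getLast? = some (j, true)) (h2' : (p'.map fsw).getLast? = some (j, true)) :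
    Lang (MC.aE' w) p' := by
  have := ((h.map sw fsw lw_sw.word).aE i j hE hr h1 h1' h2 h2').map sw fsw lw_sw.word
  have e : (p'.map fsw).map fsw = p' := by
    rw [List.map_map]
    convert List.map_id p' 
    funext x; revert x; decide
  rw [e] at this
  exact this

abbrev A1 : Lt := (0, true)
abbrev B1 : Lt := (1, true)

def Pat (w : F2) : Prop := Lang w [B1, A1, B1, B1] ∨ Lang w [A1, A1, B1, A1] ∨
  Lang w [A1, B1, A1, B1, A1] ∨ Lang w [B1, A1, B1, A1, B1]

theorem pat_E_start {w : F2} (h : Lang w [A1, A1, A1]) : Pat (aE w) := by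
  right; right; left
  exact h.aE 0 0 (by rfl) (by unfold FreeGroup.IsReduced; decide) rfl rfl rfl rfl

theorem pat_E'_start {w : F2} (h : Lang w [B1, B1, B1]) : Pat (aE' w) := by
  right; right; right
  exact h.aE' 0 0 (by rfl) (by unfold FreeGroup.IsReduced; decide) rfl rfl rfl rfl

theorem pat_E {w : F2} (h : Pat w) : Pat (aE w) := by
  left
  rcases h with h | h | h | h
  · exact h.aE 1 1 (by rfl) (by unfold FreeGroup.IsReduced; decide) rfl rfl rfl rfl
  · have := h.aE (p' := [A1, B1, A1, B1, B1, A1]) 0 0 (by rfl)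
      (by unfold FreeGroup.IsReduced; decide) rfl rfl rfl rfl
    exact Lang.factor (A := [A1]) (B := [A1]) this
  · have := h.aE (p' := [A1, B1, B1, A1, B1, B1, A1]) 0 0 (by rfl)
      (by unfold FreeGroup.IsReduced; decide) rfl rfl rfl rfl
    exact Lang.factor (A := [A1, B1]) (B := [A1]) this
  · have := h.aE (p' := [B1, A1, B1, B1, A1, B1]) 1 1 (by rfl)
      (by unfold FreeGroup.IsReduced; decide) rfl rfl rfl rfl
    exact Lang.factor (A := []) (B := [A1, B1]) this

theorem pat_E' {w : F2} (h : Pat w) : Pat (aE' w) := by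
  right; left
  rcases h with h | h | h | h
  · have := h.aE' (p' := [B1, A1, A1, B1, A1, B1]) 0 0 (by rfl)
      (by unfold FreeGroup.IsReduced; decide) rfl rfl rfl rfl
    exact Lang.factor (A := [B1]) (B := [B1]) this
  · exact h.aE' 1 1 (by rfl) (by unfold FreeGroup.IsReduced; decide) rfl rfl rfl rfl
  · have := h.aE' (p' := [A1, B1, A1, A1, B1, A1]) 1 1 (by rfl)
      (by unfold FreeGroup.IsReduced; decide) rfl rfl rfl rfl
    exact Lang.factor (A := [A1, B1]) (B := []) this
  · have := h.aE' (p' := [B1, A1, A1, B1, A1, A1, B1]) 0 0 (by rfl)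
      (by unfold FreeGroup.IsReduced; decide) rfl rfl rfl rfl
    exact Lang.factor (A := [B1]) (B := [A1, B1]) this

/-- positive automorphisms -/
inductive Pos : MulAut F2 → Prop
  | one : Pos 1
  | e (φ) : Pos φ → Pos (φ * aE)
  | e' (φ) : Pos φ → Pos (φ * aE')

theorem pos_pat {φ : MulAut F2} (h : Pos φ) : ∀ w, Pat w → Pat (φ w) := by
  induction h with
  | one => intro w hw; exact hw
  | e φ _ ih => intro w hw; exact ih _ (pat_E hw)
  | e' φ _ ih => intro w hw; exact ih _ (pat_E' hw)

theorem pos_start {φ : MulAut F2} (h : Pos φ) : φ = 1 ∨ ∀ w, Lang w [A1, A1, A1] →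
    Lang w [B1, B1, B1] → Pat (φ w) := by
  cases h with
  | one => left; rfl
  | e φ h => right; intro w h1 h2; exact pos_pat h _ (pat_E_start h1)
  | e' φ h => right; intro w h1 h2; exact pos_pat h _ (pat_E'_start h2)

theorem mul_conj' (φ : MulAut F2) (g : F2) : φ * MulAut.conj g = MulAut.conj (φ g) * φ := by
  ext x; simp

def Cset : Set (MulAut F2) := {aE, aE⁻¹, aE', aE'⁻¹}

theorem W_C {τ : MulAut F2} (h : τ ∈ W) : ∀ ε ∈ Cset, ∃ g, ∃ ε' ∈ Cset,
    τ * ε = MulAut.conj g * ε' * τ := by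
  have gen : ∀ y ∈ ({sw, ta} : Set (MulAut F2)), y⁻¹ = y ∧ ∀ ε ∈ Cset, ∃ g, ∃ ε' ∈ Cset,
    y * ε = MulAut.conj g * ε' * y := by
    rintro y (rfl | rfl)
    · refine ⟨sw_inv, ?_⟩
      rintro ε (rfl | rfl | rfl | rfl)
      · exact ⟨1, aE', by simp [Cset], aut_ext (by simp) (by simp)⟩
      · exact ⟨1, aE'⁻¹, by simp [Cset], aut_ext (by simp) (by simp)⟩
      · exact ⟨1, aE, by simp [Cset], aut_ext (by simp) (by simp)⟩
      · exact ⟨1, aE⁻¹, by simp [Cset], aut_ext (by simp) (by simp)⟩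
    · refine ⟨ta_inv, ?_⟩
      rintro ε (rfl | rfl | rfl | rfl)
      · exact ⟨(of 1)⁻¹, aE⁻¹, by simp [Cset], aut_ext (by simp) (by simp)⟩
      · exact ⟨of 1, aE, by simp [Cset], aut_ext (by simp) (by simp)⟩
      · exact ⟨1, aE'⁻¹, by simp [Cset], aut_ext (by simp) (by simp)⟩
      · exact ⟨1, aE', by simp [Cset], aut_ext (by simp) (by simp)⟩
  have step : ∀ x y : MulAut F2, (∀ ε ∈ Cset, ∃ g, ∃ ε' ∈ Cset, x * ε = MulAut.conj g * ε' * x) →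
      (∀ ε ∈ Cset, ∃ g, ∃ ε' ∈ Cset, y * ε = MulAut.conj g * ε' * y) →
      (∀ ε ∈ Cset, ∃ g, ∃ ε' ∈ Cset, (x * y) * ε = MulAut.conj g * ε' * (x * y)) := by
    intro x y hx hy ε hε
    obtain ⟨g, ε', h1, h2⟩ := hy ε hε
    obtain ⟨g', ε'', h3, h4⟩ := hx ε' h1
    refine ⟨x g * g', ε'', h3, ?_⟩
    rw [mul_assoc, h2, ← mul_assoc, ← mul_assoc, mul_conj', mul_assoc (MulAut.conj (x g)), h4, map_mul]
    group
  induction h using Subgroup.closure_induction_right with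
  | one => intro ε h; exact ⟨1, ε, h, by simp⟩
  | mul_right x hx y hy ih => exact step x y ih (gen y hy).2
  | mul_inv_cancel x hx y hy ih => rw [(gen y hy).1]; exact step x y ih (gen y hy).2

def SS (δ : MulAut F2) : Prop := ∃ g, ∃ σ ∈ W, ∃ φ, Pos φ ∧ ∃ τ ∈ W,
  δ = MulAut.conj g * σ * φ * τ

theorem SS_conj {δ : MulAut F2} (h : SS δ) (g : F2) : SS (δ * MulAut.conj g) := by
  obtain ⟨g0, σ, hσ, φ, hφ, τ, hτ, rfl⟩ := h
  refine ⟨(MulAut.conj g0 * σ * φ * τ) g * g0, σ, hσ, φ, hφ, τ, hτ, ?_⟩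
  rw [mul_conj', map_mul]; simp only [mul_assoc]

theorem SS_W {δ ω : MulAut F2} (h : SS δ) (hω : ω ∈ W) : SS (δ * ω) := by
  obtain ⟨g0, σ, hσ, φ, hφ, τ, hτ, rfl⟩ := h
  exact ⟨g0, σ, hσ, φ, hφ, τ * ω, mul_mem hτ hω, by simp only [mul_assoc]⟩

theorem Pos_C {φ ε : MulAut F2} (h : Pos φ) (hε : ε ∈ Cset) : SS (φ * ε) := by
  rcases hε with rfl | rfl | rfl | rfl
  · exact ⟨1, 1, one_mem _, _, Pos.e _ h, 1, one_mem _, by simp⟩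
  · cases h with
    | one => exact ⟨1, sw * ta * sw, mul_mem (mul_mem sw_mem ta_mem) sw_mem, aE, by
        simpa using Pos.e _ Pos.one, sw * ta * sw, mul_mem (mul_mem sw_mem ta_mem) sw_mem,
        aut_ext (by simp) (by simp)⟩
    | e φ h => exact ⟨1, 1, one_mem _, _, h, 1, one_mem _, by simp⟩
    | e' φ h =>
      have e : aE' * aE⁻¹ = MulAut.conj (of 1) * aE * (sw * ta) := aut_ext (by simp) (by simp [mul_assoc])
      refine ⟨φ (of 1), 1, one_mem _, _, Pos.e _ h, sw * ta, mul_mem sw_mem ta_mem, ?_⟩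
      have e2 := mul_conj' φ (of 1)
      rw [mul_assoc, e, mul_one, ← mul_assoc (MulAut.conj _), ← e2]
      simp only [mul_assoc]
  · exact ⟨1, 1, one_mem _, _, Pos.e' _ h, 1, one_mem _, by simp⟩
  · cases h with
    | one => exact ⟨1, ta, ta_mem, aE', by
        simpa using Pos.e' _ Pos.one, ta, ta_mem,
        aut_ext (by simp) (by simp)⟩
    | e φ h =>
      have e : aE * aE'⁻¹ = MulAut.conj (of 0) * aE' * (ta * sw) := aut_ext (by simp [mul_assoc]) (by simp)
      refine ⟨φ (of 0), 1, one_mem _, _, Pos.e' _ h, ta * sw, mul_mem ta_mem sw_mem, ?_⟩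
      have e2 := mul_conj' φ (of 0)
      rw [mul_assoc, e, mul_one, ← mul_assoc (MulAut.conj _), ← e2]
      simp only [mul_assoc]
    | e' φ h => exact ⟨1, 1, one_mem _, _, h, 1, one_mem _, by simp⟩

theorem SS_C {δ ε : MulAut F2} (h : SS δ) (hε : ε ∈ Cset) : SS (δ * ε) := by
  obtain ⟨g0, σ, hσ, φ, hφ, τ, hτ, rfl⟩ := h
  obtain ⟨g, ε', h1, h2⟩ := W_C hτ ε hε
  obtain ⟨g1, σ1, hσ1, φ1, hφ1, τ1, hτ1, e⟩ := Pos_C hφ h1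
  refine ⟨g0 * (σ * φ) g * σ g1, σ * σ1, mul_mem hσ hσ1, φ1, hφ1, τ1 * τ, mul_mem hτ1 hτ, ?_⟩
  calc MulAut.conj g0 * σ * φ * τ * ε = MulAut.conj g0 * ((σ * φ) * MulAut.conj g) * ε' * τ := by
        rw [mul_assoc _ τ ε, h2]; simp only [mul_assoc]
    _ = MulAut.conj g0 * MulAut.conj ((σ * φ) g) * σ * (φ * ε') * τ := by
        rw [mul_conj']; simp only [mul_assoc]
    _ = MulAut.conj g0 * MulAut.conj ((σ * φ) g) * (σ * MulAut.conj g1) * σ1 * φ1 * τ1 * τ := by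
        rw [e]; simp only [mul_assoc]
    _ = _ := by rw [mul_conj' σ g1]; simp only [mul_assoc, map_mul]

/-- subgroup generated by elementary automorphisms -/
def NN : Subgroup (MulAut F2) :=
  Subgroup.closure (Set.range (MulAut.conj : F2 →* MulAut F2) ∪ {aE, sw, ta})

theorem NN_SS {δ : MulAut F2} (h : δ ∈ NN) : SS δ := by
  induction h using Subgroup.closure_induction_right with
  | one => exact ⟨1, 1, one_mem _, 1, Pos.one, 1, one_mem _, by simp⟩
  | mul_right x hx y hy ih =>
    rcases hy with ⟨g, rfl⟩ | rfl | rfl | rfl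
    · exact SS_conj ih g
    · exact SS_C ih (by simp [Cset])
    · exact SS_W ih sw_mem
    · exact SS_W ih ta_mem
  | mul_inv_cancel x hx y hy ih =>
    rcases hy with ⟨g, rfl⟩ | rfl | rfl | rfl
    · rw [← map_inv]; exact SS_conj ih _
    · exact SS_C ih (by simp [Cset])
    · exact SS_W ih (inv_mem sw_mem)
    · exact SS_W ih (inv_mem ta_mem)

end MC

namespace MC
open FreeGroup hiding map_mul map_inv map_one

def li (l : Lt) : Lt := (l.1, !l.2)

theorem mk_li (l : Lt) : (mk [li l] : F2) = (mk [l])⁻¹ := rfl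

theorem W_trans (l l' : Lt) (h : l.1 ≠ l'.1) : ∃ τ ∈ W, τ (of 0) = mk [l] ∧ τ (of 1) = mk [l'] := by
  have htb : sw * ta * sw ∈ W := mul_mem (mul_mem sw_mem ta_mem) sw_mem
  rcases lt_cases l with rfl | rfl | rfl | rfl <;> rcases lt_cases l' with rfl | rfl | rfl | rfl <;>
    simp only [ne_eq, not_true_eq_false] at h <;> simp only [mk_at, mk_bt, mk_af, mk_bf]
  · exact ⟨1, one_mem _, by simp, by simp⟩
  · exact ⟨sw * ta * sw, htb, by simp, by simp⟩
  · exact ⟨ta, ta_mem, by simp, by simp⟩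
  · exact ⟨ta * (sw * ta * sw), mul_mem ta_mem htb, by simp, by simp⟩
  · exact ⟨sw, sw_mem, by simp, by simp⟩
  · exact ⟨ta * sw, mul_mem ta_mem sw_mem, by simp, by simp⟩
  · exact ⟨(sw * ta * sw) * sw, mul_mem htb sw_mem, by simp, by simp⟩
  · exact ⟨ta * (sw * ta * sw) * sw, mul_mem (mul_mem ta_mem htb) sw_mem, by simp, by simp⟩

theorem W_le_NN : W ≤ NN := by
  unfold W NN
  apply Subgroup.closure_mono
  rintro x (rfl | rfl) <;> simp

theorem aE_NN : aE ∈ NN := Subgroup.subset_closure (by simp)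
theorem aE'_NN : aE' ∈ NN :=
  mul_mem (mul_mem (W_le_NN sw_mem) aE_NN) (W_le_NN sw_mem)
theorem conj_NN (g : F2) : MulAut.conj g ∈ NN := Subgroup.subset_closure (by simp)

def Nm (δ : MulAut F2) : ℕ := (δ (of 0)).norm + (δ (of 1)).norm

def Mn (δ : MulAut F2) : Prop := ∀ n ∈ NN, Nm δ ≤ Nm (δ * n)

/-- image of a letter -/
def X (δ : MulAut F2) (l : Lt) : F2 := δ (mk [l])

theorem X_li (δ : MulAut F2) (l : Lt) : X δ (li l) = (X δ l)⁻¹ := by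
  unfold X; rw [mk_li, map_inv]

theorem X_norm_li (δ : MulAut F2) (l : Lt) : (X δ (li l)).norm = (X δ l).norm := by
  rw [X_li, norm_inv_eq]

theorem X_ne (δ : MulAut F2) (l : Lt) : X δ l ≠ 1 := by
  unfold X
  rw [ne_eq, EmbeddingLike.map_eq_one_iff]
  intro h
  have : (mk [l] : F2).toWord = [] := by rw [h, toWord_one]
  rw [toWord_mk_of_red (by simp)] at this
  simp at this

theorem X_pos (δ : MulAut F2) (l : Lt) : 0 < (X δ l).norm := by
  rw [Nat.pos_iff_ne_zero, ne_eq, FreeGroup.norm_eq_zero]; exact X_ne δ l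

theorem Nm_eq (δ : MulAut F2) (l l' : Lt) (h : l.1 ≠ l'.1) :
    Nm δ = (X δ l).norm + (X δ l').norm := by
  unfold Nm X
  rcases lt_cases l with rfl | rfl | rfl | rfl <;> rcases lt_cases l' with rfl | rfl | rfl | rfl <;>
    simp only [ne_eq, not_true_eq_false] at h <;>
    simp only [mk_at, mk_bt, mk_af, mk_bf, map_inv, norm_inv_eq] <;> omega

theorem Mn.le {δ : MulAut F2} (hδ : Mn δ) (l l' : Lt) (h : l.1 ≠ l'.1) :
    (X δ l).norm ≤ (X δ l * X δ l').norm := by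
  obtain ⟨τ, hτ, h0, h1⟩ := W_trans l l' h
  have := hδ (τ * aE) (mul_mem (W_le_NN hτ) aE_NN)
  rw [Nm_eq δ l l' h] at this
  unfold Nm at this
  simp only [MulAut.mul_apply, aE_a, aE_b, map_mul, h0, h1] at this
  unfold X at *
  omega

theorem Mn.le' {δ : MulAut F2} (hδ : Mn δ) (l l' : Lt) (h : l.1 ≠ l'.1) :
    (X δ l').norm ≤ (X δ l * X δ l').norm := by
  have := hδ.le (li l') (li l) (by simpa [li] using h.symm)
  rw [X_li, X_li, ← mul_inv_rev, norm_inv_eq, norm_inv_eq] at this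
  exact this

/-- no two-sided half cancellation -/
theorem Mn.no_bad {δ : MulAut F2} (hδ : Mn δ) (l m : Lt) (h : l.1 ≠ m.1) (p r s : List Lt)
    (hm : (X δ m).toWord = p ++ r) (hl : (X δ l).toWord = invRev r ++ s ++ invRev p)
    : False := by
  obtain ⟨τ, hτ, h0, h1⟩ := W_trans m l h.symm
  have := hδ (MulAut.conj (δ⁻¹ (mk r)) * (τ * aE')) (mul_mem (conj_NN _) (mul_mem (W_le_NN hτ) aE'_NN))
  rw [Nm_eq δ m l h.symm, ← mul_assoc, mul_conj'] at this
  have e1 : X δ m = mk p * mk r := mk_eq_of_left hm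
  have e2 : X δ l = (mk r)⁻¹ * mk s * (mk p)⁻¹ := by
    rw [← mk_toWord (x := X δ l), hl, ← mul_mk, ← mul_mk, inv_mk, inv_mk]
  have n1 : (X δ m).norm = p.length + r.length := by simp [FreeGroup.norm, hm]
  have n2 : (X δ l).norm = r.length + s.length + p.length := by simp [FreeGroup.norm, hl]; omega
  have n3 := X_pos δ m
  unfold Nm at this
  have f1 : δ (mk [m]) = mk p * mk r := e1
  have f2 : δ (mk [l]) = (mk r)⁻¹ * mk s * (mk p)⁻¹ := e2
  have g1 : ((MulAut.conj (δ (δ⁻¹ (mk r))) * δ * (τ * aE')) (of 0)) = mk (r ++ p) := by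
    simp only [MulAut.mul_apply, aE'_a, h0, f1, MulAut.apply_inv_self, MulAut.conj_apply, ← mul_mk]
    group
  have g2 : ((MulAut.conj (δ (δ⁻¹ (mk r))) * δ * (τ * aE')) (of 1)) = mk s := by
    simp only [MulAut.mul_apply, aE'_b, map_mul, h0, h1, f1, f2, MulAut.apply_inv_self, MulAut.conj_apply]
    group
  rw [g1, g2] at this
  have k1 : (mk (r ++ p) : F2).norm ≤ (r ++ p).length := norm_mk_le
  have k2 : (mk s : F2).norm ≤ s.length := norm_mk_le
  simp at k1
  omega

/-- amount of cancellation -/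
def kap (x y : F2) : ℕ := (x.norm + y.norm - (x * y).norm) / 2

theorem cancel_kap (x y : F2) : ∃ A p B, x.toWord = A ++ p ∧ y.toWord = invRev p ++ B ∧
    (x * y).toWord = A ++ B ∧ p.length = kap x y ∧ 2 * kap x y + (x * y).norm = x.norm + y.norm := by
  obtain ⟨A, p, B, h1, h2, h3⟩ := cancel x y
  refine ⟨A, p, B, h1, h2, h3, ?_, ?_⟩ <;>
  · simp only [kap, FreeGroup.norm, h1, h2, h3, List.length_append, invRev_length]
    omega

theorem self_kap (x : F2) (hx : x ≠ 1) : 2 * kap x x < x.norm := by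
  obtain ⟨A, p, B, h1, h2, h3, h4, h5⟩ := cancel_kap x x
  by_contra hc
  have hl : A.length ≤ p.length := by
    simp only [FreeGroup.norm, h1, List.length_append] at *; omega
  have h6 := h1.symm.trans h2
  rw [List.append_eq_append_iff] at h6
  have h7 : ∃ C, invRev p = A ++ C ∧ p = C ++ B := by
    rcases h6 with h | ⟨C, h7, h8⟩
    · exact h
    · have : A.length = p.length + C.length := by rw [h7]; simp
      have : C = [] := List.eq_nil_of_length_eq_zero (by omega)
      subst this
      exact ⟨[], by simpa using h7.symm, by simpa using h8.symm⟩
  obtain ⟨C, h7, h8⟩ := h7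
  have h9 : p = invRev C ++ invRev A := by
    rw [← invRev_append, ← h7, invRev_invRev]
  rw [h8] at h9
  obtain ⟨h10, h11⟩ := List.append_inj h9 (by simp)
  have h12 : (mk C : F2) ^ 2 = 1 := by
    rw [pow_two]; nth_rewrite 2 [h10]
    rw [← inv_mk, mul_inv_cancel]
  have h13 : (mk C : F2) = 1 := by
    rwa [pow_eq_one_iff_left (by norm_num)] at h12
  apply hx
  rw [mk_eq_of_left h1, h8, h11, ← mul_mk, h13, ← inv_mk]
  group

theorem Mn.pair {δ : MulAut F2} (hδ : Mn δ) (l m : Lt) (h : l ≠ li m) :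
    2 * kap (X δ l) (X δ m) ≤ (X δ l).norm ∧ 2 * kap (X δ l) (X δ m) ≤ (X δ m).norm ∧
    (l = m → 2 * kap (X δ l) (X δ m) < (X δ l).norm) := by
  by_cases hlm : l = m
  · subst hlm
    have := self_kap _ (X_ne δ l)
    exact ⟨this.le, this.le, fun _ => this⟩
  · have hne : l.1 ≠ m.1 := by
      intro e
      rcases lt_cases l with rfl | rfl | rfl | rfl <;> rcases lt_cases m with rfl | rfl | rfl | rfl <;>
        simp_all [li]
    obtain ⟨A, p, B, h1, h2, h3, h4, h5⟩ := cancel_kap (X δ l) (X δ m)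
    have := hδ.le l m hne
    have := hδ.le' l m hne
    exact ⟨by omega, by omega, fun e => absurd e hlm⟩

theorem Mn.triple {δ : MulAut F2} (hδ : Mn δ) (l m n : Lt) (h : l ≠ li m) (h' : m ≠ li n) :
    kap (X δ l) (X δ m) + kap (X δ m) (X δ n) < (X δ m).norm := by
  have h1 := hδ.pair l m h
  have h2 := hδ.pair m n h'
  by_contra hc
  have e1 : 2 * kap (X δ l) (X δ m) = (X δ m).norm := by omega
  have e2 : 2 * kap (X δ m) (X δ n) = (X δ m).norm := by omega
  have hlm : l ≠ m := by rintro rfl; have := h1.2.2 rfl; omega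
  have hmn : m ≠ n := by rintro rfl; have := h2.2.2 rfl; omega
  have hl1 : l.1 ≠ m.1 ∧ (n = l ∨ n = li l) := by
    clear * - h h' hlm hmn
    rcases lt_cases l with rfl | rfl | rfl | rfl <;> rcases lt_cases m with rfl | rfl | rfl | rfl <;>
      rcases lt_cases n with rfl | rfl | rfl | rfl <;> simp_all [li]
  obtain ⟨A, q, B, a1, a2, a3, a4, a5⟩ := cancel_kap (X δ l) (X δ m)
  obtain ⟨A', r, B', b1, b2, b3, b4, b5⟩ := cancel_kap (X δ m) (X δ n)
  have hlen : (X δ m).norm = q.length + B.length := by simp [FreeGroup.norm, a2]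
  have hAB := a2.symm.trans b1
  have hlen2 : (X δ m).norm = A'.length + r.length := by simp [FreeGroup.norm, b1]
  obtain ⟨c1, c2⟩ := List.append_inj hAB (by simp; omega)
  subst c2
  obtain ⟨hl1, rfl | rfl⟩ := hl1
  ·
    have hlA : B.length ≤ A.length := by
      have : (X δ n).norm = A.length + q.length := by simp [FreeGroup.norm, a1]
      omega
    have := a1.symm.trans b2
    rw [List.append_eq_append_iff] at this
    rcases this with ⟨C, d1, d2⟩ | ⟨C, d1, d2⟩
    · have : (invRev B).length = A.length + C.length := by rw [d1]; simp
      simp at this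
      have : C = [] := List.eq_nil_of_length_eq_zero (by omega)
      subst this
      refine hδ.no_bad n m hl1 (invRev q) B [] a2 ?_
      rw [invRev_invRev, a1, d1]; simp
    · refine hδ.no_bad n m hl1 (invRev q) B C a2 ?_
      rw [invRev_invRev, a1, d1]
  · rw [X_li, toWord_inv, a1, invRev_append] at b2
    obtain ⟨d1, -⟩ := List.append_inj b2 (by simp; omega)
    apply X_ne δ m
    rw [mk_eq_of_left a2, d1, ← inv_mk]
    group

theorem Mn.grow {δ : MulAut F2} (hδ : Mn δ) (L : List Lt) : ∀ l m, IsReduced (L ++ [l, m]) →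
    ∃ T, (δ (mk (L ++ [l, m]))).toWord = T ++ (X δ m).toWord.drop (kap (X δ l) (X δ m)) ∧
      L.length + 1 ≤ T.length := by
  have hli : ∀ l m : Lt, IsReduced [l, m] → l ≠ li m := by
    rintro l m h rfl
    simp [li] at h
  induction L using List.reverseRecOn with
  | nil =>
    intro l m h
    obtain ⟨A, p, B, h1, h2, h3, h4, h5⟩ := cancel_kap (X δ l) (X δ m)
    refine ⟨A, ?_, ?_⟩
    · have : δ (mk ([] ++ [l, m])) = X δ l * X δ m := by
        unfold X; rw [← map_mul, mul_mk]; rfl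
      rw [this, h3, h2, List.drop_left' (by simpa using h4)]
    · have := (hδ.pair l m (hli _ _ (by simpa using h))).1
      have e : (X δ l).norm = A.length + p.length := by simp [FreeGroup.norm, h1]
      have := X_pos δ l
      simp; omega
  | append_singleton L k ih =>
    intro l m h
    have hr1 : IsReduced (L ++ [k, l]) := red_left (B := [m]) (by simpa using h)
    have hr2 : IsReduced [l, m] := red_right h
    have hr3 : IsReduced [k, l] := red_right hr1
    obtain ⟨T, t1, t2⟩ := ih k l hr1
    have tr := hδ.triple k l m (hli _ _ hr3) (hli _ _ hr2)
    obtain ⟨A, p, B, h1, h2, h3, h4, h5⟩ := cancel_kap (X δ l) (X δ m)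
    have e : (X δ l).norm = A.length + p.length := by simp [FreeGroup.norm, h1]
    have hA : kap (X δ k) (X δ l) < A.length := by omega
    have hd : (X δ l).toWord.drop (kap (X δ k) (X δ l)) = A.drop (kap (X δ k) (X δ l)) ++ p := by
      rw [h1, List.drop_append_of_le_length hA.le]
    rw [hd] at t1
    generalize kap (X δ k) (X δ l) = c at *
    have hprod : δ (mk (L ++ [k] ++ [l, m])) = mk (T ++ A.drop c ++ B) := by
      have : L ++ [k] ++ [l, m] = (L ++ [k, l]) ++ [m] := by simp
      rw [this, ← mul_mk, map_mul, ← mk_toWord (x := δ (mk (L ++ [k, l]))), t1]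
      have e2 : δ (mk [m]) = (mk p)⁻¹ * mk B := by
        have := mk_eq_of_left h2
        rwa [← inv_mk] at this
      rw [e2, ← mul_mk, ← mul_mk, ← mul_mk, ← mul_mk]
      group
    have hred : IsReduced (T ++ A.drop c ++ B) := by
      apply IsReduced.append_overlap
      · apply red_left (B := p); rw [List.append_assoc, ← t1]; exact isReduced_toWord
      · have : IsReduced (A ++ B) := by rw [← h3]; exact isReduced_toWord
        rw [← List.take_append_drop c A, List.append_assoc] at this
        exact red_right this
      · intro h0
        have := congrArg List.length h0
        simp at this
        omega
    refine ⟨T ++ A.drop c, ?_, ?_⟩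
    · rw [hprod, toWord_mk_of_red hred, h2, List.drop_left' (by simpa using h4)]
    · simp; omega

theorem Mn.expand {δ : MulAut F2} (hδ : Mn δ) (g : F2) : g.norm ≤ (δ g).norm := by
  have hr := isReduced_toWord (x := g)
  have hg : mk g.toWord = g := mk_toWord
  rw [FreeGroup.norm, ← hg]
  rw [toWord_mk_of_red hr]
  generalize g.toWord = L at *
  induction L using List.reverseRecOn with
  | nil => simp
  | append_singleton L m _ =>
    induction L using List.reverseRecOn with
    | nil => exact X_pos δ m
    | append_singleton L l _ =>
      have e : L ++ [l] ++ [m] = L ++ [l, m] := by simp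
      rw [e] at hr
      rw [e]
      obtain ⟨T, h1, h2⟩ := hδ.grow L l m hr
      have h3 : l ≠ li m := by
        rintro rfl
        have := red_right hr
        simp [li] at this
      have h4 := (hδ.pair l m h3).2.1
      have h5 := X_pos δ m
      rw [FreeGroup.norm, h1]
      simp only [List.length_append, List.length_drop]
      have : (X δ m).norm = (X δ m).toWord.length := rfl
      simp; omega

theorem Mn.mem_W {δ : MulAut F2} (hδ : Mn δ) : δ ∈ W := by
  have key : ∀ i : Fin 2, ∃ l, δ⁻¹ (of i) = mk [l] := by
    intro i
    have := hδ.expand (δ⁻¹ (of i))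
    rw [MulAut.apply_inv_self, norm_of] at this
    have h1 : (δ⁻¹ (of i)).norm ≠ 0 := by
      rw [ne_eq, FreeGroup.norm_eq_zero, EmbeddingLike.map_eq_one_iff]; exact of_ne_one i
    have h2 : (δ⁻¹ (of i)).toWord.length = 1 := by unfold FreeGroup.norm at *; omega
    obtain ⟨l, hl⟩ := List.length_eq_one_iff.1 h2
    exact ⟨l, by rw [← hl, mk_toWord]⟩
  obtain ⟨l, hl⟩ := key 0
  obtain ⟨m, hm⟩ := key 1
  have hne : l.1 ≠ m.1 := by
    intro e
    have h3 : l = m ∨ l = li m := by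
      clear * - e
      rcases lt_cases l with rfl | rfl | rfl | rfl <;> rcases lt_cases m with rfl | rfl | rfl | rfl <;>
        simp_all [li]
    have h4 : (of 0 : F2) = of 1 ∨ (of 0 : F2) = (of 1)⁻¹ := by
      rcases h3 with rfl | rfl
      · left; exact (δ⁻¹).injective (hl.trans hm.symm)
      · right
        apply (δ⁻¹).injective
        rw [hl, map_inv, hm, mk_li]
    revert h4; decide
  obtain ⟨τ, hτ, h0, h1⟩ := W_trans l m hne
  have : δ⁻¹ = τ := aut_ext (hl.trans h0.symm) (hm.trans h1.symm)
  rw [← inv_inv δ, this]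
  exact inv_mem hτ

theorem NN_top (δ : MulAut F2) : δ ∈ NN := by
  have hex : ∃ k, ∃ n ∈ NN, Nm (δ * n) = k := ⟨_, 1, one_mem _, rfl⟩
  classical
  obtain ⟨n, hn, e⟩ := Nat.find_spec hex
  have : Mn (δ * n) := by
    intro n' hn'
    rw [e, mul_assoc]
    exact Nat.find_min' hex ⟨n * n', mul_mem hn hn', rfl⟩
  have := mul_mem (W_le_NN this.mem_W) (inv_mem hn)
  simpa using this

end MC

namespace MC
open FreeGroup hiding map_mul map_inv map_one

abbrev aa (n : ℕ) : List Lt := List.replicate n A1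
abbrev bb (n : ℕ) : List Lt := List.replicate n B1

/-- reduced words with prescribed ends -/
structure Ends (L : List Lt) (x y : Lt) : Prop where
  red : IsReduced L
  hd : L.head? = some x
  lst : L.getLast? = some y

theorem Ends.app' {A B : List Lt} {x y y' z : Lt} (h : Ends A x y) (h' : Ends B y' z)
    (hyy : y.1 = y'.1 → y.2 = y'.2) : Ends (A ++ B) x z := by
  refine ⟨isReduced_append.2 ⟨h.red, h'.red, ?_⟩, ?_, ?_⟩
  · intro u hu v hv
    rw [h.lst] at hu; rw [h'.hd] at hv
    simp at hu hv
    subst hu hv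
    exact hyy
  · simp [List.head?_append, h.hd]
  · simp [List.getLast?_append, h'.lst]

theorem Ends.app {A B : List Lt} {x y z : Lt} (h : Ends A x y) (h' : Ends B y z) :
    Ends (A ++ B) x z := h.app' h' (fun _ => rfl)

theorem Ends.inv {A : List Lt} {x y : Lt} (h : Ends A x y) : Ends (invRev A) (li y) (li x) := by
  refine ⟨isReduced_invRev h.red, ?_, ?_⟩
  · simp [invRev, h.lst, li]
  · simp [invRev, h.hd, li]

theorem Ends.ne {A : List Lt} {x y : Lt} (h : Ends A x y) : A ≠ [] := by
  rintro rfl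
  have := h.hd
  simp at this

def Ps (L : List Lt) : Prop := ∀ x ∈ L, x.2 = true

theorem Ps.red {L : List Lt} (h : Ps L) : IsReduced L := by
  induction L with
  | nil => simp
  | cons x L ih =>
    have h1 : IsReduced ([x] ++ L) := by
      refine isReduced_append.2 ⟨by simp, ih (fun y hy => h y (by simp [hy])), ?_⟩
      intro u hu v hv _
      simp at hu
      subst hu
      rw [h _ (by simp), h v (by have := List.mem_of_mem_head? hv; simp [this])]
    exact h1

theorem Ps.app {A B : List Lt} (h : Ps A) (h' : Ps B) : Ps (A ++ B) := by
  intro x hx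
  rcases List.mem_append.1 hx with hx | hx
  · exact h x hx
  · exact h' x hx

theorem ps_aa (n : ℕ) : Ps (aa n) := by intro x hx; rw [List.eq_of_mem_replicate hx]
theorem ps_bb (n : ℕ) : Ps (bb n) := by intro x hx; rw [List.eq_of_mem_replicate hx]

/-- `a³b^s a³b^{s+1} ⋯` -/
def blk (s : ℕ) : ℕ → List Lt
  | 0 => []
  | n + 1 => blk s n ++ (aa 3 ++ bb (n + s))

theorem ps_blk (s n : ℕ) : Ps (blk s n) := by
  induction n with
  | zero => intro x hx; simp [blk] at hx
  | succ n ih => exact ih.app ((ps_aa _).app (ps_bb _))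

theorem mk_aa (n : ℕ) : (mk (aa n) : F2) = fa ^ n := by
  rw [fa, ← mk_toWord (x := of 0 ^ n), toWord_of_pow]
theorem mk_bb (n : ℕ) : (mk (bb n) : F2) = fb ^ n := by
  rw [fb, ← mk_toWord (x := of 1 ^ n), toWord_of_pow]

/-- group version of `blk` -/
def cb (s : ℕ) (n : ℕ) : F2 := ((List.range n).map fun m => fa ^ 3 * fb ^ (m + s)).prod

theorem cb_zero (s : ℕ) : cb s 0 = 1 := rfl
theorem cb_succ (s n : ℕ) : cb s (n + 1) = cb s n * (fa ^ 3 * fb ^ (n + s)) := by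
  simp [cb, List.range_succ]

theorem mk_blk (s n : ℕ) : (mk (blk s n) : F2) = cb s n := by
  induction n with
  | zero => rfl
  | succ n ih => rw [cb_succ, ← ih, blk, ← mul_mk, ← mul_mk, mk_aa, mk_bb]

theorem omegaX_eq (ρ : ℕ) : omegaX ρ = cb 3 ρ := rfl
theorem omegaY_eq (ρ : ℕ) : omegaY ρ = cb (ρ + 3) ρ := rfl

def Pp (s : ℕ) : List Lt := aa 3 ++ bb s ++ aa 2
def Mm (m : ℕ) : List Lt := aa 1 ++ bb m ++ aa 3 ++ bb (m + 1) ++ aa 1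
def Qr (k s : ℕ) : List Lt := aa 2 ++ (bb (s + 3) ++ blk (s + 4) k ++ aa 2) ++ aa 1
def Qq (k s : ℕ) : List Lt := Qr k s ++ bb (s + k + 4)

theorem cb_add (s k n : ℕ) : cb s (n + k) = cb s n * cb (s + n) k := by
  induction k with
  | zero => simp [cb_zero]
  | succ k ih => rw [← add_assoc, cb_succ, ih, cb_succ, mul_assoc]; congr 4; ring

theorem cb_split (k s : ℕ) : cb s (k + 5) = mk (Pp s) * mk (Mm (s + 1)) * mk (Qq k s) := by
  have e : k + 5 = 4 + (k + 1) := by ring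
  rw [e, cb_add, cb_succ (s + 4)]
  simp only [cb_succ, cb_zero, Pp, Mm, Qq, Qr, ← mul_mk, mk_aa, mk_bb, mk_blk]
  have e2 : k + (s + 4) = s + k + 4 := by ring
  have e3 : (3 + s) = s + 3 := by ring
  have e4 : (2 + s) = s + 1 + 1 := by ring
  have e5 : (1 + s) = s + 1 := by ring
  rw [e2, e3, e4, e5]
  simp only [mul_assoc, one_mul, zero_add, pow_succ, pow_zero]

variable (k : ℕ)

/-- initial exponent; here `ρ = k + 5` -/
def ss (i : Fin 2) : ℕ := if i = 0 then 3 else k + 8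

def PL (l : Lt) : List Lt := if l.2 then Pp (ss k l.1) else invRev (Qq k (ss k l.1))
def ML (l : Lt) : List Lt := if l.2 then Mm (ss k l.1 + 1) else invRev (Mm (ss k l.1 + 1))
def QL (l : Lt) : List Lt := if l.2 then Qq k (ss k l.1) else invRev (Pp (ss k l.1))

theorem PL_li (l : Lt) : PL k (li l) = invRev (QL k l) := by
  rcases l with ⟨i, _ | _⟩ <;> simp [PL, QL, li, invRev_invRev]
theorem QL_li (l : Lt) : QL k (li l) = invRev (PL k l) := by
  rcases l with ⟨i, _ | _⟩ <;> simp [PL, QL, li, invRev_invRev]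
theorem ML_li (l : Lt) : ML k (li l) = invRev (ML k l) := by
  rcases l with ⟨i, _ | _⟩ <;> simp [ML, li, invRev_invRev]

theorem ps_Pp (s : ℕ) : Ps (Pp s) := ((ps_aa _).app (ps_bb _)).app (ps_aa _)
theorem ps_Mm (s : ℕ) : Ps (Mm s) :=
  ((((ps_aa _).app (ps_bb _)).app (ps_aa _)).app (ps_bb _)).app (ps_aa _)
theorem ps_Qr (s : ℕ) : Ps (Qr k s) :=
  ((ps_aa _).app (((ps_bb _).app (ps_blk _ _)).app (ps_aa _))).app (ps_aa _)
theorem ps_Qq (s : ℕ) : Ps (Qq k s) := (ps_Qr k s).app (ps_bb _)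

theorem en_Pp (s : ℕ) : Ends (Pp s) A1 A1 :=
  ⟨(ps_Pp s).red, by simp [Pp, List.replicate_succ], by
    simp only [Pp, List.getLast?_append]; rfl⟩
theorem en_Mm (s : ℕ) : Ends (Mm s) A1 A1 :=
  ⟨(ps_Mm s).red, by simp [Mm, List.replicate_succ], by
    simp only [Mm, List.getLast?_append]; rfl⟩
theorem en_Qr (s : ℕ) : Ends (Qr k s) A1 A1 :=
  ⟨(ps_Qr k s).red, by simp [Qr, List.replicate_succ], by
    simp only [Qr, List.getLast?_append]; rfl⟩
theorem en_bb (s : ℕ) : Ends (bb (s + 1)) B1 B1 :=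
  ⟨(ps_bb _).red, by simp [List.replicate_succ], by simp [List.getLast?_replicate]⟩
theorem en_aa (s : ℕ) : Ends (aa (s + 1)) A1 A1 :=
  ⟨(ps_aa _).red, by simp [List.replicate_succ], by simp [List.getLast?_replicate]⟩
theorem en_Qq (s : ℕ) : Ends (Qq k s) A1 B1 := (en_Qr k s).app' (en_bb (s + k + 3)) (by simp)

theorem en_ML (l : Lt) : Ends (ML k l) (0, l.2) (0, l.2) := by
  rcases l with ⟨i, _ | _⟩
  · exact (en_Mm _).inv
  · exact en_Mm _

/-- junction of two consecutive letters -/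
def Jn (l m : Lt) : Prop := ∃ R : List Lt, (mk R : F2) = mk (QL k l) * mk (PL k m) ∧
  Ends R (0, l.2) (0, m.2)

theorem Jn.symm {l m : Lt} (h : Jn k l m) : Jn k (li m) (li l) := by
  obtain ⟨R, h1, h2⟩ := h
  refine ⟨invRev R, ?_, h2.inv⟩
  rw [QL_li, PL_li, ← inv_mk, ← inv_mk, ← inv_mk, h1, mul_inv_rev]

theorem jn_pp (i j : Fin 2) : Jn k (i, true) (j, true) := by
  refine ⟨Qq k (ss k i) ++ Pp (ss k j), by rw [← mul_mk]; rfl, ?_⟩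
  refine ⟨((ps_Qq k _).app (ps_Pp _)).red, ?_, ?_⟩
  · simp [List.head?_append, (en_Qq k _).hd]
  · simp [List.getLast?_append, (en_Pp _).lst]

theorem jn_01 : Jn k (0, false) (1, true) := by
  refine ⟨invRev (aa 2) ++ bb (k + 5) ++ aa 2, ?_, ?_⟩
  · have e1 : QL k (0, false) = invRev (Pp 3) := rfl
    have e2 : PL k (1, true) = Pp (3 + (k + 5)) := by
      have : 3 + (k + 5) = k + 8 := by ring
      rw [this]; rfl
    rw [e1, e2, ← inv_mk]
    simp only [Pp, ← mul_mk, mk_aa, mk_bb, ← inv_mk, pow_add fb]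
    group
  · exact ((en_aa 1).inv.app' (en_bb (k + 4)) (by simp [li])).app' (en_aa 1) (by simp)

theorem jn_01' : Jn k (0, true) (1, false) := by
  refine ⟨Qr k 3 ++ invRev (bb (k + 5)) ++ invRev (Qr k (k + 8)), ?_, ?_⟩
  · have e1 : QL k (0, true) = Qr k 3 ++ bb (3 + k + 4) := rfl
    have e2 : PL k (1, false) = invRev (Qr k (k + 8) ++ bb ((k + 5) + (3 + k + 4))) := by
      have : (k + 5) + (3 + k + 4) = (k + 8) + k + 4 := by ring
      rw [this]; rfl
    rw [e1, e2, ← inv_mk]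
    simp only [← mul_mk, mk_bb, ← inv_mk, pow_add fb (k + 5)]
    group
  · exact ((en_Qr k 3).app' (en_bb (k + 4)).inv (by simp [li])).app' (en_Qr k _).inv (by simp [li])

theorem jn (l m : Lt) (h : l ≠ li m) : Jn k l m := by
  rcases lt_cases l with rfl | rfl | rfl | rfl
  · rcases lt_cases m with rfl | rfl | rfl | rfl
    · exact jn_pp k 0 0
    · exact absurd rfl h
    · exact jn_pp k 0 1
    · exact jn_01' k
  · rcases lt_cases m with rfl | rfl | rfl | rfl
    · exact absurd rfl h
    · exact (jn_pp k 0 0).symm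
    · exact jn_01 k
    · exact (jn_pp k 1 0).symm
  · rcases lt_cases m with rfl | rfl | rfl | rfl
    · exact jn_pp k 1 0
    · exact (jn_01' k).symm
    · exact jn_pp k 1 1
    · exact absurd rfl h
  · rcases lt_cases m with rfl | rfl | rfl | rfl
    · exact (jn_01 k).symm
    · exact (jn_pp k 0 1).symm
    · exact absurd rfl h
    · exact (jn_pp k 1 1).symm

def G : F2 →* F2 := FreeGroup.lift ![omegaX (k + 5), omegaY (k + 5)]

theorem G_letter (l : Lt) : G k (mk [l]) = mk (PL k l) * mk (ML k l) * mk (QL k l) := by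
  have hx : G k (of 0) = mk (Pp 3) * mk (Mm 4) * mk (Qq k 3) := by
    rw [← cb_split]; simp [G, omegaX_eq]
  have hy : G k (of 1) = mk (Pp (k + 8)) * mk (Mm (k + 9)) * mk (Qq k (k + 8)) := by
    rw [← cb_split]; simp [G, omegaY_eq]
  rcases lt_cases l with rfl | rfl | rfl | rfl
  · exact hx
  · rw [mk_af, map_inv, hx, mul_inv_rev, mul_inv_rev, inv_mk, inv_mk, inv_mk, mul_assoc]; rfl
  · exact hy
  · rw [mk_bf, map_inv, hy, mul_inv_rev, mul_inv_rev, inv_mk, inv_mk, inv_mk, mul_assoc]; rfl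

theorem en_Q (l : Lt) : IsReduced (ML k l ++ QL k l) := by
  rcases l with ⟨i, _ | _⟩
  · exact ((en_Mm _).inv.app (en_Pp _).inv).red
  · exact ((en_Mm _).app (en_Qq k _)).red
theorem en_P (l : Lt) : IsReduced (PL k l ++ ML k l) := by
  rcases l with ⟨i, _ | _⟩
  · exact ((en_Qq k _).inv.app (en_Mm _).inv).red
  · exact ((en_Pp _).app (en_Mm _)).red

theorem step (L : List Lt) (l m : Lt) (Y : List Lt)
    (hY : (G k (mk (L ++ [l]))).toWord = Y ++ ML k l ++ QL k l) (hr : IsReduced (L ++ [l, m])) :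
    ∃ R, R ≠ [] ∧ (mk R : F2) = mk (QL k l) * mk (PL k m) ∧
      (G k (mk (L ++ [l] ++ [m]))).toWord = (Y ++ ML k l ++ R) ++ ML k m ++ QL k m := by
  have hlm : l ≠ li m := by
    rintro rfl
    have := red_right hr
    simp [li] at this
  obtain ⟨R, h1, h2⟩ := jn k l m hlm
  refine ⟨R, h2.ne, h1, ?_⟩
  have e : G k (mk (L ++ [l] ++ [m])) = mk ((Y ++ ML k l ++ R) ++ ML k m ++ QL k m) := by
    rw [← mul_mk, map_mul, ← mk_toWord (x := G k (mk (L ++ [l]))), hY, G_letter]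
    simp only [← mul_mk, h1, mul_assoc]
  rw [e]
  apply toWord_mk_of_red
  apply IsReduced.append_overlap _ (en_Q k m) (en_ML k m).ne
  apply IsReduced.append_overlap _ (h2.app (en_ML k m)).red h2.ne
  apply IsReduced.append_overlap _ ((en_ML k l).app h2).red (en_ML k l).ne
  apply red_left (B := QL k l)
  rw [← hY]; exact isReduced_toWord

theorem pre (L : List Lt) : ∀ l, IsReduced (L ++ [l]) → ∃ Y,
    (G k (mk (L ++ [l]))).toWord = Y ++ ML k l ++ QL k l ∧
    (mk Y : F2) = G k (mk L) * mk (PL k l) ∧ L.length ≤ Y.length := by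
  induction L using List.reverseRecOn with
  | nil =>
    intro l _
    refine ⟨PL k l, ?_, ?_, by simp⟩
    · rw [List.nil_append, G_letter, mul_mk, mul_mk]
      exact toWord_mk_of_red (IsReduced.append_overlap (en_P k l) (en_Q k l) (en_ML k l).ne)
    · have : (mk [] : F2) = 1 := rfl
      rw [this]; simp
  | append_singleton L l ih =>
    intro m hr
    have hr' : IsReduced (L ++ [l, m]) := by simpa using hr
    obtain ⟨Y, h1, h2, h3⟩ := ih l (red_left hr)
    obtain ⟨R, h4, h5, h6⟩ := step k L l m Y h1 hr'
    refine ⟨_, h6, ?_, ?_⟩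
    · rw [← mul_mk, h5, ← mul_assoc, mul_mk, ← h1, mk_toWord]
    · have := List.length_pos_iff.2 h4
      simp; omega

theorem mid (L : List Lt) (l : Lt) (L2 : List Lt) (hr : IsReduced (L ++ [l] ++ L2)) : ∃ Y V,
    (G k (mk (L ++ [l] ++ L2))).toWord = Y ++ ML k l ++ V ∧
    (mk Y : F2) = G k (mk L) * mk (PL k l) ∧ L.length ≤ Y.length ∧ L2.length ≤ V.length := by
  obtain ⟨Y, h1, h2, h3⟩ := pre k L l (red_left hr)
  suffices h : ∃ n S Z C, L ++ [l] ++ L2 = S ++ [n] ∧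
      (G k (mk (S ++ [n]))).toWord = Z ++ ML k n ++ QL k n ∧ Z ++ ML k n = Y ++ ML k l ++ C ∧
      L2.length ≤ C.length by
    obtain ⟨n, S, Z, C, e1, e2, e3, e4⟩ := h
    refine ⟨Y, C ++ QL k n, ?_, h2, h3, by simp; omega⟩
    rw [e1, e2, e3, List.append_assoc]
  induction L2 using List.reverseRecOn with
  | nil => exact ⟨l, L, Y, [], by simp, h1, by simp, by simp⟩
  | append_singleton L2 m ih =>
    obtain ⟨n, S, Z, C, e1, e2, e3, e4⟩ := ih (by rw [← List.append_assoc] at hr; exact red_left hr)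
    have hr' : IsReduced (S ++ [n, m]) := by
      rw [← List.append_assoc, e1] at hr; simpa using hr
    obtain ⟨R, h4, h5, h6⟩ := step k S n m Z e2 hr'
    refine ⟨m, S ++ [n], _, C ++ R ++ ML k m, by rw [← e1]; simp, h6, ?_, ?_⟩
    · rw [e3]; simp
    · have := List.length_pos_iff.2 h4
      simp; omega

theorem G_inj : Function.Injective (G k) := by
  rw [injective_iff_map_eq_one]
  intro g hg
  by_contra hne
  have h1 : g.toWord ≠ [] := by rwa [ne_eq, toWord_eq_nil_iff]
  obtain ⟨L, l, e⟩ := List.eq_nil_or_concat g.toWord |>.resolve_left h1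
  rw [List.concat_eq_append] at e
  obtain ⟨Y, h2, -, -⟩ := pre k L l (by rw [← e]; exact isReduced_toWord)
  rw [← e, mk_toWord, hg, toWord_one] at h2
  have := (en_ML k l).ne
  simp_all

theorem norm_pow_ge (v : F2) (hv : v ≠ 1) (n : ℕ) : n ≤ (v ^ n).norm := by
  rcases n with _ | n
  · simp
  rw [FreeGroup.norm, toWord_pow, reduceCyclically.reduce_flatten_replicate_succ isReduced_toWord]
  have hne : reduceCyclically v.toWord ≠ [] := by
    intro h
    have := reduceCyclically.conj_conjugator_reduceCyclically v.toWord
    rw [h] at this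
    apply hv
    rw [← mk_toWord (x := v), ← this, List.append_nil, ← mul_mk, ← inv_mk, mul_inv_cancel]
  have := List.length_pos_iff.2 hne
  simp
  nlinarith

theorem range_G : (G k).range = Subgroup.closure {omegaX (k + 5), omegaY (k + 5)} := by
  unfold G
  rw [range_lift_eq_closure]
  congr 1
  ext; simp [or_comm]

theorem noncyc : ¬ IsCyclic ↥(Subgroup.closure {omegaX (k + 5), omegaY (k + 5)}) := by
  rw [← range_G]
  intro h
  have hc : ∀ a b : (G k).range, a * b = b * a := by
    let _ := @IsCyclic.commGroup _ _ h
    exact fun a b => mul_comm a b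
  have := hc ⟨_, of 0, rfl⟩ ⟨_, of 1, rfl⟩
  have := congrArg Subtype.val this
  simp only [Subgroup.coe_mul] at this
  rw [← map_mul, ← map_mul] at this
  have := G_inj k this
  revert this; decide

/-- the two distinguished exponents -/
def Good (m : ℕ) : Prop := m = 4 ∨ m = k + 9

/-- deep occurrence with controlled position -/
def Occ (w : F2) (i : Fin 2) (K : ℕ) : Prop := ∃ n : ℤ, ∃ U V : List Lt, K ≤ U.length ∧ K ≤ V.length ∧
    (w ^ n).toWord = U ++ Mm (ss k i + 1) ++ V

theorem exists_occ (w : F2) (hw : w ∈ (G k).range) (h1 : w ≠ 1) (K : ℕ) :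
    Occ k w 0 K ∨ Occ k w 1 K := by
  obtain ⟨v, rfl⟩ := hw
  have hv : v ≠ 1 := by rintro rfl; exact h1 (map_one _)
  have hn := norm_pow_ge v hv (2 * K + 1)
  unfold FreeGroup.norm at hn
  have hK : K < (v ^ (2 * K + 1)).toWord.length := by omega
  have e : (v ^ (2 * K + 1)).toWord = (v ^ (2 * K + 1)).toWord.take K ++
      [(v ^ (2 * K + 1)).toWord[K]] ++ (v ^ (2 * K + 1)).toWord.drop (K + 1) := by
    simp
  generalize hl : (v ^ (2 * K + 1)).toWord[K] = l at e
  obtain ⟨Y, V, h2, -, h3, h4⟩ := mid k _ l _ (by rw [← e]; exact isReduced_toWord)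
  rw [← e, mk_toWord, map_pow] at h2
  simp only [List.length_take, List.length_drop] at h3 h4
  have : Occ k (G k v) l.1 K := by
    rcases l with ⟨i, _ | _⟩
    · refine ⟨-(2 * K + 1 : ℕ), invRev V, invRev Y, by simp; omega, by simp; omega, ?_⟩
      rw [zpow_neg, zpow_natCast, toWord_inv, h2, invRev_append, invRev_append, List.append_assoc]
      simp [ML, invRev_invRev]
    · exact ⟨(2 * K + 1 : ℕ), Y, V, by omega, by omega, by rw [zpow_natCast, h2]; rfl⟩
  generalize l.1 = i at this
  fin_cases i
  · left; exact this
  · right; exact this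

theorem exists_lang (w : F2) (hw : w ∈ (G k).range) (h1 : w ≠ 1) :
    ∃ m, Good k m ∧ Lang w (Mm m) := by
  have mono : ∀ i K K', K ≤ K' → Occ k w i K' → Occ k w i K := by
    rintro i K K' hK ⟨n, U, V, a, b, c⟩
    exact ⟨n, U, V, by omega, by omega, c⟩
  by_cases h : ∀ K, Occ k w 0 K
  · refine ⟨4, Or.inl rfl, fun K => ?_⟩
    have h3 := h K
    unfold Occ at h3
    have e : ss k 0 + 1 = 4 := rfl
    rwa [e] at h3
  · push Not at h
    obtain ⟨K0, hK0⟩ := h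
    refine ⟨k + 9, Or.inr rfl, fun K => ?_⟩
    have h2 : Occ k w 1 (max K K0) := by
      refine (exists_occ k w hw h1 (max K K0)).resolve_left fun h => hK0 (mono _ _ _ (le_max_right _ _) h)
    have h3 : Occ k w 1 K := mono _ _ _ (le_max_left _ _) h2
    unfold Occ at h3
    have e : ss k 1 + 1 = k + 9 := rfl
    rwa [e] at h3

end MC

namespace MC
open FreeGroup hiding map_mul map_inv map_one

/-- vertices of the folded graph -/
inductive Vx
  | A (i j : ℕ) : Vx
  | B (i t : ℕ) : Vx

open Vx

variable (ρ : ℕ)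

def s1 (i : ℕ) : ℕ := if i = 4 then ρ + 3 else if i = ρ + 3 then 2 * ρ + 2 else i - 1
def s2 (i : ℕ) : ℕ := if i = 4 then 3 else if i = ρ + 3 then 2 * ρ + 2 else i - 1
def d1 (i : ℕ) : ℕ := if i = ρ + 2 then 2 * ρ + 2 else i
def d2 (i : ℕ) : ℕ := if i = ρ + 2 then ρ else 0

/-- edges -/
def Ed (v : Vx) (c : Fin 2) (v' : Vx) : Prop :=
  (c = 0 ∧ ∃ i, 4 ≤ i ∧ i ≤ 2 * ρ + 2 ∧ ((v = B (s1 ρ i) (s2 ρ i) ∧ v' = A i 1) ∨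
    (v = A i 1 ∧ v' = A i 2) ∨ (v = A i 2 ∧ v' = B (d1 ρ i) (d2 ρ i)))) ∨
  (c = 1 ∧ ∃ i t, 4 ≤ i ∧ i ≤ 2 * ρ + 2 ∧ i ≠ ρ + 2 ∧ t < i ∧ v = B i t ∧ v' = B i (t + 1))

theorem Ed.a {v v' : Vx} (h : Ed ρ v 0 v') : ∃ i, 4 ≤ i ∧ i ≤ 2 * ρ + 2 ∧
    ((v = B (s1 ρ i) (s2 ρ i) ∧ v' = A i 1) ∨
    (v = A i 1 ∧ v' = A i 2) ∨ (v = A i 2 ∧ v' = B (d1 ρ i) (d2 ρ i))) := by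
  rcases h with ⟨-, h⟩ | ⟨h, -⟩
  · exact h
  · simp at h

theorem Ed.b {v v' : Vx} (h : Ed ρ v 1 v') : ∃ i t, 4 ≤ i ∧ i ≤ 2 * ρ + 2 ∧ i ≠ ρ + 2 ∧ t < i ∧
    v = B i t ∧ v' = B i (t + 1) := by
  rcases h with ⟨h, -⟩ | ⟨-, h⟩
  · simp at h
  · exact h

variable {ρ}

theorem s_inj (hρ : 10 ≤ ρ) {i j : ℕ} (hi : 4 ≤ i) (hj : 4 ≤ j) (hi' : i ≤ 2 * ρ + 2)
    (hj' : j ≤ 2 * ρ + 2)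
    (h1 : s1 ρ i = s1 ρ j) (h2 : s2 ρ i = s2 ρ j) : i = j := by
  unfold s1 s2 at *; split_ifs at * <;> omega

theorem d_inj {i j : ℕ} (hi : 4 ≤ i) (hj : 4 ≤ j) (hi' : i ≤ 2 * ρ + 2)
    (hj' : j ≤ 2 * ρ + 2)
    (h1 : d1 ρ i = d1 ρ j) (h2 : d2 ρ i = d2 ρ j) : i = j := by
  unfold d1 d2 at *; split_ifs at * <;> omega

theorem Ed.fn (hρ : 10 ≤ ρ) {v v1 v2 : Vx} {c : Fin 2} (h : Ed ρ v c v1) (h' : Ed ρ v c v2) : v1 = v2 := by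
  obtain rfl | rfl : c = 0 ∨ c = 1 := by clear h h'; revert c; decide
  · obtain ⟨i, hi, hi', h⟩ := h.a
    obtain ⟨j, hj, hj', h'⟩ := h'.a
    rcases h with ⟨rfl, rfl⟩ | ⟨rfl, rfl⟩ | ⟨rfl, rfl⟩ <;>
    rcases h' with ⟨e, rfl⟩ | ⟨e, rfl⟩ | ⟨e, rfl⟩ <;> simp at e <;>
    first
    | rw [e]
    | rw [s_inj hρ hi hj hi' hj' e.1 e.2]
  · obtain ⟨i, t, _, _, _, _, rfl, rfl⟩ := h.b
    obtain ⟨i', t', _, _, _, _, e, rfl⟩ := h'.b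
    simp at e
    simp [e]

theorem Ed.inj (hρ : 10 ≤ ρ) {v v1 v2 : Vx} {c : Fin 2} (h : Ed ρ v1 c v) (h' : Ed ρ v2 c v) : v1 = v2 := by
  obtain rfl | rfl : c = 0 ∨ c = 1 := by clear h h'; revert c; decide
  · obtain ⟨i, hi, hi', h⟩ := h.a
    obtain ⟨j, hj, hj', h'⟩ := h'.a
    rcases h with ⟨rfl, rfl⟩ | ⟨rfl, rfl⟩ | ⟨rfl, rfl⟩ <;>
    rcases h' with ⟨rfl, e⟩ | ⟨rfl, e⟩ | ⟨rfl, e⟩ <;> simp at e <;>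
    first
    | rw [e]
    | rw [d_inj hi hj hi' hj' e.1 e.2]
  · obtain ⟨i, t, _, _, _, _, rfl, rfl⟩ := h.b
    obtain ⟨i', t', _, _, _, _, rfl, e⟩ := h'.b
    simp at e
    simp [e]

variable (ρ)

/-- reading one letter -/
def Stp (v : Vx) (c : Lt) (v' : Vx) : Prop :=
  (c.2 = true ∧ Ed ρ v c.1 v') ∨ (c.2 = false ∧ Ed ρ v' c.1 v)

/-- reading a word -/
def Path : Vx → List Lt → Vx → Prop
  | v, [], v' => v = v'
  | v, c :: W, v' => ∃ u, Stp ρ v c u ∧ Path u W v'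

variable {ρ}

theorem path_append {v v' : Vx} {W W' : List Lt} : Path ρ v (W ++ W') v' ↔
    ∃ u, Path ρ v W u ∧ Path ρ u W' v' := by
  induction W generalizing v with
  | nil => simp [Path]
  | cons c W ih =>
    simp only [List.cons_append, Path, ih]
    constructor
    · rintro ⟨u, h1, x, h2, h3⟩; exact ⟨x, ⟨u, h1, h2⟩, h3⟩
    · rintro ⟨x, ⟨u, h1, h2⟩, h3⟩; exact ⟨u, h1, x, h2, h3⟩

theorem path_single {v v' : Vx} {c : Lt} : Path ρ v [c] v' ↔ Stp ρ v c v' := by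
  simp [Path]

theorem Stp.inv {v v' : Vx} {c : Lt} (h : Stp ρ v c v') : Stp ρ v' (li c) v := by
  rcases h with ⟨h1, h2⟩ | ⟨h1, h2⟩
  · right; exact ⟨by simp [li, h1], h2⟩
  · left; exact ⟨by simp [li, h1], h2⟩

theorem Path.inv {W : List Lt} : ∀ {v v' : Vx}, Path ρ v W v' → Path ρ v' (invRev W) v := by
  induction W with
  | nil => intro v v' h; exact h.symm
  | cons c W ih =>
    rintro v v' ⟨u, h1, h2⟩
    rw [invRev_cons, path_append]
    exact ⟨u, ih h2, path_single.2 h1.inv⟩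

theorem Stp.fn (hρ : 10 ≤ ρ) {v v1 v2 : Vx} {c : Lt} (h : Stp ρ v c v1) (h' : Stp ρ v c v2) : v1 = v2 := by
  rcases h with ⟨h1, h2⟩ | ⟨h1, h2⟩ <;> rcases h' with ⟨h1', h2'⟩ | ⟨h1', h2'⟩
  · exact h2.fn hρ h2'
  · simp_all
  · simp_all
  · exact h2.inj hρ h2'

theorem path_red (hρ : 10 ≤ ρ) {v v' : Vx} {W W' : List Lt} (h : Red W W') (hp : Path ρ v W v') :
    Path ρ v W' v' := by
  induction h with
  | refl => exact hp
  | tail _ hs ih =>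
    cases hs with
    | @not L1 L2 x b =>
      rw [path_append] at ih
      obtain ⟨u, h1, u1, h2, u2, h3, h4⟩ := ih
      have h5 : Stp ρ u1 (li (x, b)) u := h2.inv
      have : u = u2 := h5.fn hρ h3
      subst this
      rw [path_append]
      exact ⟨u, h1, h4⟩

/-- group elements readable between two vertices -/
def PG (ρ : ℕ) (v : Vx) (g : F2) (v' : Vx) : Prop := ∃ W, mk W = g ∧ Path ρ v W v'

theorem PG.toWord (hρ : 10 ≤ ρ) {v v' : Vx} {g : F2} (h : PG ρ v g v') : Path ρ v g.toWord v' := by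
  obtain ⟨W, rfl, h⟩ := h
  rw [toWord_mk]
  exact path_red hρ reduce.red h

theorem PG.mul {u v w : Vx} {g h : F2} (h1 : PG ρ u g v) (h2 : PG ρ v h w) : PG ρ u (g * h) w := by
  obtain ⟨W, rfl, h1⟩ := h1
  obtain ⟨W', rfl, h2⟩ := h2
  exact ⟨W ++ W', by rw [mul_mk], path_append.2 ⟨_, h1, h2⟩⟩

theorem PG.inv {u v : Vx} {g : F2} (h1 : PG ρ u g v) : PG ρ v g⁻¹ u := by
  obtain ⟨W, rfl, h1⟩ := h1
  exact ⟨invRev W, by rw [inv_mk], h1.inv⟩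

theorem PG.one (u : Vx) : PG ρ u 1 u := ⟨[], rfl, rfl⟩

theorem pg_a {u v : Vx} (h : Ed ρ u 0 v) : PG ρ u fa v :=
  ⟨[A1], rfl, path_single.2 (Or.inl ⟨rfl, h⟩)⟩
theorem pg_b {u v : Vx} (h : Ed ρ u 1 v) : PG ρ u fb v :=
  ⟨[B1], rfl, path_single.2 (Or.inl ⟨rfl, h⟩)⟩

theorem pg_seg {i : ℕ} (hi : 4 ≤ i) (hi' : i ≤ 2 * ρ + 2) :
    PG ρ (B (s1 ρ i) (s2 ρ i)) (fa ^ 3) (B (d1 ρ i) (d2 ρ i)) := by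
  have h1 : Ed ρ (B (s1 ρ i) (s2 ρ i)) 0 (A i 1) := Or.inl ⟨rfl, i, hi, hi', by simp⟩
  have h2 : Ed ρ (A i 1) 0 (A i 2) := Or.inl ⟨rfl, i, hi, hi', by simp⟩
  have h3 : Ed ρ (A i 2) 0 (B (d1 ρ i) (d2 ρ i)) := Or.inl ⟨rfl, i, hi, hi', by simp⟩
  have := ((pg_a h1).mul (pg_a h2)).mul (pg_a h3)
  convert this using 1; simp [pow_succ]

theorem pg_line {i : ℕ} (hi : 4 ≤ i) (hi' : i ≤ 2 * ρ + 2) (hn : i ≠ ρ + 2) (t : ℕ) (n : ℕ) (h : t + n ≤ i) :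
    PG ρ (B i t) (fb ^ n) (B i (t + n)) := by
  induction n with
  | zero => exact PG.one _
  | succ n ih =>
    rw [pow_succ]
    refine (ih (by omega)).mul (pg_b (Or.inr ⟨rfl, i, t + n, hi, hi', hn, by omega, rfl, rfl⟩))

/-- base vertex -/
def oo (ρ : ℕ) : Vx := B (2 * ρ + 2) (2 * ρ + 2)

theorem pg_step {v : Vx} {g : F2} {i j t n j' t' : ℕ} (h : PG ρ v g (B (s1 ρ i) (s2 ρ i)))
    (hi : 4 ≤ i) (hi' : i ≤ 2 * ρ + 2)
    (h1 : d1 ρ i = j) (h2 : d2 ρ i = t) (hj : 4 ≤ j) (hj' : j ≤ 2 * ρ + 2) (hn : j ≠ ρ + 2)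
    (htn : t + n ≤ j) (e1 : j' = j) (e2 : t' = t + n) :
    PG ρ v (g * (fa ^ 3 * fb ^ n)) (B j' t') := by
  subst e1 e2 h1 h2
  exact h.mul ((pg_seg hi hi').mul (pg_line hj hj' hn _ n htn))

theorem pg_x (hρ : 10 ≤ ρ) : PG ρ (oo ρ) (omegaX ρ) (oo ρ) := by
  rw [omegaX_eq]
  have h : ∀ n, n + 2 ≤ ρ → PG ρ (oo ρ) (cb 3 (n + 1)) (B (s1 ρ (n + 4)) (s2 ρ (n + 4))) := by
    intro n
    induction n with
    | zero =>
      intro _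
      rw [cb_succ]
      refine pg_step (i := ρ + 3) (j := ρ + 3) (t := 0) ?_ (by omega) (by omega) ?_ ?_ (by omega)
        (by omega) (by omega) (by omega) ?_ ?_
      · have : oo ρ = B (s1 ρ (ρ + 3)) (s2 ρ (ρ + 3)) := by
          unfold oo s1 s2; congr 1 <;> split_ifs <;> omega
        rw [← this]; exact PG.one _
      all_goals first | unfold s1 | unfold s2 | unfold d1 | unfold d2
      all_goals split_ifs <;> omega
    | succ n ih =>
      intro hn
      rw [cb_succ]
      refine pg_step (j := n + 4) (t := 0) (ih (by omega)) (by omega) (by omega) ?_ ?_ (by omega)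
        (by omega) (by omega) (by omega) ?_ ?_
      all_goals first | unfold s1 | unfold s2 | unfold d1 | unfold d2
      all_goals split_ifs <;> omega
  obtain ⟨n, rfl⟩ : ∃ n, ρ = n + 2 := ⟨ρ - 2, by omega⟩
  have := h n le_rfl
  rw [cb_succ]
  refine pg_step (j := 2 * (n + 2) + 2) (t := n + 2) this (by omega) (by omega) ?_ ?_ (by omega)
        (by omega) (by omega) (by omega) ?_ ?_
  all_goals first | rfl | unfold d1 | unfold d2 | skip
  all_goals first | omega | (split_ifs <;> omega)

theorem pg_y (hρ : 10 ≤ ρ) : PG ρ (oo ρ) (omegaY ρ) (oo ρ) := by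
  rw [omegaY_eq]
  have h : ∀ n, n + 1 ≤ ρ → PG ρ (oo ρ) (cb (ρ + 3) n) (B (s1 ρ (n + ρ + 3)) (s2 ρ (n + ρ + 3))) := by
    intro n
    induction n with
    | zero =>
      intro _
      have : oo ρ = B (s1 ρ (0 + ρ + 3)) (s2 ρ (0 + ρ + 3)) := by
        unfold oo s1 s2; congr 1 <;> split_ifs <;> omega
      rw [← this]; exact PG.one _
    | succ n ih =>
      intro hn
      rw [cb_succ]
      refine pg_step (j := n + ρ + 3) (t := 0) (ih (by omega)) (by omega) (by omega) ?_ ?_ (by omega)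
        (by omega) (by omega) (by omega) ?_ ?_
      all_goals first | unfold s1 | unfold s2 | unfold d1 | unfold d2
      all_goals split_ifs <;> omega
  obtain ⟨n, rfl⟩ : ∃ n, ρ = n + 1 := ⟨ρ - 1, by omega⟩
  have := h n le_rfl
  rw [cb_succ]
  refine pg_step (j := 2 * (n + 1) + 2) (t := 0) this (by omega) (by omega) ?_ ?_ (by omega)
        (by omega) (by omega) (by omega) ?_ ?_
  all_goals first | rfl | unfold d1 | unfold d2 | skip
  all_goals first | omega | (split_ifs <;> omega)

def LL (ρ : ℕ) : Subgroup F2 := Subgroup.closure {omegaX ρ, omegaY ρ}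

theorem LL_path (hρ : 10 ≤ ρ) {g : F2} (hg : g ∈ LL ρ) : Path ρ (oo ρ) g.toWord (oo ρ) := by
  apply PG.toWord hρ
  induction hg using Subgroup.closure_induction with
  | mem x hx =>
    rcases hx with rfl | rfl
    · exact pg_x hρ
    · exact pg_y hρ
  | one => exact PG.one _
  | mul x y _ _ h1 h2 => exact h1.mul h2
  | inv x _ h => exact h.inv

/-- labels -/
def hd (ρ i : ℕ) : F2 := if i ≤ ρ + 2 then cb 3 (i - 3) else cb (ρ + 3) (i - ρ - 3)

def lam (ρ : ℕ) : Vx → F2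
  | A i j => hd ρ i * fa ^ j
  | B i t => hd ρ i * fa ^ 3 * fb ^ t

theorem hd_succ (i : ℕ) (hi : 4 ≤ i) (hn : i ≠ ρ + 2) :
    hd ρ i * fa ^ 3 * fb ^ i = hd ρ (i + 1) := by
  unfold hd
  by_cases h : i ≤ ρ + 2
  · rw [if_pos h, if_pos (by omega)]
    obtain ⟨j, rfl⟩ : ∃ j, i = j + 3 := ⟨i - 3, by omega⟩
    have : j + 3 + 1 - 3 = j + 1 := by omega
    rw [this, cb_succ, Nat.add_sub_cancel, mul_assoc]
  · rw [if_neg h, if_neg (by omega)]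
    obtain ⟨j, rfl⟩ : ∃ j, i = j + ρ + 3 := ⟨i - ρ - 3, by omega⟩
    have : j + ρ + 3 + 1 - ρ - 3 = j + 1 := by omega
    have e2 : j + ρ + 3 - ρ - 3 = j := by omega
    rw [this, cb_succ, e2, mul_assoc]; congr 3

theorem x_mem : omegaX ρ ∈ LL ρ := Subgroup.subset_closure (by simp)
theorem y_mem : omegaY ρ ∈ LL ρ := Subgroup.subset_closure (by simp)

theorem hd_x (hρ : 10 ≤ ρ) : hd ρ (ρ + 2) * fa ^ 3 * fb ^ (ρ + 2) = omegaX ρ := by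
  unfold hd
  rw [if_pos le_rfl, omegaX_eq]
  obtain ⟨n, rfl⟩ : ∃ n, ρ = n + 1 := ⟨ρ - 1, by omega⟩
  rw [cb_succ]
  have : n + 1 + 2 - 3 = n := by omega
  rw [this, mul_assoc]
theorem hd_y (hρ : 10 ≤ ρ) : hd ρ (2 * ρ + 2) * fa ^ 3 * fb ^ (2 * ρ + 2) = omegaY ρ := by
  unfold hd
  rw [if_neg (by omega), omegaY_eq]
  obtain ⟨n, rfl⟩ : ∃ n, ρ = n + 1 := ⟨ρ - 1, by omega⟩
  rw [cb_succ]
  have : 2 * (n + 1) + 2 - (n + 1) - 3 = n := by omega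
  rw [this, mul_assoc]
  congr 3; ring

theorem lam_src (hρ : 10 ≤ ρ) (i : ℕ) (hi : 4 ≤ i) : ∃ l ∈ LL ρ,
    lam ρ (B (s1 ρ i) (s2 ρ i)) = l * hd ρ i := by
  by_cases h4 : i = 4
  · subst h4
    refine ⟨1, one_mem _, ?_⟩
    have e1 : s1 ρ 4 = ρ + 3 := by simp [s1]
    have e2 : s2 ρ 4 = 3 := by simp [s2]
    rw [e1, e2, lam, hd, hd, if_neg (by omega), if_pos (by omega)]
    have : ρ + 3 - ρ - 3 = 0 := by omega
    rw [this]
    simp [cb_succ, cb_zero]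
  · by_cases h3 : i = ρ + 3
    · refine ⟨omegaY ρ, y_mem, ?_⟩
      have e1 : s1 ρ i = 2 * ρ + 2 := by rw [s1, if_neg h4, if_pos h3]
      have e2 : s2 ρ i = 2 * ρ + 2 := by rw [s2, if_neg h4, if_pos h3]
      rw [e1, e2, lam, hd_y hρ, hd, if_neg (by omega)]
      have : i - ρ - 3 = 0 := by omega
      rw [this, cb_zero, mul_one]
    · refine ⟨1, one_mem _, ?_⟩
      obtain ⟨j, rfl⟩ : ∃ j, i = j + 1 := ⟨i - 1, by omega⟩
      have e1 : s1 ρ (j + 1) = j := by rw [s1, if_neg h4, if_neg h3]; rfl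
      have e2 : s2 ρ (j + 1) = j := by rw [s2, if_neg h4, if_neg h3]; rfl
      rw [e1, e2, lam, one_mul, hd_succ j (by omega) (by omega)]

theorem lam_dst (hρ : 10 ≤ ρ) (i : ℕ) : ∃ l ∈ LL ρ,
    hd ρ i * fa ^ 3 = l * lam ρ (B (d1 ρ i) (d2 ρ i)) := by
  by_cases h : i = ρ + 2
  · refine ⟨omegaX ρ * (omegaY ρ)⁻¹, mul_mem x_mem (inv_mem y_mem), ?_⟩
    have e1 : d1 ρ i = 2 * ρ + 2 := by rw [d1, if_pos h]
    have e2 : d2 ρ i = ρ := by rw [d2, if_pos h]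
    have e3 : 2 * ρ + 2 = ρ + (ρ + 2) := by ring
    rw [e1, e2, lam, ← hd_x hρ, ← hd_y hρ, h]
    generalize hd ρ (2 * ρ + 2) = y
    rw [e3, pow_add fb ρ]
    group
  · refine ⟨1, one_mem _, ?_⟩
    have e1 : d1 ρ i = i := by rw [d1, if_neg h]
    have e2 : d2 ρ i = 0 := by rw [d2, if_neg h]
    rw [e1, e2, lam]; simp

theorem ed_lam (hρ : 10 ≤ ρ) {v v' : Vx} {c : Fin 2} (h : Ed ρ v c v') :
    ∃ l ∈ LL ρ, lam ρ v * of c = l * lam ρ v' := by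
  rcases h with ⟨rfl, i, hi, hi', ⟨rfl, rfl⟩ | ⟨rfl, rfl⟩ | ⟨rfl, rfl⟩⟩ |
    ⟨rfl, i, t, hi, hi', hn, ht, rfl, rfl⟩
  · obtain ⟨l, hl, e⟩ := lam_src hρ i hi
    exact ⟨l, hl, by rw [e, lam, pow_one, mul_assoc]; rfl⟩
  · exact ⟨1, one_mem _, by simp [lam, pow_succ, mul_assoc, fa]⟩
  · obtain ⟨l, hl, e⟩ := lam_dst hρ i
    exact ⟨l, hl, by rw [← e, lam, pow_succ _ 2, ← mul_assoc]; rfl⟩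
  · exact ⟨1, one_mem _, by simp [lam, pow_succ, mul_assoc, fb]⟩

theorem path_lam (hρ : 10 ≤ ρ) {W : List Lt} : ∀ {v v' : Vx}, Path ρ v W v' →
    ∃ l ∈ LL ρ, lam ρ v * mk W = l * lam ρ v' := by
  induction W with
  | nil =>
    rintro v v' rfl
    have : (mk [] : F2) = 1 := rfl
    exact ⟨1, one_mem _, by rw [this]; simp⟩
  | cons c W ih =>
    rintro v v' ⟨u, h1, h2⟩
    obtain ⟨l, hl, e⟩ := ih h2
    have : ∃ l ∈ LL ρ, lam ρ v * mk [c] = l * lam ρ u := by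
      rcases c with ⟨i, s⟩
      rcases h1 with ⟨rfl, h1⟩ | ⟨rfl, h1⟩
      · exact ed_lam hρ h1
      · obtain ⟨l, hl, e⟩ := ed_lam hρ h1
        refine ⟨l⁻¹, inv_mem hl, ?_⟩
        have : (mk [(i, false)] : F2) = (of i)⁻¹ := rfl
        simp only [this]
        rw [mul_inv_eq_iff_eq_mul, mul_assoc, e]; group
    obtain ⟨l', hl', e'⟩ := this
    refine ⟨l' * l, mul_mem hl' hl, ?_⟩
    rw [mk_cons, ← mul_assoc, e', mul_assoc, e, mul_assoc]

theorem path_base (hρ : 10 ≤ ρ) {W : List Lt} {v : Vx} (h : Path ρ (oo ρ) W v) :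
    ∃ l ∈ LL ρ, mk W = l * lam ρ v := by
  obtain ⟨l, hl, e⟩ := path_lam hρ h
  have e1 : lam ρ (oo ρ) = omegaY ρ := hd_y hρ
  rw [e1] at e
  refine ⟨(omegaY ρ)⁻¹ * l, mul_mem (inv_mem y_mem) hl, ?_⟩
  rw [mul_assoc, ← e]; group

end MC

namespace MC
open FreeGroup hiding map_mul map_inv map_one
open Vx

variable {ρ : ℕ}

/-- the vertex meets an edge labelled `c` -/
def Has (ρ : ℕ) (c : Fin 2) (u : Vx) : Prop := ∃ v, Ed ρ u c v ∨ Ed ρ v c u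

theorem hasB {u : Vx} (h : Has ρ 1 u) : ∃ i t, 4 ≤ i ∧ i ≤ 2 * ρ + 2 ∧ i ≠ ρ + 2 ∧ t ≤ i ∧ u = B i t := by
  obtain ⟨v, h | h⟩ := h
  · obtain ⟨i, t, h1, h2, h3, h4, h5, -⟩ := h.b
    exact ⟨i, t, h1, h2, h3, h4.le, h5⟩
  · obtain ⟨i, t, h1, h2, h3, h4, -, h5⟩ := h.b
    exact ⟨i, t + 1, h1, h2, h3, h4, h5⟩

theorem outA {i t : ℕ} {v : Vx} (h : Ed ρ (B i t) 0 v) :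
    ∃ j, 4 ≤ j ∧ j ≤ 2 * ρ + 2 ∧ v = A j 1 ∧ i = s1 ρ j ∧ t = s2 ρ j := by
  obtain ⟨j, h1, h2, h3⟩ := h.a
  rcases h3 with ⟨e, rfl⟩ | ⟨e, rfl⟩ | ⟨e, rfl⟩ <;> simp at e
  exact ⟨j, h1, h2, rfl, e.1, e.2⟩

theorem inA {i t : ℕ} {v : Vx} (h : Ed ρ v 0 (B i t)) :
    ∃ j, 4 ≤ j ∧ j ≤ 2 * ρ + 2 ∧ v = A j 2 ∧ i = d1 ρ j ∧ t = d2 ρ j := by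
  obtain ⟨j, h1, h2, h3⟩ := h.a
  rcases h3 with ⟨rfl, e⟩ | ⟨rfl, e⟩ | ⟨rfl, e⟩ <;> simp at e
  exact ⟨j, h1, h2, rfl, e.1, e.2⟩

theorem outA' {i t : ℕ} {v : Vx} (h : Ed ρ (B i t) 0 v) : (i = ρ + 3 ∧ t = 3) ∨ t = i := by
  obtain ⟨j, h1, h2, -, h3, h4⟩ := outA h
  unfold s1 at h3; unfold s2 at h4
  split_ifs at * <;> omega

theorem inA' {i t : ℕ} {v : Vx} (h : Ed ρ v 0 (B i t)) : (i = 2 * ρ + 2 ∧ t = ρ) ∨ (t = 0 ∧ v = A i 2) := by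
  obtain ⟨j, h1, h2, rfl, h3, h4⟩ := inA h
  unfold d1 at h3; unfold d2 at h4
  split_ifs at *
  · left; omega
  · right; subst h3; exact ⟨h4, rfl⟩

theorem hasA {i t : ℕ} (h : Has ρ 0 (B i t)) :
    t = 0 ∨ t = i ∨ (i = ρ + 3 ∧ t = 3) ∨ (i = 2 * ρ + 2 ∧ t = ρ) := by
  obtain ⟨v, h | h⟩ := h
  · have := outA' h; tauto
  · have := inA' h; tauto

theorem isoA {u v : Vx} (h : Ed ρ u 0 v) (h1 : Has ρ 1 u) (h2 : Has ρ 1 v) : False := by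
  obtain ⟨i, t, -, -, -, -, rfl⟩ := hasB h1
  obtain ⟨i', t', -, -, -, -, rfl⟩ := hasB h2
  obtain ⟨j, -, -, e, -⟩ := outA h
  simp at e

theorem isoB (hρ : 10 ≤ ρ) {u v : Vx} (h : Ed ρ u 1 v) (h1 : Has ρ 0 u) (h2 : Has ρ 0 v) : False := by
  obtain ⟨i, t, h3, h4, h5, h6, rfl, rfl⟩ := h.b
  have h1 := hasA h1
  have h2 := hasA h2
  omega

theorem Stp.has {u v : Vx} {l : Lt} (h : Stp ρ u l v) : Has ρ l.1 u ∧ Has ρ l.1 v := by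
  rcases h with ⟨-, h⟩ | ⟨-, h⟩
  · exact ⟨⟨v, Or.inl h⟩, ⟨u, Or.inr h⟩⟩
  · exact ⟨⟨v, Or.inr h⟩, ⟨u, Or.inl h⟩⟩

theorem triple (hρ : 10 ≤ ρ) {u v : Vx} {l m n : Lt} (h : Path ρ u [l, m, n] v) (h1 : l.1 = n.1)
    (h2 : l.1 ≠ m.1) : False := by
  obtain ⟨x, hx, y, hy, z, hz, -⟩ := h
  have a1 := hx.has.2
  have a2 := hz.has.1
  rw [← h1] at a2
  obtain ⟨i, s⟩ := m
  have e : (i = 0 ∧ l.1 = 1) ∨ (i = 1 ∧ l.1 = 0) := by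
    generalize l.1 = c at *
    simp only at h2
    clear hx hy hz a1 a2 h1
    revert c i; decide
  rcases e with ⟨rfl, e⟩ | ⟨rfl, e⟩ <;> rw [e] at a1 a2
  · rcases hy with ⟨-, hy⟩ | ⟨-, hy⟩
    · exact isoA hy a1 a2
    · exact isoA hy a2 a1
  · rcases hy with ⟨-, hy⟩ | ⟨-, hy⟩
    · exact isoB hρ hy a1 a2
    · exact isoB hρ hy a2 a1

theorem stp_pos {u v : Vx} {c : Fin 2} : Stp ρ u (c, true) v ↔ Ed ρ u c v := by simp [Stp]
theorem stp_neg {u v : Vx} {c : Fin 2} : Stp ρ u (c, false) v ↔ Ed ρ v c u := by simp [Stp]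

theorem dst_out (hρ : 10 ≤ ρ) {i : ℕ} (hi : 4 ≤ i) {v : Vx} (h : Ed ρ (B (d1 ρ i) (d2 ρ i)) 0 v) : False := by
  have := outA' h
  unfold d1 d2 at this
  by_cases e : i = ρ + 2
  · rw [if_pos e, if_pos e] at this; omega
  · rw [if_neg e, if_neg e] at this; omega

theorem four (hρ : 10 ≤ ρ) {u v : Vx} (h : Path ρ u (aa 4) v) : False := by
  obtain ⟨x, hx, y, hy, z, hz, w, hw, -⟩ := h
  rw [A1, stp_pos] at *
  obtain ⟨i, hi, hi', hx⟩ := hx.a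
  rcases hx with ⟨rfl, rfl⟩ | ⟨rfl, rfl⟩ | ⟨rfl, rfl⟩
  · obtain ⟨j, hj, hj', hy⟩ := hy.a
    rcases hy with ⟨e, rfl⟩ | ⟨e, rfl⟩ | ⟨e, rfl⟩ <;> simp at e
    subst e
    obtain ⟨j, hj, hj', hz⟩ := hz.a
    rcases hz with ⟨e, rfl⟩ | ⟨e, rfl⟩ | ⟨e, rfl⟩ <;> simp at e
    exact dst_out hρ hj hw
  · obtain ⟨j, hj, hj', hy⟩ := hy.a
    rcases hy with ⟨e, rfl⟩ | ⟨e, rfl⟩ | ⟨e, rfl⟩ <;> simp at e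
    exact dst_out hρ hj hz
  · exact dst_out hρ hi hy

theorem path_b : ∀ {n : ℕ} {v v' : Vx}, Path ρ v (bb (n + 1)) v' → ∃ i t, 4 ≤ i ∧ i ≤ 2 * ρ + 2 ∧
    i ≠ ρ + 2 ∧ t + (n + 1) ≤ i ∧ v = B i t ∧ v' = B i (t + (n + 1)) := by
  intro n
  induction n with
  | zero =>
    intro v v' h
    obtain ⟨i, t, h1, h2, h3, h4, h5, h6⟩ := (stp_pos.1 (path_single.1 h)).b
    exact ⟨i, t, h1, h2, h3, h4, h5, h6⟩
  | succ n ih =>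
    rintro v v' ⟨u, h, h'⟩
    obtain ⟨i, t, h1, h2, h3, h4, rfl, rfl⟩ := (stp_pos.1 h).b
    obtain ⟨i', t', h1', h2', h3', h4', e, rfl⟩ := ih h'
    simp at e
    obtain ⟨rfl, rfl⟩ := e
    refine ⟨i, t, h1, h2, h3, by omega, rfl, ?_⟩
    congr 1; omega

/-- `a b^n a` readable only at the expected place -/
theorem aba (hρ : 10 ≤ ρ) {n : ℕ} {u v v' u' : Vx} (h1 : Ed ρ u 0 v) (h : Path ρ v (bb (n + 1)) v')
    (h2 : Ed ρ v' 0 u') (hn : n + 1 ≠ 3) (hn' : n + 1 ≠ ρ + 2) :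
    u = A (n + 1) 2 ∧ v = B (n + 1) 0 ∧ v' = B (n + 1) (n + 1) := by
  obtain ⟨i, t, h3, h4, h5, h6, rfl, rfl⟩ := path_b h
  have a1 := inA' h1
  have a2 := outA' h2
  rcases a1 with a1 | ⟨rfl, rfl⟩
  · omega
  · have : i = n + 1 := by omega
    subst this
    simp

theorem aBa (hρ : 10 ≤ ρ) {n : ℕ} {u v v' u' : Vx} (h1 : Ed ρ u 0 v) (h : Path ρ v' (bb (n + 1)) v)
    (h2 : Ed ρ v' 0 u') : False := by
  obtain ⟨i, t, h3, h4, h5, h6, rfl, rfl⟩ := path_b h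
  have a1 := inA' h1
  have a2 := outA' h2
  omega

theorem lang_path (hρ : 10 ≤ ρ) {w : F2} (hw : w ∈ LL ρ) {p : List Lt} (h : Lang w p) :
    ∃ u v, Path ρ u p v := by
  obtain ⟨n, U, V, -, -, e⟩ := h 0
  have := LL_path hρ (zpow_mem hw n)
  rw [e, path_append] at this
  obtain ⟨u, h, -⟩ := this
  rw [path_append] at h
  obtain ⟨v, -, h⟩ := h
  exact ⟨v, u, h⟩

theorem invRev_rep (n : ℕ) (c : Fin 2) (s : Bool) :
    invRev (List.replicate n (c, s)) = List.replicate n (c, !s) := by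
  simp [invRev]

/-- Unreadability of the reversed marker -/
theorem rev_marker (hρ : 10 ≤ ρ) {m : ℕ} (hm : m = 4 ∨ m = ρ + 4) {u v : Vx}
    (h : Path ρ u (aa 1 ++ bb (m + 1) ++ aa 3 ++ bb m ++ aa 1) v) : False := by
  simp only [path_append] at h
  obtain ⟨x1, ⟨x2, ⟨x3, ⟨x4, h1, h2⟩, h3⟩, h4⟩, h5⟩ := h
  obtain ⟨p, hp, q, hq, r, hr, rfl⟩ := h3
  rw [A1, stp_pos] at hp hq hr
  have h1 := stp_pos.1 (path_single.1 h1)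
  have h5 := stp_pos.1 (path_single.1 h5)
  obtain ⟨-, -, rfl⟩ := aba hρ h1 h2 hp (by omega) (by omega)
  obtain ⟨m, rfl⟩ : ∃ n, m = n + 1 := ⟨m - 1, by omega⟩
  obtain ⟨rfl, -, -⟩ := aba hρ hr h4 h5 (by omega) (by omega)
  obtain ⟨j, hj, hj', rfl, e1, e2⟩ := outA hp
  obtain ⟨i, hi, hi', hq⟩ := hq.a
  rcases hq with ⟨e, e'⟩ | ⟨e, e'⟩ | ⟨e, e'⟩ <;> simp at e e'
  subst e e'
  unfold s1 at e1; unfold s2 at e2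
  split_ifs at * <;> omega

theorem marker (hρ : 10 ≤ ρ) {m : ℕ} (hm : m = 4 ∨ m = ρ + 4) {u v : Vx}
    (h : Path ρ u (Mm m) v) : u = A m 2 := by
  unfold Mm at h
  simp only [path_append] at h
  obtain ⟨x1, ⟨x2, ⟨x3, ⟨x4, h1, h2⟩, h3⟩, h4⟩, h5⟩ := h
  obtain ⟨p, hp, -⟩ := h3
  rw [A1, stp_pos] at hp
  have h1 := stp_pos.1 (path_single.1 h1)
  obtain ⟨m, rfl⟩ : ∃ n, m = n + 1 := ⟨m - 1, by omega⟩
  exact (aba hρ h1 h2 hp (by omega) (by omega)).1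

theorem lang_aaa {w : F2} {m : ℕ} (hm : 4 ≤ m) (h : Lang w (Mm m)) : Lang w (aa 3) := by
  unfold Mm at h
  refine Lang.factor (A := aa 1 ++ bb m) (B := bb (m + 1) ++ aa 1) ?_
  simpa only [List.append_assoc] using h

theorem lang_bbbb {w : F2} {m : ℕ} (hm : 4 ≤ m) (h : Lang w (Mm m)) : Lang w (bb 4) := by
  refine Lang.factor (A := aa 1) (B := bb (m - 4) ++ aa 3 ++ bb (m + 1) ++ aa 1) ?_
  have : bb m = bb 4 ++ bb (m - 4) := by
    rw [bb, bb, bb, List.replicate_append_replicate]; congr 1; omega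
  unfold Mm at h
  rw [this] at h
  simpa only [List.append_assoc] using h

theorem lang_aba {w : F2} {m : ℕ} (h : Lang w (Mm m)) : Lang w (aa 1 ++ bb m ++ aa 1) := by
  refine Lang.factor (A := []) (B := aa 2 ++ bb (m + 1) ++ aa 1) ?_
  unfold Mm at h
  have : aa 3 = aa 1 ++ aa 2 := rfl
  rw [this] at h
  simpa only [List.append_assoc, List.nil_append] using h

theorem Letterwise.ne {φ : MulAut F2} {f : Lt → Lt} (h : Letterwise φ f) : (f A1).1 ≠ (f B1).1 := by
  intro e
  by_cases h2 : (f A1).2 = (f B1).2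
  · have : f A1 = f B1 := Prod.ext e h2
    have := h.inj this
    simp [A1, B1] at this
  · have h3 := h.comm B1
    have : f A1 = f (B1.1, !B1.2) := by
      rw [h3]
      refine Prod.ext e ?_
      revert h2
      cases (f A1).2 <;> cases (f B1).2 <;> simp
    have := h.inj this
    simp [A1, B1] at this

theorem fin_ne {c d : Fin 2} (h : c ≠ d) : (c = 0 ∧ d = 1) ∨ (c = 1 ∧ d = 0) := by
  revert c d; decide

theorem lang_sgn {w : F2} {n : ℕ} {c : Fin 2} {s : Bool} (h : Lang w (List.replicate n (c, s))) :
    Lang w (List.replicate n (c, true)) := by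
  cases s
  · have := h.inv
    rwa [invRev_rep] at this
  · exact h

theorem pat_bad (hρ : 10 ≤ ρ) {w g : F2} {σ : MulAut F2} (hσ : σ ∈ W) (h : Pat w)
    (hw : g * σ w * g⁻¹ ∈ LL ρ) : False := by
  obtain ⟨f, hf⟩ := lw_W hσ
  have key : ∀ x y : Lt, (f x).1 ≠ (f y).1 → ¬ Lang w [x, y, x] := by
    intro x y hxy hl
    obtain ⟨u, v, hp⟩ := lang_path hρ hw ((hl.map σ f hf.word).conj g)
    exact triple hρ hp rfl hxy
  have n1 := key A1 B1 hf.ne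
  have n2 := key B1 A1 hf.ne.symm
  rcases h with h | h | h | h
  · exact n2 (Lang.factor (A := []) (B := [B1]) h)
  · exact n1 (Lang.factor (A := [A1]) (B := []) h)
  · exact n1 (Lang.factor (A := []) (B := [B1, A1]) h)
  · exact n2 (Lang.factor (A := []) (B := [A1, B1]) h)

theorem lw_id (hρ : 10 ≤ ρ) {m : ℕ} (hm : m = 4 ∨ m = ρ + 4) {w g : F2} {σ : MulAut F2}
    (hσ : σ ∈ W) (h : Lang w (Mm m)) (hw : g * σ w * g⁻¹ ∈ LL ρ) : σ = 1 := by
  obtain ⟨f, hf⟩ := lw_W hσ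
  have hm4 : 4 ≤ m := by omega
  have T : ∀ {p}, Lang w p → Lang (g * σ w * g⁻¹) (p.map f) := fun hp => (hp.map σ f hf.word).conj g
  obtain ⟨c, s, ha⟩ : ∃ c s, f A1 = (c, s) := ⟨_, _, rfl⟩
  obtain ⟨d, t, hb⟩ : ∃ c s, f B1 = (c, s) := ⟨_, _, rfl⟩
  have hne := hf.ne
  rw [ha, hb] at hne
  have noBa : ∀ x y, ¬ Path ρ x (aa 1 ++ List.replicate m (1, false) ++ aa 1) y := by
    intro x y hp
    simp only [path_append] at hp
    obtain ⟨x1, ⟨x2, h1, h2⟩, h3⟩ := hp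
    have h1 := stp_pos.1 (path_single.1 h1)
    have h3 := stp_pos.1 (path_single.1 h3)
    have h2 := h2.inv
    rw [invRev_rep] at h2
    obtain ⟨n, rfl⟩ : ∃ n, m = n + 1 := ⟨m - 1, by omega⟩
    exact aBa hρ h1 h2 h3
  rcases fin_ne hne with ⟨e1, e2⟩ | ⟨e1, e2⟩ <;> simp only at e1 e2 <;> subst e1 e2
  · cases s <;> cases t
    · have := (T h).inv
      simp only [Mm, List.map_append, List.map_replicate, ha, hb, invRev_append, invRev_rep] at this
      obtain ⟨x, y, hp⟩ := lang_path hρ hw this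
      exact (rev_marker hρ hm (by simp only [List.append_assoc] at hp ⊢; exact hp)).elim
    · have := (T (lang_aba h)).inv
      simp only [List.map_append, List.map_replicate, ha, hb, invRev_append, invRev_rep] at this
      obtain ⟨x, y, hp⟩ := lang_path hρ hw this
      exact (noBa x y (by simp only [List.append_assoc] at hp ⊢; exact hp)).elim
    · have := T (lang_aba h)
      simp only [List.map_append, List.map_replicate, ha, hb] at this
      obtain ⟨x, y, hp⟩ := lang_path hρ hw this
      exact (noBa x y (by simp only [List.append_assoc] at hp ⊢; exact hp)).elim
    · apply aut_ext
      · apply toWord_injective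
        rw [hf.word, toWord_of]
        exact congrArg (fun z => [z]) ha
      · apply toWord_injective
        rw [hf.word, toWord_of]
        exact congrArg (fun z => [z]) hb
  · exfalso
    have := T (lang_bbbb hm4 h)
    rw [List.map_replicate, hb] at this
    obtain ⟨x, y, hp⟩ := lang_path hρ hw (lang_sgn this)
    exact four hρ hp

theorem main (hρ : 10 ≤ ρ) : Malcharacteristic (LL ρ) := by
  rintro δ ⟨w, hw, hw1, hδ⟩
  obtain ⟨g, σ, hσ, φ, hφ, τ, hτ, rfl⟩ := NN_SS (NN_top δ)
  obtain ⟨m, hm, hl⟩ : ∃ m, (m = 4 ∨ m = ρ + 4) ∧ Lang w (Mm m) := by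
    obtain ⟨k, rfl⟩ : ∃ k, ρ = k + 5 := ⟨ρ - 5, by omega⟩
    exact exists_lang k w (by rw [range_G]; exact hw) hw1
  have hm4 : 4 ≤ m := by omega
  have hφ1 : φ = 1 := by
    rcases pos_start hφ with h | h
    · exact h
    · exfalso
      obtain ⟨f, hf⟩ := lw_W hτ
      have ha := (lang_aaa hm4 hl).map τ f hf.word
      have hb := (Lang.factor (A := []) (B := [B1]) (p := bb 3) (lang_bbbb hm4 hl)).map τ f hf.word
      rw [List.map_replicate] at ha hb
      have ha := lang_sgn (c := (f A1).1) (s := (f A1).2) ha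
      have hb := lang_sgn (c := (f B1).1) (s := (f B1).2) hb
      have hP : Pat (φ (τ w)) := by
        rcases fin_ne hf.ne with ⟨e1, e2⟩ | ⟨e1, e2⟩ <;> rw [e1] at ha <;> rw [e2] at hb
        · exact h _ ha hb
        · exact h _ hb ha
      exact pat_bad hρ hσ hP hδ
  subst hφ1
  have hs : σ * τ = 1 := lw_id hρ hm (mul_mem hσ hτ) hl (g := g) hδ
  have hd : MulAut.conj g * σ * 1 * τ = MulAut.conj g := by
    rw [mul_one, mul_assoc, hs, mul_one]
  rw [hd] at hδ ⊢
  have hg : g ∈ LL ρ := by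
    obtain ⟨n, U, V, hU, hV, e⟩ := hl (g.norm + 1)
    obtain ⟨U', V', e', hmk, -, -⟩ := conj_stable g _ e (by omega) (by omega)
    have p1 := LL_path hρ (zpow_mem hw n)
    have p2 : Path ρ (oo ρ) (g * w ^ n * g⁻¹).toWord (oo ρ) := by
      apply LL_path hρ
      have := zpow_mem hδ n
      rw [← map_zpow] at this
      exact this
    rw [e] at p1
    rw [e'] at p2
    simp only [path_append] at p1 p2
    obtain ⟨_, ⟨x, p1, p1'⟩, -⟩ := p1
    obtain ⟨_, ⟨x', p2, p2'⟩, -⟩ := p2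
    obtain rfl := marker hρ hm p1'
    obtain rfl := marker hρ hm p2'
    obtain ⟨l, hl, q1⟩ := path_base hρ p1
    obtain ⟨l', hl', q2⟩ := path_base hρ p2
    rw [hmk, q1, ← mul_assoc] at q2
    have q3 := mul_right_cancel q2
    have : g = l' * l⁻¹ := by rw [← q3]; group
    rw [this]
    exact mul_mem hl' (inv_mem hl)
  exact ⟨g⁻¹, inv_mem hg, fun h => by simp⟩

end MC

theorem lem_malchar_free :
    ∃ ρ₀ : ℕ, ∀ ρ : ℕ, ρ₀ ≤ ρ →
      ¬ IsCyclic ↥(Subgroup.closure {omegaX ρ, omegaY ρ}) ∧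
      Malcharacteristic (Subgroup.closure {omegaX ρ, omegaY ρ}) := by
  refine ⟨10, fun ρ hρ => ⟨?_, MC.main hρ⟩⟩
  obtain ⟨k, rfl⟩ : ∃ k, ρ = k + 5 := ⟨ρ - 5, by omega⟩
  exact MC.noncyc k
end

section
/- For every n ∈ ℕ⁺ ∪ {ℵ₀}, the free group F(a,b) of rank two contains a malcharacteristic subgroup which is a free group of rank n. -/
namespace MalChar
open FreeGroup

abbrev F := FreeGroup (Fin 2)

/-- length of the longest common initial piece -/
def lcp {A : Type} [DecidableEq A] : List A → List A → ℕ
  | x :: xs, y :: ys => if x = y then lcp xs ys + 1 else 0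
  | _, _ => 0

section
variable {A : Type} [DecidableEq A]

theorem lcp_nil_left (l : List A) : lcp [] l = 0 := by simp [lcp]
theorem lcp_nil_right (l : List A) : lcp l [] = 0 := by cases l <;> simp [lcp]
theorem lcp_cons (x y : A) (xs ys : List A) :
    lcp (x :: xs) (y :: ys) = if x = y then lcp xs ys + 1 else 0 := by simp [lcp]

theorem lcp_comm (l m : List A) : lcp l m = lcp m l := by
  induction l generalizing m with
  | nil => simp [lcp_nil_left, lcp_nil_right]
  | cons x xs ih =>
    cases m with
    | nil => simp [lcp_nil_left, lcp_nil_right]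
    | cons y ys => simp only [lcp_cons, ih ys, eq_comm]

theorem lcp_le_left (l m : List A) : lcp l m ≤ l.length := by
  induction l generalizing m with
  | nil => simp [lcp_nil_left]
  | cons x xs ih =>
    cases m with
    | nil => simp [lcp_nil_right]
    | cons y ys =>
      simp only [lcp_cons]; have := ih ys
      split_ifs <;> simp [this]

theorem lcp_self (l : List A) : lcp l l = l.length := by
  induction l with
  | nil => simp [lcp_nil_left]
  | cons x xs ih => simp [lcp_cons, ih]

theorem lcp_ultra (l m n : List A) : min (lcp l m) (lcp m n) ≤ lcp l n := by
  induction l generalizing m n with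
  | nil => simp [lcp_nil_left]
  | cons x xs ih =>
    cases m with
    | nil => simp [lcp_nil_right]
    | cons y ys =>
      cases n with
      | nil => simp [lcp_nil_right]
      | cons z zs =>
        simp only [lcp_cons]; have := ih ys zs
        split_ifs <;> simp_all

theorem take_eq_of_le_lcp (l m : List A) (n : ℕ) (h : n ≤ lcp l m) : l.take n = m.take n := by
  induction l generalizing m n with
  | nil => simp [lcp_nil_left] at h; simp [h]
  | cons x xs ih =>
    cases m with
    | nil => simp [lcp_nil_right] at h; simp [h]
    | cons y ys =>
      cases n with
      | zero => simp
      | succ n =>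
        simp only [lcp_cons] at h
        split_ifs at h with hxy
        · simp [hxy, ih ys n (by omega)]
        · omega
end

theorem isReduced_invRev {α : Type} [DecidableEq α] {L : List (α × Bool)} (h : IsReduced L) :
    IsReduced (invRev L) := by
  rw [isReduced_iff_reduce_eq] at *
  rw [reduce_invRev, h]

theorem reduce_len {α : Type} [DecidableEq α] (l m : List (α × Bool)) (hl : IsReduced l)
    (hm : IsReduced m) :
    (reduce (invRev l ++ m)).length + 2 * lcp l m = l.length + m.length := by
  induction l generalizing m with
  | nil => simp [lcp_nil_left, hm.reduce_eq]
  | cons x xs ih =>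
    cases m with
    | nil => simp [lcp_nil_right, (isReduced_invRev hl).reduce_eq]
    | cons y ys =>
      simp only [lcp_cons]
      split_ifs with h
      · subst h
        have h1 : reduce (invRev (x :: xs) ++ x :: ys) = reduce (invRev xs ++ ys) := by
          apply reduce.sound
          rw [← mul_mk, ← mul_mk, ← inv_mk, ← inv_mk]
          have e : ∀ zs, mk (x :: zs) = mk [x] * mk zs := by intro zs; rw [mul_mk]; rfl
          rw [e xs, e ys]; group
        rw [h1]
        have := ih ys (List.IsChain.tail hl) (List.IsChain.tail hm)
        simp; omega
      · have h1 : IsReduced (invRev (x :: xs) ++ y :: ys) := by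
          have h2 := isReduced_invRev hl
          unfold FreeGroup.IsReduced at *
          rw [List.isChain_append]
          refine ⟨h2, hm, ?_⟩
          intro a ha b hb
          simp [invRev] at ha hb
          subst ha hb
          intro h3
          by_contra h4
          apply h
          ext
          · simpa using h3
          · simp at h4 ⊢; simp at h3; revert h4; cases x.2 <;> cases y.2 <;> simp
        rw [h1.reduce_eq]
        simp

/-- Gromov product -/
def gp (x y : F) : ℕ := lcp x.toWord y.toWord

theorem gp_comm (x y : F) : gp x y = gp y x := lcp_comm _ _
theorem gp_le_left (x y : F) : gp x y ≤ x.norm := lcp_le_left _ _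
theorem gp_le_right (x y : F) : gp x y ≤ y.norm := by rw [gp_comm]; exact gp_le_left _ _
theorem gp_self (x : F) : gp x x = x.norm := lcp_self _
theorem gp_ultra (x y z : F) : min (gp x y) (gp y z) ≤ gp x z := lcp_ultra _ _ _
theorem norm_inv_mul' (x y : F) : (x⁻¹ * y).norm + 2 * gp x y = x.norm + y.norm := by
  have := reduce_len x.toWord y.toWord isReduced_toWord isReduced_toWord
  unfold FreeGroup.norm gp
  rw [toWord_mul, toWord_inv]
  exact this
theorem norm_mul' (x y : F) : (x * y).norm + 2 * gp x⁻¹ y = x.norm + y.norm := by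
  have := norm_inv_mul' x⁻¹ y
  simpa using this

theorem norm_sq_lt (y : F) (hy : y ≠ 1) : y.norm < (y * y).norm := by
  have h := reduceCyclically.reduce_flatten_replicate_succ (isReduced_toWord (x := y)) 1
  have h2 := reduceCyclically.conj_conjugator_reduceCyclically y.toWord
  have h3 : reduceCyclically y.toWord ≠ [] := by
    intro h4
    rw [h4] at h2
    apply hy
    rw [← mk_toWord (x := y), ← h2, ← mul_mk, ← inv_mk, List.append_nil, mul_inv_cancel]
  have h5 : (y * y).toWord = reduce (List.replicate 2 y.toWord).flatten := by
    rw [toWord_mul]; simp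
  have h6 := congrArg List.length h2
  have h7 : 0 < (reduceCyclically y.toWord).length := List.length_pos_iff.2 h3
  unfold FreeGroup.norm
  rw [h5, h]
  simp at h6 ⊢
  omega

theorem gp_inv_self (y : F) (hy : y ≠ 1) : 2 * gp y⁻¹ y < y.norm := by
  have := norm_mul' y y
  have := norm_sq_lt y hy
  omega

/-- The initial piece of length n. -/
def pre (x : F) (n : ℕ) : F := mk (x.toWord.take n)

theorem pre_eq (x y : F) (n : ℕ) (h : n ≤ gp x y) : pre x n = pre y n := by
  unfold pre; rw [take_eq_of_le_lcp _ _ n h]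

theorem pre_mul_inv_pre (x : F) (n m : ℕ) (h : n + m = x.norm) : x = pre x n * (pre x⁻¹ m)⁻¹ := by
  unfold pre
  rw [inv_mk, mul_mk]
  conv_lhs => rw [← mk_toWord (x := x)]
  congr 1
  conv_lhs => rw [← List.take_append_drop n x.toWord]
  congr 1
  rw [toWord_inv]
  unfold FreeGroup.norm at h
  simp only [invRev, List.map_reverse, List.map_take, List.reverse_take]
  simp [← h, Function.comp_def]

theorem norm_mid (x : F) (n m : ℕ) (h : n + m ≤ x.norm) :
    ((pre x n)⁻¹ * x * pre x⁻¹ m).norm ≤ x.norm - n - m := by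
  have h0 : x = mk (x.toWord.take n) * mk ((x.toWord.drop n).take (x.norm - n - m)) *
      (pre x⁻¹ m)⁻¹ := by
    have := pre_mul_inv_pre x (x.norm - m) m (by omega)
    conv_lhs => rw [this]
    congr 1
    unfold pre
    rw [mul_mk]
    congr 1
    rw [show x.norm - m = n + (x.norm - n - m) by omega, List.take_add]
  have h1 : (pre x n)⁻¹ * x * pre x⁻¹ m = mk ((x.toWord.drop n).take (x.norm - n - m)) := by
    conv_lhs => enter [1, 2]; rw [h0]
    unfold pre; group
  rw [h1]
  refine norm_mk_le.trans ?_
  simp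

theorem norm_pre_le (x : F) (n : ℕ) : (pre x n).norm ≤ n := by
  refine norm_mk_le.trans ?_
  simp


/-! ### Nielsen reduction in rank two -/

def sg (s : Bool) (x : F) : F := cond s x x⁻¹

def fl (u v : F) (l : Fin 2 × Bool) : F := sg l.2 (![u, v] l.1)

theorem sg_not (s : Bool) (x : F) : sg (!s) x = (sg s x)⁻¹ := by cases s <;> simp [sg]

theorem fl_not (u v : F) (l : Fin 2 × Bool) : fl u v (l.1, !l.2) = (fl u v l)⁻¹ := by
  simp [fl, sg_not]

def Irr (u v : F) : Prop := ∀ l k : Fin 2 × Bool, l.1 ≠ k.1 → ∀ g : F,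
  (fl u v l).norm + (fl u v k).norm ≤
    (g⁻¹ * (fl u v l * fl u v k) * g).norm + (g⁻¹ * fl u v k * g).norm

section irr
variable {u v : F}

theorem fl_ne_one (hu : u ≠ 1) (hv : v ≠ 1) (l : Fin 2 × Bool) : fl u v l ≠ 1 := by
  obtain ⟨i, s⟩ := l
  fin_cases i <;> cases s <;> simp [fl, sg, hu, hv]

theorem irr_A (h : Irr u v) (l k : Fin 2 × Bool) (hlk : l.1 ≠ k.1) :
    2 * gp (fl u v l)⁻¹ (fl u v k) ≤ (fl u v k).norm ∧
    2 * gp (fl u v l)⁻¹ (fl u v k) ≤ (fl u v l).norm := by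
  have h1 := h l k hlk 1
  have h2 := h (k.1, !k.2) (l.1, !l.2) hlk.symm 1
  have h3 := norm_mul' (fl u v l) (fl u v k)
  rw [fl_not, fl_not, ← mul_inv_rev] at h2
  simp only [norm_inv_eq, inv_one, one_mul, mul_one] at h1 h2
  omega

theorem irr_B (hu : u ≠ 1) (hv : v ≠ 1) (h : Irr u v) (l k : Fin 2 × Bool)
    (hlk : l.1 = k.1 → l.2 = k.2) :
    2 * gp (fl u v l)⁻¹ (fl u v k) ≤ (fl u v k).norm ∧
    2 * gp (fl u v l)⁻¹ (fl u v k) ≤ (fl u v l).norm := by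
  by_cases e : l.1 = k.1
  · obtain rfl : l = k := Prod.ext e (hlk e)
    have := gp_inv_self _ (fl_ne_one hu hv l)
    omega
  · exact irr_A h l k e

theorem irr_C (hu : u ≠ 1) (hv : v ≠ 1) (h : Irr u v) (l k m : Fin 2 × Bool)
    (hlk : l.1 = k.1 → l.2 = k.2) (hkm : k.1 = m.1 → k.2 = m.2) :
    gp (fl u v l)⁻¹ (fl u v k) + gp (fl u v k)⁻¹ (fl u v m) < (fl u v k).norm := by
  by_contra hcon
  have b1 := (irr_B hu hv h l k hlk).1
  have b2 := (irr_B hu hv h k m hkm).2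
  have b3 := gp_inv_self _ (fl_ne_one hu hv k)
  have lk : l.1 ≠ k.1 := by
    intro e
    obtain rfl : l = k := Prod.ext e (hlk e)
    omega
  have km : k.1 ≠ m.1 := by
    intro e
    obtain rfl : k = m := Prod.ext e (hkm e)
    omega
  have lm : l.1 = m.1 := by omega
  have b4 := (irr_A h l k lk).2
  have hne := fl_ne_one hu hv k
  set n := gp (fl u v l)⁻¹ (fl u v k) with hn
  have hn2 : gp (fl u v k)⁻¹ (fl u v m) = n := by omega
  have hny : n + n = (fl u v k).norm := by omega
  have p1 := pre_eq _ _ n hn.le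
  have p2 := pre_eq _ _ n hn2.ge
  have p3 := pre_mul_inv_pre (fl u v k) n n hny
  by_cases e : l.2 = m.2
  · obtain rfl : l = m := Prod.ext lm e
    have h1 := norm_mid (fl u v l) n n (by omega)
    have h2 := h l k lk (pre (fl u v l) n)
    rw [← p1, p2] at p3
    have e1 : (pre (fl u v l) n)⁻¹ * (fl u v l * fl u v k) * pre (fl u v l) n
        = (pre (fl u v l) n)⁻¹ * fl u v l * pre (fl u v l)⁻¹ n := by
      conv_lhs => rw [p3]
      group
    have e2 : (pre (fl u v l) n)⁻¹ * fl u v k * pre (fl u v l) n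
        = (pre (fl u v l) n)⁻¹ * pre (fl u v l)⁻¹ n := by
      conv_lhs => rw [p3]
      group
    rw [e1, e2] at h2
    have h3 := norm_mul_le (pre (fl u v l) n)⁻¹ (pre (fl u v l)⁻¹ n)
    rw [norm_inv_eq] at h3
    have h4 := norm_pre_le (fl u v l) n
    have h5 := norm_pre_le (fl u v l)⁻¹ n
    have h6 : (fl u v k).norm ≠ 0 := fun h => hne (norm_eq_zero.1 h)
    omega
  · have e1 : fl u v m = (fl u v l)⁻¹ := by
      rw [← fl_not]
      congr 1
      ext
      · simp [lm]
      · simp; revert e; cases l.2 <;> cases m.2 <;> simp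
    rw [p2, e1, p1, mul_inv_cancel] at p3
    exact hne p3

theorem irr_main (hu : u ≠ 1) (hv : v ≠ 1) (h : Irr u v) (t : List (Fin 2 × Bool)) :
    ∀ l, FreeGroup.IsReduced (l :: t) →
    (∀ k : Fin 2 × Bool, (k.1 = l.1 → k.2 = l.2) → gp (fl u v k)⁻¹ (fl u v l) <
      gp ((l :: t).map (fl u v)).prod (fl u v l)) ∧
    t.length + gp ((l :: t).map (fl u v)).prod (fl u v l) ≤ ((l :: t).map (fl u v)).prod.norm := by
  induction t with
  | nil =>
    intro l _
    simp only [List.map_cons, List.map_nil, List.prod_cons, List.prod_nil, mul_one, gp_self]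
    refine ⟨fun k hk => ?_, by simp⟩
    have := (irr_B hu hv h k l hk).1
    have : (fl u v l).norm ≠ 0 := fun h => fl_ne_one hu hv l (norm_eq_zero.1 h)
    omega
  | cons m t ih =>
    intro l hl
    rw [isReduced_cons_cons] at hl
    obtain ⟨i1, i2⟩ := ih m hl.2
    rw [List.map_cons, List.prod_cons]
    set g := ((m :: t).map (fl u v)).prod
    have c1 := i1 l hl.1
    set c := gp (fl u v l)⁻¹ (fl u v m) with hc
    have c2 := gp_ultra (fl u v l)⁻¹ (fl u v m) g
    have c3 := gp_ultra (fl u v l)⁻¹ g (fl u v m)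
    rw [gp_comm (fl u v m) g] at c2
    have n1 := norm_mul' (fl u v l) g
    have n2 := norm_inv_mul' (fl u v l * g) (fl u v l)
    have e : ((fl u v l * g)⁻¹ * fl u v l) = g⁻¹ := by group
    rw [e, norm_inv_eq] at n2
    have c4 : gp (fl u v l)⁻¹ g = c := by omega
    refine ⟨fun k hk => ?_, ?_⟩
    · have := irr_C hu hv h k l m hk hl.1
      omega
    · simp only [List.length_cons]
      have := gp_le_left (fl u v l)⁻¹ (fl u v m)
      rw [norm_inv_eq] at this
      omega

theorem lift_mk_fl (L : List (Fin 2 × Bool)) :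
    FreeGroup.lift ![u, v] (mk L) = (L.map (fl u v)).prod := by
  rw [FreeGroup.lift_mk]; rfl

theorem irr_norm (hu : u ≠ 1) (hv : v ≠ 1) (h : Irr u v) (x : F) :
    x.norm ≤ (FreeGroup.lift ![u, v] x).norm := by
  rw [← mk_toWord (x := x), lift_mk_fl, mk_toWord]
  unfold FreeGroup.norm
  have hr : FreeGroup.IsReduced x.toWord := isReduced_toWord
  cases hx : x.toWord with
  | nil => simp
  | cons l t =>
    rw [hx] at hr
    have h1 := irr_main hu hv h t l hr
    have h2 := h1.1 l (fun _ => rfl)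
    have h3 := h1.2
    unfold FreeGroup.norm at h3
    simp only [List.length_cons]
    omega

theorem irr_letter (hu : u ≠ 1) (hv : v ≠ 1) (h : Irr u v) (i : Fin 2)
    (hi : of i ∈ (FreeGroup.lift ![u, v] : F →* F).range) : ∃ l, of i = fl u v l := by
  obtain ⟨x, hx⟩ := hi
  have h1 := irr_norm hu hv h x
  rw [hx, norm_of] at h1
  rw [← mk_toWord (x := x), lift_mk_fl] at hx
  unfold FreeGroup.norm at h1
  match hw : x.toWord, h1 with
  | [], _ => rw [hw] at hx; simp at hx
  | [l], _ => rw [hw] at hx; exact ⟨l, by simpa using hx.symm⟩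
  | _ :: _ :: _, h1 => simp at h1
end irr

abbrev ga : F := of 0
abbrev gb : F := of 1

inductive P : F → F → Prop
  | base (s t : Bool) : P (sg s ga) (sg t gb)
  | swap {u v : F} : P u v → P v u
  | step {u v : F} : P u v → P (u * v) v

def Good (u v : F) : Prop :=
  ∃ g u' v' s t, P u' v' ∧ u = g * sg s u' * g⁻¹ ∧ v = g * sg t v' * g⁻¹

theorem Good.swap {u v : F} : Good u v → Good v u := by
  rintro ⟨g, u', v', s, t, h, h1, h2⟩
  exact ⟨g, v', u', t, s, h.swap, h2, h1⟩

theorem Good.conj {u v : F} (k : F) : Good u v → Good (k * u * k⁻¹) (k * v * k⁻¹) := by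
  rintro ⟨g, u', v', s, t, h, rfl, rfl⟩
  exact ⟨k * g, u', v', s, t, h, by group, by group⟩

theorem Good.inv_left {u v : F} : Good u v → Good u⁻¹ v := by
  rintro ⟨g, u', v', s, t, h, rfl, rfl⟩
  exact ⟨g, u', v', !s, t, h, by rw [sg_not]; group, rfl⟩

theorem Good.inv_right {u v : F} (h : Good u v) : Good u v⁻¹ := h.swap.inv_left.swap

theorem Good.sg {u v : F} (h : Good u v) (s t : Bool) : Good (sg s u) (sg t v) := by
  cases s <;> cases t <;> simp only [MalChar.sg, cond_true, cond_false]
  · exact h.inv_left.inv_right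
  · exact h.inv_left
  · exact h.inv_right
  · exact h

theorem P.good {u v : F} (h : P u v) : Good u v := ⟨1, u, v, true, true, h, by simp [sg], by simp [sg]⟩

theorem P.div {u v : F} (h : P u v) : Good (u * v⁻¹) v ∧ Good u (v * u⁻¹) := by
  induction h with
  | base s t =>
    constructor
    · have := (P.base s (!t)).step.good.inv_right
      simpa [sg_not] using this
    · have := (P.base (!s) t).swap.step.swap.good.inv_left
      simpa [sg_not] using this
  | swap h ih => exact ⟨ih.2.swap, ih.1.swap⟩
  | @step u v h ih =>
    constructor
    · simpa using h.good
    · have := (h.swap.step.good.inv_right.conj u)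
      convert this using 1 <;> group

theorem Good.mul {u v : F} : Good u v → Good (u * v) v := by
  rintro ⟨g, u', v', s, t, h, rfl, rfl⟩
  suffices Good (MalChar.sg s u' * MalChar.sg t v') (MalChar.sg t v') by
    convert this.conj g using 1
    group
  cases s <;> cases t <;> simp only [MalChar.sg, cond_true, cond_false]
  · have := (h.step.good.inv_left.inv_right).conj v'
    convert this using 1 <;> group
  · have := (h.div.1.inv_left).conj v'⁻¹
    convert this using 1 <;> group
  · exact h.div.1.inv_right
  · exact h.step.good

theorem Good.of_mul {u v : F} (h : Good (u * v) v) : Good u v := by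
  have := h.inv_right.mul.inv_right
  simpa using this

def Gen (u v : F) : Prop := ∀ H : Subgroup F, u ∈ H → v ∈ H → H = ⊤

theorem Gen.swap {u v : F} (h : Gen u v) : Gen v u := fun H h1 h2 => h H h2 h1

theorem ab_ne : ga * gb ≠ gb * ga := by decide

theorem Gen.ne_one {u v : F} (h : Gen u v) : u ≠ 1 := by
  rintro rfl
  have h1 := h (Subgroup.zpowers v) (one_mem _) (Subgroup.mem_zpowers v)
  have h2 : ga ∈ Subgroup.zpowers v := by rw [h1]; trivial
  have h3 : gb ∈ Subgroup.zpowers v := by rw [h1]; trivial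
  obtain ⟨i, hi⟩ := h2
  obtain ⟨j, hj⟩ := h3
  apply ab_ne
  rw [← hi, ← hj]
  exact ((Commute.refl v).zpow_zpow i j).eq

theorem Gen.move {u v x y g : F} (h : Gen u v) (hu : ∀ H : Subgroup F, x ∈ H → y ∈ H → u ∈ H ∧ v ∈ H) :
    Gen (g⁻¹ * (x * y) * g) (g⁻¹ * y * g) := by
  intro H h1 h2
  let φ : F →* F := (MulAut.conj g⁻¹).toMonoidHom
  have e : ∀ z, φ z = g⁻¹ * z * g := by intro z; simp [φ]
  have h3 : x * y ∈ H.comap φ := by rw [Subgroup.mem_comap, e]; exact h1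
  have h4 : y ∈ H.comap φ := by rw [Subgroup.mem_comap, e]; exact h2
  have h5 : x ∈ H.comap φ := (Subgroup.mul_mem_cancel_right _ h4).1 h3
  have h6 := h _ (hu _ h5 h4).1 (hu _ h5 h4).2
  rw [eq_top_iff]
  intro z _
  have : g * z * g⁻¹ ∈ H.comap φ := by rw [h6]; trivial
  rw [Subgroup.mem_comap, e] at this
  convert this using 1
  group

theorem sg_mem (H : Subgroup F) (s : Bool) (x : F) : sg s x ∈ H ↔ x ∈ H := by
  cases s <;> simp [sg]
theorem sg_sg (s : Bool) (x : F) : sg s (sg s x) = x := by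
  cases s <;> simp [sg]
theorem norm_sg (s : Bool) (x : F) : (sg s x).norm = x.norm := by
  cases s <;> simp [sg, norm_inv_eq]

theorem nielsen (n : ℕ) : ∀ u v : F, u.norm + v.norm < n → Gen u v → Good u v := by
  induction n with
  | zero => intro u v h; omega
  | succ n ih =>
    intro u v hn hg
    by_contra hbad
    have hirr : Irr u v := by
      intro l k hlk g
      by_contra hlt
      push Not at hlt
      apply hbad
      obtain ⟨i, s⟩ := l
      obtain ⟨j, t⟩ := k
      simp only at hlk
      have hgood := ih (g⁻¹ * (fl u v (i, s) * fl u v (j, t)) * g) (g⁻¹ * fl u v (j, t) * g) (by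
        fin_cases i <;> fin_cases j <;> simp [fl, norm_sg] at hlk hlt hn ⊢ <;> omega)
        (hg.move (by
          intro H h1 h2
          fin_cases i <;> fin_cases j <;> simp [fl, sg_mem] at hlk h1 h2 ⊢ <;> simp [h1, h2]))
      have h2 := hgood.conj g
      have h3 : Good (fl u v (i, s) * fl u v (j, t)) (fl u v (j, t)) := by
        convert h2 using 1 <;> group
      have h4 := h3.of_mul.sg s t
      fin_cases i <;> fin_cases j <;> simp [fl, sg_sg] at hlk h4
      · exact h4
      · exact h4.swap
    have hr := hg (FreeGroup.lift ![u, v] : F →* F).range ⟨of 0, by simp⟩ ⟨of 1, by simp⟩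
    obtain ⟨⟨i, s⟩, hl⟩ := irr_letter hg.ne_one hg.swap.ne_one hirr 0 (by rw [hr]; trivial)
    obtain ⟨⟨j, t⟩, hk⟩ := irr_letter hg.ne_one hg.swap.ne_one hirr 1 (by rw [hr]; trivial)
    have hij : i ≠ j := by
      rintro rfl
      have h1 : sg s (of 0 : F) = sg t (of 1) := by rw [hl, hk]; simp [fl, sg_sg]
      revert h1; cases s <;> cases t <;> decide
    apply hbad
    have hl' := congrArg (sg s) hl
    have hk' := congrArg (sg t) hk
    fin_cases i <;> fin_cases j <;> simp [fl, sg_sg] at hij hl' hk'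
    · rw [← hl', ← hk']; exact (P.base s t).good
    · rw [← hl', ← hk']; exact (P.base s t).swap.good


/-! ### Abelianization and consequences of the Nielsen theorem -/

def abm : F →* Multiplicative (ℤ × ℤ) :=
  FreeGroup.lift ![Multiplicative.ofAdd (1, 0), Multiplicative.ofAdd (0, 1)]

def abv (x : F) : ℤ × ℤ := Multiplicative.toAdd (abm x)

theorem abv_mul (x y : F) : abv (x * y) = abv x + abv y := by simp [abv]
theorem abv_one : abv 1 = 0 := by simp [abv]
theorem abv_inv (x : F) : abv x⁻¹ = - abv x := by simp [abv]
theorem abv_zpow (x : F) (n : ℤ) : abv (x ^ n) = n • abv x := by simp [abv]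
theorem abv_ga : abv ga = (1, 0) := by simp [abv, abm]
theorem abv_gb : abv gb = (0, 1) := by simp [abv, abm]
theorem abv_conj (x g : F) : abv (g * x * g⁻¹) = abv x := by simp [abv_mul, abv_inv]

def com (u v : F) : F := v * u * v⁻¹ * u⁻¹

def CC (u v : F) : Prop := ∃ k s, com u v = k * sg s (com ga gb) * k⁻¹

theorem CC.swap {u v : F} : CC u v → CC v u := by
  rintro ⟨k, s, h⟩
  refine ⟨k, !s, ?_⟩
  have : com v u = (com u v)⁻¹ := by unfold com; group
  rw [this, h, sg_not]; group

theorem CC.conj {u v : F} (g : F) : CC u v → CC (g * u * g⁻¹) (g * v * g⁻¹) := by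
  rintro ⟨k, s, h⟩
  refine ⟨g * k, s, ?_⟩
  have : com (g * u * g⁻¹) (g * v * g⁻¹) = g * com u v * g⁻¹ := by unfold com; group
  rw [this, h]; group

theorem CC.inv_left {u v : F} : CC u v → CC u⁻¹ v := by
  rintro ⟨k, s, h⟩
  refine ⟨u⁻¹ * k, !s, ?_⟩
  have : com u⁻¹ v = u⁻¹ * (com u v)⁻¹ * u := by unfold com; group
  rw [this, h, sg_not]; group

theorem CC.inv_right {u v : F} (h : CC u v) : CC u v⁻¹ := h.swap.inv_left.swap

theorem CC.sg {u v : F} (h : CC u v) (s t : Bool) : CC (sg s u) (sg t v) := by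
  cases s <;> cases t <;> simp only [MalChar.sg, cond_true, cond_false]
  · exact h.inv_left.inv_right
  · exact h.inv_left
  · exact h.inv_right
  · exact h

theorem P.cc {u v : F} (h : P u v) : CC u v := by
  induction h with
  | base s t => exact CC.sg ⟨1, true, by simp [MalChar.sg]⟩ s t
  | swap h ih => exact ih.swap
  | @step u v h ih =>
    obtain ⟨k, s, ih⟩ := ih
    refine ⟨k, s, ?_⟩
    rw [← ih]; unfold com; group

theorem Good.cc {u v : F} : Good u v → CC u v := by
  rintro ⟨g, u', v', s, t, h, rfl, rfl⟩
  exact (h.cc.sg s t).conj g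

theorem abv_sg_ga (s : Bool) : abv (sg s ga) = (cond s 1 (-1), 0) := by
  cases s <;> simp [sg, abv_inv, abv_ga]
theorem abv_sg_gb (s : Bool) : abv (sg s gb) = (0, cond s 1 (-1)) := by
  cases s <;> simp [sg, abv_inv, abv_gb]
theorem abv_sg (s : Bool) (x : F) : abv (sg s x) = (cond s 1 (-1) : ℤ) • abv x := by
  cases s <;> simp [sg, abv_inv]

theorem P.ab {u v : F} (h : P u v) : ∃ (e f : Bool) (p q r w : ℕ),
    abv u = ((cond e 1 (-1) : ℤ) * p, (cond f 1 (-1) : ℤ) * q) ∧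
    abv v = ((cond e 1 (-1) : ℤ) * r, (cond f 1 (-1) : ℤ) * w) ∧
    1 ≤ p + q ∧ 1 ≤ r + w ∧ (3 ≤ p + q + r + w ∨
      ∃ s t, (u = MalChar.sg s ga ∧ v = MalChar.sg t gb) ∨
        (u = MalChar.sg t gb ∧ v = MalChar.sg s ga)) := by
  induction h with
  | base s t =>
    exact ⟨s, t, 1, 0, 0, 1, by simp [abv_sg_ga], by simp [abv_sg_gb], by simp, by simp,
      Or.inr ⟨s, t, Or.inl ⟨rfl, rfl⟩⟩⟩
  | swap h ih =>
    obtain ⟨e, f, p, q, r, w, h1, h2, h3, h4, h5⟩ := ih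
    refine ⟨e, f, r, w, p, q, h2, h1, h4, h3, ?_⟩
    rcases h5 with h5 | ⟨s, t, h5⟩
    · left; omega
    · right; exact ⟨s, t, by tauto⟩
  | step h ih =>
    obtain ⟨e, f, p, q, r, w, h1, h2, h3, h4, h5⟩ := ih
    refine ⟨e, f, p + r, q + w, r, w, ?_, h2, by omega, by omega, Or.inl (by omega)⟩
    rw [abv_mul, h1, h2]
    ext <;> simp <;> ring

theorem Good.inner {u v : F} (h : Good u v) (hu : abv u = (1, 0)) (hv : abv v = (0, 1)) :
    ∃ g, u = g * ga * g⁻¹ ∧ v = g * gb * g⁻¹ := by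
  obtain ⟨g, u', v', s, t, h, rfl, rfl⟩ := h
  refine ⟨g, ?_⟩
  rw [abv_conj] at hu hv
  obtain ⟨e, f, p, q, r, w, h1, h2, h3, h4, h5⟩ := h.ab
  rcases h5 with h5 | ⟨s', t', ⟨rfl, rfl⟩ | ⟨rfl, rfl⟩⟩
  · exfalso
    rw [abv_sg, h1] at hu
    rw [abv_sg, h2] at hv
    simp only [Prod.smul_mk, Prod.mk.injEq, smul_eq_mul] at hu hv
    obtain ⟨hu1, hu2⟩ := hu
    obtain ⟨hv1, hv2⟩ := hv
    cases s <;> cases t <;> cases e <;> cases f <;> simp at hu1 hu2 hv1 hv2 <;> omega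
  · rw [abv_sg, abv_sg_ga] at hu
    rw [abv_sg, abv_sg_gb] at hv
    cases s <;> cases t <;> cases s' <;> cases t' <;> simp at hu hv <;> simp [MalChar.sg]
  · rw [abv_sg, abv_sg_gb] at hu
    simp at hu

theorem hom_mem_of_gens {G : Type} [Group G] (δ : F →* G) (H : Subgroup G) (ha : δ ga ∈ H)
    (hb : δ gb ∈ H) (x : F) : δ x ∈ H := by
  induction x using FreeGroup.induction_on with
  | C1 => simp
  | of i => fin_cases i <;> assumption
  | inv_of i h => rw [_root_.map_inv]; exact H.inv_mem h
  | mul x y hx hy => rw [_root_.map_mul]; exact H.mul_mem hx hy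

theorem aut_good (δ : MulAut F) : Good (δ ga) (δ gb) := by
  refine nielsen _ _ _ (Nat.lt_succ_self _) ?_
  intro H ha hb
  rw [eq_top_iff]
  intro x _
  have := hom_mem_of_gens δ.toMonoidHom H ha hb (δ.symm x)
  simpa using this

theorem aut_com (δ : MulAut F) : ∃ k s, δ (com ga gb) = k * sg s (com ga gb) * k⁻¹ := by
  have := (aut_good δ).cc
  unfold CC at this
  convert this using 4
  simp [com]

theorem aut_inner (δ : MulAut F) (ha : abv (δ ga) = (1, 0)) (hb : abv (δ gb) = (0, 1)) :
    ∃ g, ∀ x, δ x = g * x * g⁻¹ := by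
  obtain ⟨g, h1, h2⟩ := (aut_good δ).inner ha hb
  refine ⟨g, fun x => ?_⟩
  have : δ.toMonoidHom = (MulAut.conj g).toMonoidHom := by
    ext i; fin_cases i
    · simpa using h1
    · simpa using h2
  have := DFunLike.congr_fun this x
  simpa using this

/-! ### The commutator subgroup is free -/

abbrev E := FreeGroup (ℤ × ℤ)

def eF (z : ℤ × ℤ) : F := (ga ^ z.1 * gb ^ z.2) * com ga gb * (ga ^ z.1 * gb ^ z.2)⁻¹

def psi : E →* F := FreeGroup.lift eF

def chi : E →* FreeGroup (Option ℤ) :=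
  FreeGroup.lift fun z => of none ^ z.1 * of (some z.2) * (of none ^ z.1)⁻¹

def sigma (i : ℤ) : MulAut E := FreeGroup.freeGroupCongr (Equiv.prodCongr (Equiv.addLeft i) (Equiv.refl ℤ))

def sigmaHom : Multiplicative ℤ →* MulAut E where
  toFun i := sigma (Multiplicative.toAdd i)
  map_one' := by
    apply MulEquiv.toMonoidHom_injective
    ext z; simp [sigma]
  map_mul' i j := by
    apply MulEquiv.toMonoidHom_injective
    ext ⟨z1, z2⟩; simp [sigma, add_assoc]

theorem conj_inr {N : Type} [Group N] (φ : Multiplicative ℤ →* MulAut N) (n : N) (i : ℤ) :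
    (SemidirectProduct.inr (Multiplicative.ofAdd 1) : N ⋊[φ] Multiplicative ℤ) ^ i *
      SemidirectProduct.inl n *
      ((SemidirectProduct.inr (Multiplicative.ofAdd 1) : N ⋊[φ] Multiplicative ℤ) ^ i)⁻¹ =
      SemidirectProduct.inl (φ (Multiplicative.ofAdd i) n) := by
  rw [SemidirectProduct.inl_aut, ← _root_.map_zpow, ← _root_.map_inv]
  simp [← ofAdd_zsmul]

theorem chi_injective : Function.Injective chi := by
  let θ : FreeGroup (Option ℤ) →* E ⋊[sigmaHom] Multiplicative ℤ :=
    FreeGroup.lift fun o => o.elim (SemidirectProduct.inr (Multiplicative.ofAdd 1))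
      fun j => SemidirectProduct.inl (of (0, j))
  have h : θ.comp chi = SemidirectProduct.inl := by
    ext1 ⟨i, j⟩
    simp only [chi, θ, MonoidHom.comp_apply, FreeGroup.lift_apply_of, _root_.map_mul, _root_.map_inv, _root_.map_zpow,
      Option.elim_none, Option.elim_some]
    rw [conj_inr]
    simp [sigmaHom, sigma]
  have h2 : Function.Injective (θ.comp chi) := by rw [h]; exact SemidirectProduct.inl_injective
  rw [MonoidHom.coe_comp] at h2
  exact h2.of_comp

def betaFwd : FreeGroup (Option ℤ) →* FreeGroup (Option ℤ) :=
  FreeGroup.lift fun o => o.elim (of (some 0) * of none) fun j => of (some (j + 1))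
def betaBwd : FreeGroup (Option ℤ) →* FreeGroup (Option ℤ) :=
  FreeGroup.lift fun o => o.elim ((of (some (-1)))⁻¹ * of none) fun j => of (some (j - 1))

def beta : MulAut (FreeGroup (Option ℤ)) :=
  MonoidHom.toMulEquiv betaFwd betaBwd
    (by ext o; cases o <;> simp [betaFwd, betaBwd])
    (by ext o; cases o <;> simp [betaFwd, betaBwd])

theorem beta_some (j : ℤ) : beta (of (some j)) = of (some (j + 1)) := by
  simp [beta, betaFwd]
theorem beta_none : beta (of none) = of (some 0) * of none := by
  simp [beta, betaFwd]

theorem beta_zpow (j : ℤ) : (beta ^ j) (of (some 0)) = of (some j) := by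
  induction j with
  | zero => simp
  | succ i ih => rw [add_comm, zpow_add, MulAut.mul_apply, ih, zpow_one, beta_some, add_comm]
  | pred i ih =>
    rw [sub_eq_add_neg, add_comm, zpow_add, MulAut.mul_apply, ih, zpow_neg, zpow_one,
      MulAut.inv_apply, MulEquiv.symm_apply_eq, beta_some]
    simp

theorem psi_injective : Function.Injective psi := by
  let θ : F →* FreeGroup (Option ℤ) ⋊[zpowersHom _ beta] Multiplicative ℤ :=
    FreeGroup.lift ![SemidirectProduct.inl (of none), SemidirectProduct.inr (Multiplicative.ofAdd 1)]
  have ha : θ ga = SemidirectProduct.inl (of none) := by simp [θ]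
  have hb : θ gb = SemidirectProduct.inr (Multiplicative.ofAdd 1) := by simp [θ]
  have hc : θ (com ga gb) = SemidirectProduct.inl (of (some 0)) := by
    have := conj_inr (zpowersHom _ beta) (of none) 1
    simp only [zpow_one] at this
    simp only [com, _root_.map_mul, _root_.map_inv, ha, hb]
    rw [this]
    simp [beta_none]
  have h : θ.comp psi = SemidirectProduct.inl.comp chi := by
    ext1 ⟨i, j⟩
    simp only [psi, chi, MonoidHom.comp_apply, FreeGroup.lift_apply_of, eF]
    have := conj_inr (zpowersHom _ beta) (of (some 0)) j
    simp only [_root_.map_mul, _root_.map_inv, _root_.map_zpow, ha, hb, hc]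
    rw [mul_inv_rev, show ∀ x y z w t : FreeGroup (Option ℤ) ⋊[zpowersHom _ beta] Multiplicative ℤ,
      x * y * z * (w * t) = x * (y * z * w) * t by intros; group, this]
    simp [beta_zpow]
  have h2 : Function.Injective (θ.comp psi) := by
    rw [h, MonoidHom.coe_comp]; exact SemidirectProduct.inl_injective.comp chi_injective
  rw [MonoidHom.coe_comp] at h2
  exact h2.of_comp

theorem psi_of (z : ℤ × ℤ) : psi (of z) = eF z := by simp [psi]

theorem q_mem (i j : ℤ) : ga ^ i * (gb ^ j * ga * (gb ^ j)⁻¹ * ga⁻¹) * (ga ^ i)⁻¹ ∈ psi.range := by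
  have key : ∀ j : ℤ, ga ^ i * (gb ^ (j + 1) * ga * (gb ^ (j + 1))⁻¹ * ga⁻¹) * (ga ^ i)⁻¹ =
      psi (of (i, j)) * (ga ^ i * (gb ^ j * ga * (gb ^ j)⁻¹ * ga⁻¹) * (ga ^ i)⁻¹) := by
    intro j
    rw [psi_of]; unfold eF com; simp only; rw [zpow_add_one]; group
  induction j with
  | zero => simp
  | succ j ih => rw [key]; exact mul_mem ⟨_, rfl⟩ ih
  | pred j ih =>
    have := key (-j - 1)
    rw [sub_add_cancel] at this
    rw [this] at ih
    exact (Subgroup.mul_mem_cancel_left _ (show psi (of _) ∈ psi.range from ⟨_, rfl⟩)).1 ih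

theorem nf_exists (g : F) : ∃ w i j, g = psi w * (ga ^ (i : ℤ) * gb ^ (j : ℤ)) := by
  have main : ∀ (x : F) (g : F), (∃ w i j, g = psi w * (ga ^ (i : ℤ) * gb ^ (j : ℤ))) →
      ∃ w i j, g * x = psi w * (ga ^ (i : ℤ) * gb ^ (j : ℤ)) := by
    intro x
    induction x using FreeGroup.induction_on with
    | C1 => intro g h; simpa using h
    | of k =>
      rintro g ⟨w, i, j, rfl⟩
      fin_cases k
      · obtain ⟨w', hw'⟩ := q_mem i j
        refine ⟨w * w', i + 1, j, ?_⟩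
        rw [_root_.map_mul, hw', zpow_add_one]; simp only [Fin.zero_eta]; group
      · exact ⟨w, i, j + 1, by rw [zpow_add_one]; simp only [Fin.mk_one]; group⟩
    | inv_of k _ =>
      rintro g ⟨w, i, j, rfl⟩
      fin_cases k
      · obtain ⟨w', hw'⟩ := q_mem (i - 1) j
        refine ⟨w * w'⁻¹, i - 1, j, ?_⟩
        rw [_root_.map_mul, _root_.map_inv, hw', zpow_sub_one]; simp only [Fin.zero_eta]; group
      · exact ⟨w, i, j - 1, by rw [zpow_sub_one]; simp only [Fin.mk_one]; group⟩
    | mul x y hx hy =>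
      intro g h
      rw [← mul_assoc]
      exact hy _ (hx _ h)
  have := main g 1 ⟨1, 0, 0, by simp⟩
  simpa using this

theorem abv_psi (w : E) : abv (psi w) = 0 := by
  have : abm.comp psi = 1 := by
    ext1 z
    simp [psi, eF, com]
  have := DFunLike.congr_fun this w
  simpa [abv] using this

theorem nf (g : F) : ∃ w, g = psi w * (ga ^ (abv g).1 * gb ^ (abv g).2) := by
  obtain ⟨w, i, j, h⟩ := nf_exists g
  refine ⟨w, ?_⟩
  have : abv g = (i, j) := by
    rw [h]; simp [abv_mul, abv_psi, abv_zpow, abv_ga, abv_gb]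
  rw [this]; exact h

theorem mem_range_of_abv (g : F) (h : abv g = 0) : ∃ w, g = psi w := by
  obtain ⟨w, hw⟩ := nf g
  exact ⟨w, by simpa [h] using hw⟩

theorem conj_com (g : F) : ∃ w, g * com ga gb * g⁻¹ = psi (w * of (abv g) * w⁻¹) := by
  obtain ⟨w, hw⟩ := nf g
  refine ⟨w, ?_⟩
  rw [_root_.map_mul, _root_.map_mul, _root_.map_inv, psi_of]; unfold eF
  conv_lhs => rw [hw]
  group


/-! ### Action of an automorphism on the free basis of the commutator subgroup -/

theorem abv_surj (z : ℤ × ℤ) : abv (ga ^ z.1 * gb ^ z.2) = z := by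
  simp [abv_mul, abv_zpow, abv_ga, abv_gb]

theorem aut_abv_hom (δ : MulAut F) : ∃ L : ℤ × ℤ →+ ℤ × ℤ, ∀ g, abv (δ g) = L (abv g) := by
  refine ⟨{ toFun := fun z => z.1 • abv (δ ga) + z.2 • abv (δ gb), map_zero' := by simp,
            map_add' := by intro x y; simp only [Prod.fst_add, Prod.snd_add, add_smul]; abel },
          fun g => ?_⟩
  show abv (δ g) = (abv g).1 • abv (δ ga) + (abv g).2 • abv (δ gb)
  induction g using FreeGroup.induction_on with
  | C1 => simp [abv_one]
  | of i =>
    fin_cases i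
    · have := abv_ga; simp only [ga] at this; simp [this, ga]
    · have := abv_gb; simp only [gb] at this; simp [this, gb]
  | inv_of i h =>
    rw [_root_.map_inv, abv_inv, h, abv_inv]
    simp only [Prod.fst_neg, Prod.snd_neg, neg_smul]; abel
  | mul x y hx hy =>
    rw [_root_.map_mul, abv_mul, hx, hy, abv_mul]
    simp only [Prod.fst_add, Prod.snd_add, add_smul]; abel

theorem aut_abv (δ : MulAut F) : ∃ L : ℤ × ℤ ≃+ ℤ × ℤ, ∀ g, abv (δ g) = L (abv g) := by
  obtain ⟨L, hL⟩ := aut_abv_hom δ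
  obtain ⟨L', hL'⟩ := aut_abv_hom δ⁻¹
  refine ⟨{ toFun := L, invFun := L', left_inv := ?_, right_inv := ?_,
            map_add' := L.map_add }, hL⟩
  · intro z
    rw [← abv_surj z, ← hL, ← hL']; simp
  · intro z
    rw [← abv_surj z, ← hL', ← hL]; simp

theorem delta_exists (δ : MulAut F) (L : ℤ × ℤ ≃+ ℤ × ℤ) (hL : ∀ g, abv (δ g) = L (abv g)) :
    ∃ (k0 : ℤ × ℤ) (e : ℤ) (Δ : E →* E), e ≠ 0 ∧ (∀ x, δ (psi x) = psi (Δ x)) ∧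
      ∀ z, ∃ h, Δ (of z) = h * (of (L z + k0)) ^ e * h⁻¹ := by
  obtain ⟨f, s, hf⟩ := aut_com δ
  have hs : ∃ e : ℤ, e ≠ 0 ∧ sg s (com ga gb) = com ga gb ^ e := by
    cases s
    · exact ⟨-1, by simp, by simp [sg]⟩
    · exact ⟨1, by simp, by simp [sg]⟩
  obtain ⟨e, he, hs⟩ := hs
  rw [hs] at hf
  have key : ∀ z : ℤ × ℤ, ∃ w, δ (eF z) = psi (w * (of (L z + abv f)) ^ e * w⁻¹) := by
    intro z
    obtain ⟨w, hw⟩ := conj_com (δ (ga ^ z.1 * gb ^ z.2) * f)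
    refine ⟨w, ?_⟩
    rw [abv_mul, hL, abv_surj] at hw
    have h2 : w * (of (L z + abv f)) ^ e * w⁻¹ = (w * of (L z + abv f) * w⁻¹) ^ e :=
      conj_zpow.symm
    rw [h2, _root_.map_zpow, ← hw, conj_zpow]
    unfold eF
    rw [_root_.map_mul, _root_.map_mul, _root_.map_inv, hf]
    group
  choose w hw using key
  refine ⟨abv f, e, FreeGroup.lift fun z => w z * (of (L z + abv f)) ^ e * (w z)⁻¹, he, ?_,
    fun z => ⟨w z, by simp⟩⟩
  intro x
  have : δ.toMonoidHom.comp psi =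
      psi.comp (FreeGroup.lift fun z => w z * (of (L z + abv f)) ^ e * (w z)⁻¹) := by
    ext1 z
    have := hw z
    rw [← psi_of] at this
    rw [MonoidHom.comp_apply, MonoidHom.comp_apply, FreeGroup.lift_apply_of, ← this]
    rfl
  exact DFunLike.congr_fun this x

theorem conj_of_eq {x y : ℤ × ℤ} {e : ℤ} (he : e ≠ 0) {u v : E}
    (h : u * of x * u⁻¹ = v * of y ^ e * v⁻¹) : x = y := by
  by_contra hne
  let φ : E →* Multiplicative ℤ :=
    FreeGroup.lift fun t => if t = y then Multiplicative.ofAdd 1 else 1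
  have h2 := congrArg φ h
  simp [φ, hne] at h2
  apply he
  have := congrArg Multiplicative.toAdd h2
  simpa using this.symm

/-! ### The subgroup -/

section sub
variable {ι : Type} (s : ι → Fin 3 → ℤ × ℤ)

def theta : FreeGroup ι →* E :=
  FreeGroup.lift fun k => of (s k 0) * of (s k 1) * of (s k 2)

open Classical in
noncomputable def rho (i : ι → Fin 3) : E →* FreeGroup ι :=
  FreeGroup.lift fun t => if h : ∃ k, s k (i k) = t then of h.choose else 1

variable {s}

theorem rho_same (hs : ∀ k l i j, s k i = s l j → k = l ∧ i = j) (i : ι → Fin 3) (k : ι) :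
    rho s i (of (s k (i k))) = of k := by
  have h : ∃ k', s k' (i k') = s k (i k) := ⟨k, rfl⟩
  simp only [rho, FreeGroup.lift_apply_of]
  rw [dif_pos h, (hs _ _ _ _ h.choose_spec).1]

theorem rho_other (i : ι → Fin 3) (t : ℤ × ℤ) (h : ∀ k, s k (i k) ≠ t) :
    rho s i (of t) = 1 := by
  simp only [rho, FreeGroup.lift_apply_of]
  rw [dif_neg]
  push Not; exact h

theorem rho_theta (hs : ∀ k l i j, s k i = s l j → k = l ∧ i = j) (i : ι → Fin 3)
    (w : FreeGroup ι) : rho s i (theta s w) = w := by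
  have : (rho s i).comp (theta s) = MonoidHom.id _ := by
    ext1 k
    have h : ∀ j, rho s i (of (s k j)) = if j = i k then of k else 1 := by
      intro j
      split_ifs with hj
      · rw [hj]; exact rho_same hs i k
      · apply rho_other
        intro k' h'
        obtain ⟨rfl, h2⟩ := hs _ _ _ _ h'
        exact hj h2.symm
    simp only [MonoidHom.comp_apply, theta, FreeGroup.lift_apply_of, _root_.map_mul, h,
      MonoidHom.id_apply]
    generalize i k = j
    fin_cases j <;> simp
  exact DFunLike.congr_fun this w

theorem exists_triple (hs : ∀ k l i j, s k i = s l j → k = l ∧ i = j) (α : ℤ × ℤ → ℤ × ℤ)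
    (e : ℤ) (Δ : E →* E) (hΔ : ∀ z, ∃ h, Δ (of z) = h * (of (α z)) ^ e * h⁻¹)
    (w w' : FreeGroup ι) (hw : w' ≠ 1) (h : Δ (theta s w) = theta s w') :
    ∃ k, ∀ i, ∃ k' i', s k i = α (s k' i') := by
  by_contra hcon
  push Not at hcon
  choose i hi using hcon
  have h1 : ((rho s i).comp Δ).comp (theta s) = 1 := by
    ext1 k
    have h : ∀ j, rho s i (Δ (of (s k j))) = 1 := by
      intro j
      obtain ⟨g, hg⟩ := hΔ (s k j)
      rw [hg, _root_.map_mul, _root_.map_mul, _root_.map_zpow, rho_other _ _ (fun k' => hi k' k j)]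
      simp
    simp only [MonoidHom.comp_apply, theta, FreeGroup.lift_apply_of, _root_.map_mul, h,
      MonoidHom.one_apply, mul_one]
  apply hw
  rw [← rho_theta hs i w', ← h]
  exact DFunLike.congr_fun h1 w

end sub

/-! ### Malnormality of free factors / retracts of this kind -/

theorem of_comm {β : Type*} {a b : β} (h : of a * of b = of b * of a) : a = b := by
  classical
  by_contra hne
  let φ : FreeGroup β →* Equiv.Perm (Fin 3) :=
    FreeGroup.lift fun t => if t = a then Equiv.swap 0 1 else Equiv.swap 1 2
  have h2 := congrArg φ h
  simp only [φ, _root_.map_mul, FreeGroup.lift_apply_of, if_pos, if_neg (Ne.symm hne)] at h2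
  revert h2; decide

theorem subsingleton_cyclic {β : Type*} [Subsingleton β] :
    ∃ z : FreeGroup β, ∀ x, ∃ i : ℤ, x = z ^ i := by
  rcases isEmpty_or_nonempty β with hβ | ⟨⟨b⟩⟩
  · exact ⟨1, fun x => ⟨0, Subsingleton.elim _ _⟩⟩
  · refine ⟨of b, fun x => ?_⟩
    induction x using FreeGroup.induction_on with
    | C1 => exact ⟨0, by simp⟩
    | of i => exact ⟨1, by simp [Subsingleton.elim i b]⟩
    | inv_of i h => exact ⟨-1, by simp [Subsingleton.elim i b]⟩
    | mul x y hx hy =>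
      obtain ⟨i, rfl⟩ := hx
      obtain ⟨j, rfl⟩ := hy
      exact ⟨i + j, by rw [zpow_add]⟩

theorem comm_cyclic {β : Type} (x y : FreeGroup β) (h : x * y = y * x) :
    ∃ (z : FreeGroup β) (i j : ℤ), x = z ^ i ∧ y = z ^ j := by
  let H := Subgroup.closure ({x, y} : Set (FreeGroup β))
  have hcomm : ∀ a b : H, a * b = b * a := by
    have : IsMulCommutative H := by
      refine Subgroup.isMulCommutative_closure ?_
      rintro a (rfl | rfl) b (rfl | rfl) <;> first | rfl | exact h | exact h.symm
    intro a b
    exact mul_comm' a b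
  let eqv := IsFreeGroup.toFreeGroup H
  have : Subsingleton (IsFreeGroup.Generators H) := by
    refine ⟨fun a b => of_comm (eqv.symm.injective ?_)⟩
    rw [_root_.map_mul, _root_.map_mul, hcomm]
  obtain ⟨z, hz⟩ := subsingleton_cyclic (β := IsFreeGroup.Generators H)
  have hz' : ∀ a : H, ∃ i : ℤ, (a : FreeGroup β) = ((eqv.symm z : H) : FreeGroup β) ^ i := by
    intro a
    obtain ⟨i, hi⟩ := hz (eqv a)
    refine ⟨i, ?_⟩
    rw [← Subgroup.coe_zpow, ← _root_.map_zpow, ← hi, MulEquiv.symm_apply_apply]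
  obtain ⟨i, hi⟩ := hz' ⟨x, Subgroup.subset_closure (by simp)⟩
  obtain ⟨j, hj⟩ := hz' ⟨y, Subgroup.subset_closure (by simp)⟩
  exact ⟨_, i, j, hi, hj⟩

theorem malnormal {β ι : Type} (θ : FreeGroup ι →* FreeGroup β) (π : FreeGroup β →* FreeGroup ι)
    (hπ : ∀ w, π (θ w) = w) (g : FreeGroup β) (w w' : FreeGroup ι) (hw : w ≠ 1)
    (h : g * θ w * g⁻¹ = θ w') : g = θ (π g) := by
  have hw' : w' = π g * w * (π g)⁻¹ := by
    rw [← hπ w', ← h]; simp [hπ]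
  let g' := (θ (π g))⁻¹ * g
  have hpg : π g' = 1 := by simp [g', hπ]
  have hc : g' * θ w = θ w * g' := by
    rw [hw', _root_.map_mul, _root_.map_mul, _root_.map_inv] at h
    have h2 : g * θ w = θ (π g) * θ w * (θ (π g))⁻¹ * g := by rw [← h]; group
    simp only [g']
    rw [mul_assoc, h2]; group
  obtain ⟨z, i, j, hi, hj⟩ := comm_cyclic _ _ hc
  have h1 : (π z) ^ i = 1 := by rw [← _root_.map_zpow, ← hi, hpg]
  have h0 : i = 0 := by
    by_contra hi0
    have hz : π z = 1 := by
      exact (IsMulTorsionFree.zpow_eq_one_iff_left hi0).1 h1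
    apply hw
    rw [← hπ w, hj, _root_.map_zpow, hz, one_zpow]
  have : g' = 1 := by rw [hi, h0, zpow_zero]
  exact (inv_mul_eq_one.1 this).symm

/-! ### Arithmetic of the points `(2^m, 4^m)` -/

def pt (m : ℕ) : ℤ × ℤ := (2 ^ m, 4 ^ m)

theorem pow_sum : ∀ a b c d : ℕ, 2 ^ a + 2 ^ b = 2 ^ c + 2 ^ d →
    (a = c ∧ b = d) ∨ (a = d ∧ b = c) := by
  have inj : ∀ x y : ℕ, 2 ^ x = 2 ^ y → x = y := fun x y h =>
    Nat.pow_right_injective le_rfl h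
  have pos : ∀ x : ℕ, 1 ≤ 2 ^ x := fun x => Nat.one_le_two_pow
  intro a
  induction a with
  | zero =>
    intro b c d h
    rcases b with _ | b <;> rcases c with _ | c <;> rcases d with _ | d <;>
      simp only [pow_succ, pow_zero] at h
    · omega
    · have := pos d; omega
    · have := pos c; omega
    · have := pos c; have := pos d; omega
    · have := pos b; omega
    · have := inj b d (by omega); omega
    · have := inj b c (by omega); omega
    · omega
  | succ a ih =>
    intro b c d h
    have := pos a
    rcases b with _ | b <;> rcases c with _ | c <;> rcases d with _ | d <;>
      simp only [pow_succ, pow_zero] at h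
    · omega
    · have := inj a d (by omega); omega
    · have := inj a c (by omega); omega
    · omega
    · have := pos b; omega
    · omega
    · omega
    · have := ih b c d (by omega); omega

theorem pt_sub (m n : ℕ) : pt m - pt n = ((2 : ℤ) ^ m - 2 ^ n) • ((1, 2 ^ m + 2 ^ n) : ℤ × ℤ) := by
  have : ∀ m, (4 : ℤ) ^ m = 2 ^ m * 2 ^ m := by intro m; rw [← mul_pow]; norm_num
  ext
  · simp [pt]
  · simp [pt, this]; ring

theorem pt_dvd (L : ℤ × ℤ ≃+ ℤ × ℤ) (m m' n n' : ℕ) (h : pt m - pt m' = L (pt n - pt n')) :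
    (2 : ℤ) ^ n - 2 ^ n' ∣ 2 ^ m - 2 ^ m' := by
  rw [pt_sub, pt_sub, map_zsmul] at h
  have := congrArg Prod.fst h
  simp only [Prod.smul_fst, smul_eq_mul, mul_one] at this
  exact ⟨_, this⟩

theorem pt_pair (L : ℤ × ℤ ≃+ ℤ × ℤ) (k0 : ℤ × ℤ) (m m' n n' : ℕ) (h : pt m = L (pt n) + k0)
    (h' : pt m' = L (pt n') + k0) (hne : m ≠ m') : (m = n ∧ m' = n') ∨ (m = n' ∧ m' = n) := by
  have h1 : pt m - pt m' = L (pt n - pt n') := by rw [h, h', _root_.map_sub]; abel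
  have h2 : pt n - pt n' = L.symm (pt m - pt m') := by rw [h1]; simp
  have d1 := pt_dvd L _ _ _ _ h1
  have d2 := pt_dvd L.symm _ _ _ _ h2
  rcases Int.natAbs_eq_natAbs_iff.1 (Int.natAbs_eq_of_dvd_dvd d1 d2) with h | h
  · have h3 : 2 ^ m + 2 ^ n' = 2 ^ n + 2 ^ m' := by
      have : (2 : ℤ) ^ m + 2 ^ n' = 2 ^ n + 2 ^ m' := by linarith
      exact_mod_cast this
    have := pow_sum _ _ _ _ h3
    omega
  · have h3 : 2 ^ m + 2 ^ n = 2 ^ n' + 2 ^ m' := by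
      have : (2 : ℤ) ^ m + 2 ^ n = 2 ^ n' + 2 ^ m' := by linarith
      exact_mod_cast this
    have := pow_sum _ _ _ _ h3
    omega

theorem pt_triple (L : ℤ × ℤ ≃+ ℤ × ℤ) (k0 : ℤ × ℤ) (m0 m1 m2 n0 n1 n2 : ℕ)
    (h0 : pt m0 = L (pt n0) + k0) (h1 : pt m1 = L (pt n1) + k0) (h2 : pt m2 = L (pt n2) + k0)
    (h01 : m0 ≠ m1) (h02 : m0 ≠ m2) (h12 : m1 ≠ m2) : (∀ z, L z = z) ∧ k0 = 0 := by
  have e01 := pt_pair L k0 _ _ _ _ h0 h1 h01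
  have e02 := pt_pair L k0 _ _ _ _ h0 h2 h02
  have e12 := pt_pair L k0 _ _ _ _ h1 h2 h12
  obtain rfl : m0 = n0 := by omega
  obtain rfl : m1 = n1 := by omega
  obtain rfl : m2 = n2 := by omega
  have nz : ∀ a b : ℕ, a ≠ b → (2 : ℤ) ^ a - 2 ^ b ≠ 0 := by
    intro a b hab h
    apply hab
    have : (2 : ℤ) ^ a = 2 ^ b := by linarith
    exact Nat.pow_right_injective le_rfl (by exact_mod_cast this)
  have fixd : ∀ a b : ℕ, a ≠ b → pt a = L (pt a) + k0 → pt b = L (pt b) + k0 →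
      L (1, 2 ^ a + 2 ^ b) = (1, 2 ^ a + 2 ^ b) := by
    intro a b hab ha hb
    have h : L (pt a - pt b) = pt a - pt b := by
      conv_rhs => rw [ha, hb]
      rw [_root_.map_sub]; abel
    rw [pt_sub, map_zsmul] at h
    exact smul_right_injective _ (nz a b hab) h
  have f01 := fixd _ _ h01 h0 h1
  have f02 := fixd _ _ h02 h0 h2
  have fb : L (0, 1) = (0, 1) := by
    have h : L ((2 ^ m1 - 2 ^ m2 : ℤ) • ((0, 1) : ℤ × ℤ)) = (2 ^ m1 - 2 ^ m2 : ℤ) • ((0, 1) : ℤ × ℤ) := by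
      have e : (2 ^ m1 - 2 ^ m2 : ℤ) • ((0, 1) : ℤ × ℤ) =
          (1, 2 ^ m0 + 2 ^ m1) - (1, 2 ^ m0 + 2 ^ m2) := by ext <;> simp
      rw [e, _root_.map_sub, f01, f02]
    rw [map_zsmul] at h
    exact smul_right_injective _ (nz _ _ h12) h
  have fa : L (1, 0) = (1, 0) := by
    have e : ((1, 0) : ℤ × ℤ) = (1, 2 ^ m0 + 2 ^ m1) - (2 ^ m0 + 2 ^ m1 : ℤ) • ((0, 1) : ℤ × ℤ) := by
      ext <;> simp
    rw [e, _root_.map_sub, map_zsmul, f01, fb]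
  have hL : ∀ z, L z = z := by
    intro z
    have e : z = z.1 • ((1, 0) : ℤ × ℤ) + z.2 • ((0, 1) : ℤ × ℤ) := by ext <;> simp
    rw [e, _root_.map_add, map_zsmul, map_zsmul, fa, fb]
  refine ⟨hL, ?_⟩
  rw [hL] at h0
  simpa using h0

theorem pt_inj {m n : ℕ} (h : pt m = pt n) : m = n := by
  have := congrArg Prod.fst h
  simp only [pt] at this
  exact Nat.pow_right_injective le_rfl (by exact_mod_cast this)

theorem main {ι : Type} (enc : ι → ℕ) (henc : Function.Injective enc) :
    ∃ M : Subgroup F, Malcharacteristic M ∧ Nonempty (↥M ≃* FreeGroup ι) := by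
  let s : ι → Fin 3 → ℤ × ℤ := fun k i => pt (3 * enc k + i.val)
  have hs : ∀ k l i j, s k i = s l j → k = l ∧ i = j := by
    intro k l i j h
    have h := pt_inj h
    have hi := i.isLt
    have hj := j.isLt
    exact ⟨henc (by omega), Fin.ext (by omega)⟩
  have hret := rho_theta hs (fun _ => 0)
  have hinj : Function.Injective (psi.comp (theta s)) := by
    rw [MonoidHom.coe_comp]
    exact psi_injective.comp (Function.LeftInverse.injective hret)
  refine ⟨(psi.comp (theta s)).range, ?_, ⟨(MonoidHom.ofInjective hinj).symm⟩⟩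
  rintro δ ⟨_, ⟨w, rfl⟩, hx, ⟨w', hw'⟩⟩
  have hw0 : w ≠ 1 := by rintro rfl; simp at hx
  have hw1 : w' ≠ 1 := by
    rintro rfl
    rw [_root_.map_one] at hw'
    exact hx ((map_eq_one_iff δ δ.injective).1 hw'.symm)
  obtain ⟨L, hL⟩ := aut_abv δ
  obtain ⟨k0, e, Δ, he, hΔ, hΔ2⟩ := delta_exists δ L hL
  simp only [MonoidHom.comp_apply] at hw'
  obtain ⟨k, hk⟩ := exists_triple hs (fun z => L z + k0) e Δ hΔ2 w w' hw1
    (psi_injective (by rw [← hΔ, hw']))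
  obtain ⟨a0, b0, h0⟩ := hk 0
  obtain ⟨a1, b1, h1⟩ := hk 1
  obtain ⟨a2, b2, h2⟩ := hk 2
  obtain ⟨hid, rfl⟩ := pt_triple L k0 _ _ _ _ _ _ h0 h1 h2 (by simp) (by simp) (by simp)
  obtain ⟨g, hg⟩ := aut_inner δ (by rw [hL, hid, abv_ga]) (by rw [hL, hid, abv_gb])
  have habv : abv g = 0 := by
    obtain ⟨u, hu⟩ := conj_com g
    obtain ⟨v, hv⟩ := hΔ2 0
    rw [hid, add_zero] at hv
    have h3 : psi (of 0) = com ga gb := by rw [psi_of]; simp [eF]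
    have h4 := hΔ (of 0)
    rw [h3, hg, hu, hv] at h4
    exact conj_of_eq he (psi_injective h4)
  obtain ⟨g0, rfl⟩ := mem_range_of_abv g habv
  have h5 : g0 * theta s w * g0⁻¹ = theta s w' := by
    apply psi_injective
    rw [hw', hg]; simp
  have h6 := malnormal (theta s) _ hret g0 w w' hw0 h5
  refine ⟨(psi g0)⁻¹, inv_mem ⟨_, by rw [MonoidHom.comp_apply, ← h6]⟩, fun h => ?_⟩
  rw [hg, inv_inv]

end MalChar

theorem prop_malchar_free_arb_rank :
    ∀ n : Cardinal, 1 ≤ n → n ≤ Cardinal.aleph0 →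
      ∃ M : Subgroup (FreeGroup (Fin 2)), Malcharacteristic M ∧ IsFreeOfRank M n := by
  intro n _ hn
  have hc : Cardinal.mk n.out ≤ Cardinal.aleph0 := by rw [Cardinal.mk_out]; exact hn
  have : Countable n.out := Cardinal.mk_le_aleph0_iff.1 hc
  obtain ⟨enc, henc⟩ := exists_injective_nat n.out
  obtain ⟨M, hM, hF⟩ := MalChar.main enc henc
  exact ⟨M, hM, n.out, Cardinal.mk_out n, hF⟩
end
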